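/- Let N ≥ 3, μ = μ₀ = (N-2)²/4, and let V ∈ C^γ_loc(ℝ^N∖{0}) (γ ∈ (0,1)) be a positive potential satisfying |x|^{-2} - c ≤ V(x) ≤ |x|^{-2} for all x ∈ ℝ^N∖{0} for some c > 0, and limsup_{|x|→+∞} V(x)|x|² = ϱ < 1. Then L_{μ₀V} has a positive fundamental solution; for every k > 0 there exists a minimal positive classical solution u_k of -Δu - μ₀Vu = 0 in ℝ^N∖{0} satisfying the dμ-distributional identity with constant k, with lim_{x→0} u_k(x)·(|x|^{-(N-2)/2}(-ln|x|))^{-1} = k, and for every μ' ∈ (ϱμ₀, μ₀) there exists c₁₀ > 0 such that u_k(x) ≤ c₁₀|x|^{τ₋(μ')} for all x ∈ ℝ^N with |x| ≥ 1. -/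

import Mathlib

open Filter MeasureTheory Metric

noncomputable section

/-- Euclidean space ℝ^N. -/
abbrev Euc (N : ℕ) : Type := EuclideanSpace ℝ (Fin N)

/-- The Laplacian of `u` at `x`, as the sum of the pure second derivatives in the
coordinate directions. -/
def lap {N : ℕ} (u : Euc N → ℝ) (x : Euc N) : ℝ :=
  ∑ i : Fin N, fderiv ℝ (fun y => fderiv ℝ u y (EuclideanSpace.single i 1)) x
    (EuclideanSpace.single i 1)

/-- μ₀ = (N-2)²/4. -/
def mu0 (N : ℕ) : ℝ := ((N : ℝ) - 2) ^ 2 / 4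

/-- τ₋(μ) = -(N-2)/2 - √(μ₀-μ). -/
def tauMinus (N : ℕ) (μ : ℝ) : ℝ := -((N : ℝ) - 2) / 2 - Real.sqrt (mu0 N - μ)

/-- τ₊(μ) = -(N-2)/2 + √(μ₀-μ). -/
def tauPlus (N : ℕ) (μ : ℝ) : ℝ := -((N : ℝ) - 2) / 2 + Real.sqrt (mu0 N - μ)

/-- Surface area of the unit sphere in ℝ^N, i.e. N times the volume of the unit ball. -/
def sphereArea (N : ℕ) : ℝ := N * (volume (ball (0 : Euc N) 1)).toReal

/-- The normalizing constant c_μ: 2√(μ₀-μ)|𝕊^{N-1}| for μ < μ₀ and |𝕊^{N-1}| for μ = μ₀. -/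
def cMu (N : ℕ) (μ : ℝ) : ℝ :=
  if μ < mu0 N then 2 * Real.sqrt (mu0 N - μ) * sphereArea N else sphereArea N

/-- The normalizing constant c_N = ((N-2)|𝕊^{N-1}|)⁻¹ of the fundamental solution of -Δ. -/
def cN (N : ℕ) : ℝ := (((N : ℝ) - 2) * sphereArea N)⁻¹

/-- The singular profile Φ_μ: |x|^{τ₋(μ)} for μ < μ₀ and |x|^{-(N-2)/2}(-ln|x|) for μ = μ₀. -/
def PhiFun (N : ℕ) (μ : ℝ) (x : Euc N) : ℝ :=
  if μ < mu0 N then ‖x‖ ^ tauMinus N μ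
  else ‖x‖ ^ (-((N : ℝ) - 2) / 2) * (-Real.log ‖x‖)

/-- The adjoint operator L*_μ ξ(x) = -Δξ(x) - 2τ₊(μ)|x|⁻² x·∇ξ(x). -/
def LstarMu (N : ℕ) (μ : ℝ) (ξ : Euc N → ℝ) (x : Euc N) : ℝ :=
  -lap ξ x - 2 * tauPlus N μ / ‖x‖ ^ 2 * fderiv ℝ ξ x x

/-- The adjoint operator L*_{μV} ξ = L*_μ ξ - μ(V - |x|⁻²)ξ. -/
def LstarMuV (N : ℕ) (μ : ℝ) (V ξ : Euc N → ℝ) (x : Euc N) : ℝ :=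
  LstarMu N μ ξ x - μ * (V x - ‖x‖ ^ (-2 : ℝ)) * ξ x

/-- A compactly supported C^{1,1} test function: compactly supported, differentiable,
with Lipschitz gradient. -/
def IsC11c {N : ℕ} (ξ : Euc N → ℝ) : Prop :=
  HasCompactSupport ξ ∧ Differentiable ℝ ξ ∧ ∃ L : NNReal, LipschitzWith L (fderiv ℝ ξ)

/-- The dμ-distributional identity with constant `k`. -/
def DistribIdentity (N : ℕ) (μ : ℝ) (V u : Euc N → ℝ) (k : ℝ) : Prop :=
  ∀ ξ : Euc N → ℝ, IsC11c ξ →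
    ∫ x : Euc N, u x * LstarMuV N μ V ξ x * ‖x‖ ^ tauPlus N μ = cMu N μ * k * ξ 0

/-- `u` is a classical solution of -Δu - μVu = 0 in ℝ^N∖{0}. -/
def IsSolution (N : ℕ) (μ : ℝ) (V u : Euc N → ℝ) : Prop :=
  ContDiffOn ℝ 2 u {x : Euc N | x ≠ 0} ∧
  ∀ x : Euc N, x ≠ 0 → -lap u x - μ * V x * u x = 0

/-- `f` is locally γ-Hölder continuous on `s`. -/
def LocHolderOn {N : ℕ} (γ : ℝ) (s : Set (Euc N)) (f : Euc N → ℝ) : Prop :=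
  ∀ x ∈ s, ∃ ε > 0, ∃ C > 0, ∀ y ∈ ball x ε ∩ s, ∀ z ∈ ball x ε ∩ s,
    |f y - f z| ≤ C * dist y z ^ γ

/-- The filter `‖x‖ → +∞` on ℝ^N. -/
def normAtTop (N : ℕ) : Filter (Euc N) := comap norm atTop

/-- Assumption (V): V is locally Hölder and positive on ℝ^N∖{0},
0 ≤ V(x) - |x|⁻² ≤ c₀, and limsup_{|x|→∞} V(x)|x|² = α. -/
def AssumpV (N : ℕ) (V : Euc N → ℝ) (α : ℝ) : Prop :=
  (∃ γ : ℝ, 0 < γ ∧ γ < 1 ∧ LocHolderOn γ {x : Euc N | x ≠ 0} V) ∧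
  (∀ x : Euc N, x ≠ 0 → 0 < V x) ∧
  (∃ c₀ : ℝ, 0 < c₀ ∧ ∀ x : Euc N, x ≠ 0 →
    0 ≤ V x - ‖x‖ ^ (-2 : ℝ) ∧ V x - ‖x‖ ^ (-2 : ℝ) ≤ c₀) ∧
  limsup (fun x : Euc N => V x * ‖x‖ ^ 2) (normAtTop N) = α

/-- Assumption (Ṽ): V is locally Hölder and positive on ℝ^N∖{0},
0 ≤ V(x) - |x|⁻² ≤ c₀, and liminf_{|x|→∞} V(x)|x|² = β. -/
def AssumpVtilde (N : ℕ) (V : Euc N → ℝ) (β : ℝ) : Prop :=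
  (∃ γ : ℝ, 0 < γ ∧ γ < 1 ∧ LocHolderOn γ {x : Euc N | x ≠ 0} V) ∧
  (∀ x : Euc N, x ≠ 0 → 0 < V x) ∧
  (∃ c₀ : ℝ, 0 < c₀ ∧ ∀ x : Euc N, x ≠ 0 →
    0 ≤ V x - ‖x‖ ^ (-2 : ℝ) ∧ V x - ‖x‖ ^ (-2 : ℝ) ≤ c₀) ∧
  liminf (fun x : Euc N => V x * ‖x‖ ^ 2) (normAtTop N) = β

/-- The potential V_ρ(x) = |x|⁻²(1 + ρ|x|²)/(1 + |x|²). -/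
def Vrho (N : ℕ) (ρ : ℝ) (x : Euc N) : ℝ :=
  ‖x‖ ^ (-2 : ℝ) * (1 + ρ * ‖x‖ ^ 2) / (1 + ‖x‖ ^ 2)

/-- Ω has C² boundary: it is the sublevel set of a C² function whose differential
does not vanish on the boundary. -/
def HasC2Boundary {N : ℕ} (Ω : Set (Euc N)) : Prop :=
  ∃ φ : Euc N → ℝ, ContDiff ℝ 2 φ ∧ Ω = {x | φ x < 0} ∧
    ∀ x ∈ frontier Ω, fderiv ℝ φ x ≠ 0

namespace CritHardy

open Topology
open scoped ContDiff

section

variable {N : ℕ}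

/-- The standard basis vector. -/
abbrev bv (i : Fin N) : Euc N := EuclideanSpace.single i (1 : ℝ)

/-! ### The Laplacian -/

lemma eventually_differentiableAt {u : Euc N → ℝ} {x : Euc N} (hu : ContDiffAt ℝ 2 u x) :
    ∀ᶠ y in 𝓝 x, DifferentiableAt ℝ u y :=
  (hu.eventually (by simp)).mono fun _ hy => hy.differentiableAt (by simp)

lemma differentiableAt_fderiv_apply {u : Euc N → ℝ} {x : Euc N} (hu : ContDiffAt ℝ 2 u x)
    (v : Euc N) : DifferentiableAt ℝ (fun y => fderiv ℝ u y v) x :=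
  ((hu.fderiv_right (m := 1) (by norm_num)).differentiableAt (by simp)).clm_apply
    (differentiableAt_const v)

lemma lap_congr {u v : Euc N → ℝ} {x : Euc N} (h : u =ᶠ[𝓝 x] v) : lap u x = lap v x := by
  unfold lap
  refine Finset.sum_congr rfl fun i _ => ?_
  have : (fun y => fderiv ℝ u y (bv i)) =ᶠ[𝓝 x] fun y => fderiv ℝ v y (bv i) := by
    filter_upwards [h.fderiv (𝕜 := ℝ)] with y hy
    rw [hy]
  rw [this.fderiv_eq]

lemma lap_add {u v : Euc N → ℝ} {x : Euc N} (hu : ContDiffAt ℝ 2 u x)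
    (hv : ContDiffAt ℝ 2 v x) : lap (fun y => u y + v y) x = lap u x + lap v x := by
  unfold lap
  rw [← Finset.sum_add_distrib]
  refine Finset.sum_congr rfl fun i _ => ?_
  have : (fun y => fderiv ℝ (fun y => u y + v y) y (bv i)) =ᶠ[𝓝 x]
      fun y => fderiv ℝ u y (bv i) + fderiv ℝ v y (bv i) := by
    filter_upwards [eventually_differentiableAt hu, eventually_differentiableAt hv] with y h1 h2
    rw [fderiv_fun_add h1 h2]; rfl
  rw [this.fderiv_eq, fderiv_fun_add (differentiableAt_fderiv_apply hu _)
    (differentiableAt_fderiv_apply hv _)]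
  rfl

lemma lap_const_mul {u : Euc N → ℝ} {x : Euc N} (a : ℝ) (hu : ContDiffAt ℝ 2 u x) :
    lap (fun y => a * u y) x = a * lap u x := by
  unfold lap
  rw [Finset.mul_sum]
  refine Finset.sum_congr rfl fun i _ => ?_
  have : (fun y => fderiv ℝ (fun y => a * u y) y (bv i)) =ᶠ[𝓝 x]
      fun y => a * fderiv ℝ u y (bv i) := by
    filter_upwards [eventually_differentiableAt hu] with y h1
    rw [fderiv_const_mul h1]; rfl
  rw [this.fderiv_eq, fderiv_const_mul (differentiableAt_fderiv_apply hu _)]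
  rfl

lemma lap_sub {u v : Euc N → ℝ} {x : Euc N} (hu : ContDiffAt ℝ 2 u x)
    (hv : ContDiffAt ℝ 2 v x) : lap (fun y => u y - v y) x = lap u x - lap v x := by
  have := lap_add hu (contDiffAt_const (c := (-1 : ℝ)) |>.mul hv)
  rw [lap_const_mul _ hv] at this
  simpa [sub_eq_add_neg] using this

lemma second_deriv_nonneg_of_isLocalMin {f : ℝ → ℝ} {x : ℝ} (hf : ContDiffAt ℝ 2 f x)
    (h : IsLocalMin f x) : 0 ≤ deriv (deriv f) x := by
  by_contra! hneg
  have h2 := isLocalMax_of_deriv_deriv_neg hneg h.deriv_eq_zero hf.continuousAt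
  have hc : f =ᶠ[𝓝 x] fun _ => f x := by
    filter_upwards [h, h2] with y h1 h2
    exact le_antisymm h2 h1
  have := hc.deriv.deriv_eq
  simp at this
  linarith

lemma lap_nonneg_of_isLocalMin {u : Euc N → ℝ} {x : Euc N} (hu : ContDiffAt ℝ 2 u x)
    (h : IsLocalMin u x) : 0 ≤ lap u x := by
  refine Finset.sum_nonneg fun i _ => ?_
  set ℓ : ℝ → Euc N := fun t => x + t • bv i with hℓ
  have hℓd : ∀ t, HasDerivAt ℓ (bv i) t := fun t => by
    have h := ((hasDerivAt_id t).smul_const (bv i)).const_add x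
    rw [one_smul] at h
    exact h
  have hℓ0 : ℓ 0 = x := by simp [hℓ]
  have hℓc : ContDiff ℝ 2 ℓ := by fun_prop
  have ht : Tendsto ℓ (𝓝 0) (𝓝 x) := by
    simpa [hℓ0] using hℓc.continuous.tendsto 0
  have hcd : ContDiffAt ℝ 2 (u ∘ ℓ) 0 := ContDiffAt.comp 0 (by rwa [hℓ0]) hℓc.contDiffAt
  have hmin : IsLocalMin (u ∘ ℓ) 0 := by
    filter_upwards [ht.eventually h] with t htt
    simpa [hℓ0] using htt
  have key := second_deriv_nonneg_of_isLocalMin hcd hmin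
  have e1 : deriv (u ∘ ℓ) =ᶠ[𝓝 0] fun t => fderiv ℝ u (ℓ t) (bv i) := by
    filter_upwards [ht.eventually (eventually_differentiableAt hu)] with t htt
    exact (htt.hasFDerivAt.comp_hasDerivAt t (hℓd t)).deriv
  rw [e1.deriv_eq] at key
  have e2 : HasDerivAt (fun t => fderiv ℝ u (ℓ t) (bv i))
      (fderiv ℝ (fun y => fderiv ℝ u y (bv i)) x (bv i)) 0 := by
    have := (differentiableAt_fderiv_apply hu (bv i)).hasFDerivAt
    rw [← hℓ0] at this
    have h3 := this.comp_hasDerivAt 0 (hℓd 0)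
    rw [hℓ0] at h3
    exact h3
  rwa [e2.deriv] at key

/-! ### Radial functions -/

lemma hasFDerivAt_radial {g : ℝ → ℝ} {g1 : ℝ} {x : Euc N} (h : HasDerivAt g g1 (‖x‖ ^ 2)) :
    HasFDerivAt (fun y : Euc N => g (‖y‖ ^ 2)) ((2 * g1) • innerSL ℝ x) x := by
  have h1 : HasFDerivAt (fun y : Euc N => ‖y‖ ^ 2) (2 • innerSL ℝ x) x :=
    (hasStrictFDerivAt_norm_sq x).hasFDerivAt
  have := h.comp_hasFDerivAt x h1
  have e : (2 * g1) • innerSL ℝ x = g1 • (2 • innerSL ℝ x) := by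
    rw [mul_comm, mul_smul, ofNat_smul_eq_nsmul]
  rw [e]
  exact this

lemma inner_bv (x : Euc N) (i : Fin N) : inner ℝ x (bv i) = x i := by
  simp [EuclideanSpace.inner_single_right]

lemma sum_sq_eq (x : Euc N) : ∑ i, x i ^ 2 = ‖x‖ ^ 2 := by
  rw [EuclideanSpace.norm_sq_eq]; simp

lemma hasFDerivAt_coord (x : Euc N) (i : Fin N) :
    HasFDerivAt (fun y : Euc N => y i) (EuclideanSpace.proj i : Euc N →L[ℝ] ℝ) x :=
  (EuclideanSpace.proj i : Euc N →L[ℝ] ℝ).hasFDerivAt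

lemma lap_radial {g g1 : ℝ → ℝ} {g2 : ℝ} {x : Euc N}
    (h1 : ∀ᶠ t in 𝓝 (‖x‖ ^ 2), HasDerivAt g (g1 t) t) (h2 : HasDerivAt g1 g2 (‖x‖ ^ 2)) :
    lap (fun y : Euc N => g (‖y‖ ^ 2)) x = 4 * ‖x‖ ^ 2 * g2 + 2 * N * g1 (‖x‖ ^ 2) := by
  have ht : Tendsto (fun y : Euc N => ‖y‖ ^ 2) (𝓝 x) (𝓝 (‖x‖ ^ 2)) :=
    (continuous_norm.pow 2).tendsto x
  have key : ∀ i : Fin N, fderiv ℝ (fun y => fderiv ℝ (fun y : Euc N => g (‖y‖ ^ 2)) y (bv i)) x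
      (bv i) = 4 * g2 * x i ^ 2 + 2 * g1 (‖x‖ ^ 2) := by
    intro i
    have e : (fun y => fderiv ℝ (fun y : Euc N => g (‖y‖ ^ 2)) y (bv i)) =ᶠ[𝓝 x]
        fun y => (2 * g1 (‖y‖ ^ 2)) * y i := by
      filter_upwards [ht.eventually h1] with y hy
      rw [(hasFDerivAt_radial hy).fderiv]
      simp only [smul_apply, innerSL_apply_apply, inner_bv, smul_eq_mul]
    rw [e.fderiv_eq]
    have h3 : HasFDerivAt (fun y : Euc N => (2 * g1 (‖y‖ ^ 2)) * y i) _ x :=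
      ((hasFDerivAt_radial h2).const_mul 2).mul (hasFDerivAt_coord x i)
    rw [h3.fderiv]
    simp [inner_bv]
    ring
  unfold lap
  simp_rw [key]
  rw [Finset.sum_add_distrib, ← Finset.mul_sum, sum_sq_eq]
  simp
  ring

lemma rpow_norm_eq (p : ℝ) (y : Euc N) : ‖y‖ ^ p = (‖y‖ ^ 2) ^ (p / 2) := by
  rw [← Real.rpow_natCast, ← Real.rpow_mul (norm_nonneg _)]
  congr 1; push_cast; ring

lemma lap_rpow_norm (p : ℝ) {x : Euc N} (hx : x ≠ 0) :
    lap (fun y : Euc N => ‖y‖ ^ p) x = p * (p + N - 2) * ‖x‖ ^ (p - 2) := by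
  have hx2 : 0 < ‖x‖ ^ 2 := by positivity
  simp_rw [rpow_norm_eq p]
  rw [lap_radial (g := fun t => t ^ (p / 2)) (g1 := fun t => (p / 2) * t ^ (p / 2 - 1))
    (g2 := (p / 2) * ((p / 2 - 1) * (‖x‖ ^ 2) ^ (p / 2 - 1 - 1)))
    ((eventually_gt_nhds hx2).mono fun t ht => Real.hasDerivAt_rpow_const (Or.inl ht.ne'))
    ((Real.hasDerivAt_rpow_const (Or.inl hx2.ne')).const_mul _)]
  rw [rpow_norm_eq (p - 2), show (p - 2) / 2 = p / 2 - 1 by ring, Real.rpow_sub_one hx2.ne' (p / 2 - 1)]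
  field_simp
  ring

lemma contDiffAt_rpow_norm (p : ℝ) {x : Euc N} (hx : x ≠ 0) {n : WithTop ℕ∞} :
    ContDiffAt ℝ n (fun y : Euc N => ‖y‖ ^ p) x :=
  (contDiffAt_norm ℝ hx).rpow_const_of_ne (norm_ne_zero_iff.2 hx)

lemma contDiffAt_log_norm {x : Euc N} (hx : x ≠ 0) {n : WithTop ℕ∞} :
    ContDiffAt ℝ n (fun y : Euc N => Real.log ‖y‖) x :=
  (contDiffAt_norm ℝ hx).log (norm_ne_zero_iff.2 hx)

/-! ### Comparison principle on the punctured space -/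

theorem comparison {w : Euc N → ℝ} (hc : ContinuousOn w {x | x ≠ 0})
    (h0 : ∀ᶠ x in 𝓝[≠] (0 : Euc N), 0 ≤ w x) (hinf : ∀ᶠ x in cocompact (Euc N), 0 ≤ w x)
    (h : ∀ x, x ≠ 0 → w x < 0 → ∃ φ : Euc N → ℝ, ContDiffAt ℝ 2 φ x ∧ φ x = w x ∧
      (∀ᶠ y in 𝓝 x, w y ≤ φ y) ∧ lap φ x < 0) :
    ∀ x, x ≠ 0 → 0 ≤ w x := by
  intro x₁ hx₁
  by_contra! hneg
  obtain ⟨a, ha, ha'⟩ : ∃ a > 0, ∀ x : Euc N, x ≠ 0 → ‖x‖ < a → 0 ≤ w x := by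
    rw [eventually_nhdsWithin_iff, Metric.eventually_nhds_iff] at h0
    obtain ⟨a, ha, h⟩ := h0
    exact ⟨a, ha, fun x hx hxa => h (by simpa using hxa) hx⟩
  obtain ⟨K, hK, hK'⟩ := mem_cocompact.1 hinf
  set S : Set (Euc N) := K ∩ {x | a ≤ ‖x‖} with hS
  have hScomp : IsCompact S := hK.inter_right (isClosed_le continuous_const continuous_norm)
  have hS0 : ∀ x ∈ S, x ≠ 0 := by
    rintro x ⟨-, hx⟩ rfl
    simp at hx; linarith
  have hout : ∀ x, x ≠ 0 → x ∉ S → 0 ≤ w x := by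
    intro x hx hxS
    by_cases hxK : x ∈ K
    · exact ha' x hx (by by_contra! hh; exact hxS ⟨hxK, hh⟩)
    · exact hK' hxK
  have hx₁S : x₁ ∈ S := by
    by_contra hh; linarith [hout x₁ hx₁ hh]
  obtain ⟨x₀, hx₀, hmin⟩ := hScomp.exists_isMinOn ⟨x₁, hx₁S⟩ (hc.mono hS0)
  have hw0 : w x₀ < 0 := lt_of_le_of_lt (hmin hx₁S) hneg
  obtain ⟨φ, hφ, hφ0, hφw, hφl⟩ := h x₀ (hS0 _ hx₀) hw0
  have : IsLocalMin φ x₀ := by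
    filter_upwards [hφw, (isOpen_ne (x := (0 : Euc N))).mem_nhds (hS0 _ hx₀)] with y hy hy0
    rw [hφ0]
    refine le_trans ?_ hy
    by_cases hyS : y ∈ S
    · exact hmin hyS
    · linarith [hout y hy0 hyS]
  linarith [lap_nonneg_of_isLocalMin hφ this]

/-! ### Local Hölder continuity -/

lemma LocHolderOn.continuousOn {γ : ℝ} (hγ : 0 < γ) {s : Set (Euc N)} {f : Euc N → ℝ}
    (hf : LocHolderOn γ s f) : ContinuousOn f s := by
  intro x hx
  obtain ⟨ε, hε, C, hC, h⟩ := hf x hx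
  rw [ContinuousWithinAt, tendsto_iff_dist_tendsto_zero]
  have hb : ∀ᶠ y in 𝓝[s] x, dist (f y) (f x) ≤ C * dist y x ^ γ := by
    filter_upwards [mem_nhdsWithin_of_mem_nhds (ball_mem_nhds x hε), self_mem_nhdsWithin] with y h1 h2
    exact h y ⟨h1, h2⟩ x ⟨mem_ball_self hε, hx⟩
  refine squeeze_zero' (Eventually.of_forall fun _ => dist_nonneg) hb ?_
  have : Tendsto (fun y => C * dist y x ^ γ) (𝓝 x) (𝓝 (C * dist x x ^ γ)) := by
    have h1 : Continuous fun y : Euc N => C * dist y x ^ γ :=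
      continuous_const.mul ((continuous_id.dist continuous_const).rpow_const fun _ => Or.inr hγ.le)
    exact h1.tendsto x
  simp [Real.zero_rpow hγ.ne'] at this
  exact this.mono_left nhdsWithin_le_nhds

lemma LocHolderOn.mul {γ : ℝ} (hγ : 0 < γ) {s : Set (Euc N)} {f g : Euc N → ℝ}
    (hf : LocHolderOn γ s f) (hg : LocHolderOn γ s g) :
    LocHolderOn γ s (fun x => f x * g x) := by
  intro x hx
  obtain ⟨ε₁, hε₁, C₁, hC₁, h₁⟩ := hf x hx
  obtain ⟨ε₂, hε₂, C₂, hC₂, h₂⟩ := hg x hx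
  set ε := min (min ε₁ ε₂) 1
  have hε : 0 < ε := by positivity
  refine ⟨ε, hε, (|g x| + C₂) * C₁ + (|f x| + C₁) * C₂, by positivity, ?_⟩
  rintro y ⟨hy, hys⟩ z ⟨hz, hzs⟩
  have hb1 : ∀ y, y ∈ ball x ε → y ∈ ball x ε₁ := fun y hy =>
    ball_subset_ball ((min_le_left _ _).trans (min_le_left _ _)) hy
  have hb2 : ∀ y, y ∈ ball x ε → y ∈ ball x ε₂ := fun y hy =>
    ball_subset_ball ((min_le_left _ _).trans (min_le_right _ _)) hy
  have h1p : ∀ y, y ∈ ball x ε → dist y x ^ γ ≤ 1 := fun y hy =>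
    Real.rpow_le_one dist_nonneg ((mem_ball.1 hy).le.trans (min_le_right _ _)) hγ.le
  have hfz : |f z| ≤ |f x| + C₁ := by
    have := h₁ z ⟨hb1 z hz, hzs⟩ x ⟨mem_ball_self hε₁, hx⟩
    have h3 := abs_sub_abs_le_abs_sub (f z) (f x)
    nlinarith [h1p z hz]
  have hgy : |g y| ≤ |g x| + C₂ := by
    have := h₂ y ⟨hb2 y hy, hys⟩ x ⟨mem_ball_self hε₂, hx⟩
    have h3 := abs_sub_abs_le_abs_sub (g y) (g x)
    nlinarith [h1p y hy]
  have e : f y * g y - f z * g z = g y * (f y - f z) + f z * (g y - g z) := by ring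
  rw [e]
  refine (abs_add_le _ _).trans ?_
  rw [abs_mul, abs_mul]
  have k1 := h₁ y ⟨hb1 y hy, hys⟩ z ⟨hb1 z hz, hzs⟩
  have k2 := h₂ y ⟨hb2 y hy, hys⟩ z ⟨hb2 z hz, hzs⟩
  calc _ ≤ (|g x| + C₂) * (C₁ * dist y z ^ γ) + (|f x| + C₁) * (C₂ * dist y z ^ γ) := by
        gcongr
    _ = _ := by ring

/-- Locally Lipschitz functions are locally Hölder. -/
lemma locHolderOn_of_lipschitz {γ : ℝ} (hγ : 0 < γ) (hγ1 : γ < 1) {s : Set (Euc N)}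
    {f : Euc N → ℝ} (h : ∀ x ∈ s, ∃ K : NNReal, ∃ t ∈ 𝓝 x, LipschitzOnWith K f t) :
    LocHolderOn γ s f := by
  intro x hx
  obtain ⟨K, t, ht, hK⟩ := h x hx
  obtain ⟨ε, hε, hεt⟩ := Metric.mem_nhds_iff.1 ht
  refine ⟨min ε (1 / 2), by positivity, K + 1, by positivity, ?_⟩
  rintro y ⟨hy, -⟩ z ⟨hz, -⟩
  have hb : ∀ y, y ∈ ball x (min ε (1 / 2)) → y ∈ t := fun y hy =>
    hεt (ball_subset_ball (min_le_left _ _) hy)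
  have h1 := hK.dist_le_mul y (hb y hy) z (hb z hz)
  have hd : dist y z ≤ 1 := by
    have h2 := (mem_ball.1 hy).le.trans (min_le_right _ _)
    have h3 := (mem_ball.1 hz).le.trans (min_le_right _ _)
    linarith [dist_triangle_right y z x]
  have h4 : dist y z ≤ dist y z ^ γ := by
    rcases eq_or_lt_of_le (dist_nonneg (x := y) (y := z)) with h0 | h0
    · rw [← h0, Real.zero_rpow hγ.ne']
    · simpa using Real.rpow_le_rpow_of_exponent_ge h0 hd hγ1.le
  have h5 := dist_nonneg (x := y) (y := z)
  rw [Real.dist_eq] at h1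
  calc _ ≤ (K : ℝ) * dist y z := h1
    _ ≤ (K + 1) * dist y z ^ γ := by
      gcongr; linarith

lemma locHolderOn_of_contDiffAt {γ : ℝ} (hγ : 0 < γ) (hγ1 : γ < 1) {s : Set (Euc N)}
    {f : Euc N → ℝ} (h : ∀ x ∈ s, ContDiffAt ℝ 1 f x) : LocHolderOn γ s f :=
  locHolderOn_of_lipschitz hγ hγ1 fun x hx => (h x hx).exists_lipschitzOnWith

lemma locHolderOn_comp {γ : ℝ} (hγ : 0 < γ) (hγ1 : γ < 1) {s : Set (Euc N)}
    {ψ : ℝ → ℝ} {ρ : Euc N → ℝ} {K : NNReal} (hρ : LipschitzWith K ρ)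
    (h : ∀ x ∈ s, ContDiffAt ℝ 1 ψ (ρ x)) : LocHolderOn γ s (fun x => ψ (ρ x)) :=
  locHolderOn_of_lipschitz hγ hγ1 fun x hx => by
    obtain ⟨L, t, ht, hL⟩ := (h x hx).exists_lipschitzOnWith
    exact ⟨L * K, ρ ⁻¹' t, hρ.continuous.continuousAt ht,
      hL.comp hρ.lipschitzOnWith fun _ hy => hy⟩

end

section

variable {N : ℕ}

/-! ### Convolution with compactly supported smooth functions -/

section cv
variable {F : Type*} [NormedAddCommGroup F] [NormedSpace ℝ F]

/-- Convolution of a scalar function with a vector-valued one. -/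
def cv (f : Euc N → ℝ) (g : Euc N → F) (x : Euc N) : F := ∫ t, f t • g (x - t)

lemma cv_eq (f : Euc N → ℝ) (g : Euc N → F) :
    cv f g = convolution f g (ContinuousLinearMap.lsmul ℝ ℝ) volume := rfl

lemma contDiff_cv {f : Euc N → ℝ} {g : Euc N → F} {n : ℕ∞} (hf : LocallyIntegrable f)
    (hg : ContDiff ℝ n g) (hgc : HasCompactSupport g) : ContDiff ℝ n (cv f g) := by
  rw [cv_eq]
  exact hgc.contDiff_convolution_right _ hf hg

lemma hasFDerivAt_cv {f : Euc N → ℝ} {g : Euc N → F} (hf : LocallyIntegrable f)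
    (hg : ContDiff ℝ 1 g) (hgc : HasCompactSupport g) (x : Euc N) :
    HasFDerivAt (cv f g) (cv f (fderiv ℝ g) x) x := by
  rw [cv_eq]
  exact hgc.hasFDerivAt_convolution_right _ hf hg x

lemma integrable_cv {f : Euc N → ℝ} {g : Euc N → F} (hf : LocallyIntegrable f)
    (hg : Continuous g) (hgc : HasCompactSupport g) (x : Euc N) :
    Integrable (fun t => f t • g (x - t)) :=
  (hgc.convolutionExists_right (ContinuousLinearMap.lsmul ℝ ℝ) hf hg x)

end cv

lemma contDiff_two_of_infty {g : Euc N → ℝ} (h : ContDiff ℝ ∞ g) : ContDiff ℝ 2 g := by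
  exact_mod_cast contDiff_infty.1 h 2

lemma hasCompactSupport_lap {g : Euc N → ℝ} (hgc : HasCompactSupport g) :
    HasCompactSupport (lap g) := by
  refine hgc.of_isClosed_subset (isClosed_tsupport _) (closure_minimal ?_ (isClosed_tsupport _))
  intro x hx
  by_contra hxg
  apply hx
  have : g =ᶠ[𝓝 x] fun _ => 0 := notMem_tsupport_iff_eventuallyEq.1 hxg
  rw [lap_congr this]
  simp [lap]

lemma continuous_lap {g : Euc N → ℝ} (hg : ContDiff ℝ 2 g) : Continuous (lap g) := by
  unfold lap
  refine continuous_finsetSum _ fun i _ => ?_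
  have h1 : ContDiff ℝ 1 (fun y => fderiv ℝ g y (bv i)) :=
    (hg.fderiv_right (m := 1) (by norm_num)).clm_apply contDiff_const
  exact ((h1.fderiv_right (m := 0) (by norm_num)).clm_apply contDiff_const).continuous

lemma contDiff_lap {g : Euc N → ℝ} (hg : ContDiff ℝ ∞ g) : ContDiff ℝ ∞ (lap g) := by
  unfold lap
  refine ContDiff.sum fun i _ => ?_
  have h1 : ContDiff ℝ ∞ (fun y => fderiv ℝ g y (bv i)) :=
    (hg.fderiv_right (m := ∞) (by norm_num)).clm_apply contDiff_const
  exact ((h1.fderiv_right (m := ∞) (by norm_num)).clm_apply contDiff_const)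

lemma fderiv_cv_apply {f g : Euc N → ℝ} (hf : LocallyIntegrable f)
    (hg : ContDiff ℝ 1 g) (hgc : HasCompactSupport g) (x v : Euc N) :
    fderiv ℝ (cv f g) x v = cv f (fun y => fderiv ℝ g y v) x := by
  rw [(hasFDerivAt_cv hf hg hgc x).fderiv]
  unfold cv
  have := integrable_cv hf (hg.continuous_fderiv (by norm_num)) (hgc.fderiv ℝ) x
  rw [ContinuousLinearMap.integral_apply this]
  rfl

lemma lap_cv {f g : Euc N → ℝ} (hf : LocallyIntegrable f)
    (hg : ContDiff ℝ 2 g) (hgc : HasCompactSupport g) (x : Euc N) :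
    lap (cv f g) x = cv f (lap g) x := by
  unfold lap
  have h1 : ∀ i, ContDiff ℝ 1 (fun y => fderiv ℝ g y (bv i)) := fun i =>
    (hg.fderiv_right (m := 1) (by norm_num)).clm_apply contDiff_const
  have hc1 : ∀ i : Fin N, HasCompactSupport (fun y => fderiv ℝ g y (bv i)) := fun i =>
    hgc.fderiv_apply ℝ _
  have e : ∀ i : Fin N, (fun y => fderiv ℝ (cv f g) y (bv i)) = cv f (fun y => fderiv ℝ g y (bv i)) :=
    fun i => funext fun y => fderiv_cv_apply hf (hg.of_le (by norm_num)) hgc y _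
  simp_rw [e]
  simp_rw [fderiv_cv_apply hf (h1 _) (hc1 _)]
  unfold cv
  simp_rw [smul_eq_mul, Finset.mul_sum]
  rw [integral_finsetSum]
  intro i _
  have h2 : Continuous (fun y => fderiv ℝ (fun y => fderiv ℝ g y (bv i)) y (bv i)) :=
    (((h1 i).fderiv_right (m := 0) (by norm_num)).clm_apply contDiff_const).continuous
  exact integrable_cv hf h2 ((hc1 i).fderiv_apply ℝ _) x

/-- Green's second identity for a compactly supported second factor. -/
lemma integral_mul_lap {φ ψ : Euc N → ℝ} (hφ : ContDiff ℝ 2 φ) (hψ : ContDiff ℝ 2 ψ)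
    (hψc : HasCompactSupport ψ) : ∫ y, φ y * lap ψ y = ∫ y, lap φ y * ψ y := by
  have d1 : ∀ {g : Euc N → ℝ}, ContDiff ℝ 2 g → ∀ i, ContDiff ℝ 1 (fun y => fderiv ℝ g y (bv i)) :=
    fun hg i => (hg.fderiv_right (m := 1) (by norm_num)).clm_apply contDiff_const
  have d2 : ∀ {g : Euc N → ℝ}, ContDiff ℝ 1 g → ∀ i, Continuous (fun y => fderiv ℝ g y (bv i)) :=
    fun hg i => ((hg.fderiv_right (m := 0) (by norm_num)).clm_apply contDiff_const).continuous
  have c1 : ∀ i : Fin N, HasCompactSupport (fun y => fderiv ℝ ψ y (bv i)) := fun i =>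
    hψc.fderiv_apply ℝ _
  have c2 : ∀ i : Fin N,
      HasCompactSupport (fun y => fderiv ℝ (fun y => fderiv ℝ ψ y (bv i)) y (bv i)) := fun i =>
    (c1 i).fderiv_apply ℝ _
  have hi : ∀ {a b : Euc N → ℝ}, Continuous a → Continuous b → HasCompactSupport b →
      Integrable (fun y => a y * b y) := fun ha hb hc =>
    (ha.mul hb).integrable_of_hasCompactSupport hc.mul_left
  have key : ∀ i : Fin N, ∫ y, φ y * fderiv ℝ (fun y => fderiv ℝ ψ y (bv i)) y (bv i) =
      ∫ y, fderiv ℝ (fun y => fderiv ℝ φ y (bv i)) y (bv i) * ψ y := by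
    intro i
    have hφ1 := hφ.of_le (m := 1) (by norm_num)
    have hψ1 := hψ.of_le (m := 1) (by norm_num)
    rw [integral_mul_fderiv_eq_neg_fderiv_mul_of_integrable
      (hi (d2 hφ1 i) (d1 hψ i).continuous (c1 i)) (hi hφ.continuous (d2 (d1 hψ i) i) (c2 i))
      (hi hφ.continuous (d1 hψ i).continuous (c1 i))
      (fun x _ => hφ.differentiable (by norm_num) x)
      (fun x _ => (d1 hψ i).differentiable (by norm_num) x)]
    rw [integral_mul_fderiv_eq_neg_fderiv_mul_of_integrable
      (hi (d2 (d1 hφ i) i) hψ.continuous hψc) (hi (d1 hφ i).continuous (d2 hψ1 i) (c1 i))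
      (hi (d1 hφ i).continuous hψ.continuous hψc)
      (fun x _ => (d1 hφ i).differentiable (by norm_num) x)
      (fun x _ => hψ.differentiable (by norm_num) x), neg_neg]
  unfold lap
  simp_rw [Finset.mul_sum, Finset.sum_mul]
  rw [integral_finsetSum, integral_finsetSum]
  · exact Finset.sum_congr rfl fun i _ => key i
  · exact fun i _ => hi (d2 (d1 hφ i) i) hψ.continuous hψc
  · exact fun i _ => hi hφ.continuous (d2 (d1 hψ i) i) (c2 i)

lemma lap_comp_affine {φ : Euc N → ℝ} (hφ : ContDiff ℝ 2 φ) (c : ℝ) (a y : Euc N) :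
    lap (fun y => φ (c • y + a)) y = c ^ 2 * lap φ (c • y + a) := by
  have h1 : ∀ {g : Euc N → ℝ}, Differentiable ℝ g → ∀ y v,
      fderiv ℝ (fun y => g (c • y + a)) y v = c * fderiv ℝ g (c • y + a) v := by
    intro g hg y v
    have hl : HasFDerivAt (fun y : Euc N => c • y + a) (c • ContinuousLinearMap.id ℝ (Euc N)) y :=
      ((hasFDerivAt_id y).const_smul c).add_const a
    have := ((hg (c • y + a)).hasFDerivAt.comp y hl).fderiv
    rw [Function.comp_def] at this
    rw [this]
    simp
  have hd := hφ.differentiable (by norm_num)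
  unfold lap
  rw [Finset.mul_sum]
  refine Finset.sum_congr rfl fun i _ => ?_
  simp_rw [h1 hd]
  have hd1 : Differentiable ℝ fun y => fderiv ℝ φ y (bv i) :=
    ((hφ.fderiv_right (m := 1) (by norm_num)).clm_apply contDiff_const).differentiable (by norm_num)
  have hd2 : Differentiable ℝ (fun y => fderiv ℝ φ (c • y + a) (bv i)) :=
    hd1.comp (by fun_prop)
  rw [fderiv_const_mul (hd2 y), smul_apply, h1 hd1]
  simp; ring

/-! ### The Newtonian kernel and its regularisations -/

/-- The Newtonian kernel, up to normalisation. -/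
def nk (x : Euc N) : ℝ := ‖x‖ ^ (2 - (N : ℝ))

/-- A smooth kernel which agrees with the Newtonian one outside the ball of radius `r`. -/
def sk (r : ℝ) (x : Euc N) : ℝ := nk x * Real.smoothTransition (2 * ‖x‖ ^ 2 / r ^ 2 - 1)

/-- The mollifier `-Δ (sk r)`. -/
def mo (r : ℝ) (x : Euc N) : ℝ := -lap (sk r) x

/-- The total mass of the mollifier. -/
def kap (N : ℕ) : ℝ := ∫ x : Euc N, mo 1 x

lemma nk_nonneg (x : Euc N) : 0 ≤ nk x := by unfold nk; positivity

lemma nk_pos {x : Euc N} (hx : x ≠ 0) : 0 < nk x :=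
  Real.rpow_pos_of_pos (norm_pos_iff.2 hx) _

lemma nk_smul {c : ℝ} (hc : 0 < c) (x : Euc N) : nk (c • x) = c ^ (2 - (N : ℝ)) * nk x := by
  rw [nk, norm_smul, Real.norm_of_nonneg hc.le, Real.mul_rpow hc.le (norm_nonneg _), nk]

lemma nk_le {x : Euc N} (hN : 3 ≤ N) {r : ℝ} (hr : 0 < r) (h : r ≤ ‖x‖) :
    nk x ≤ r ^ (2 - (N : ℝ)) := by
  have : (3 : ℝ) ≤ N := by exact_mod_cast hN
  exact Real.rpow_le_rpow_of_nonpos hr h (by linarith)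

lemma measurable_nk : Measurable (nk : Euc N → ℝ) := by
  unfold nk; fun_prop

lemma sk_nonneg (r : ℝ) (x : Euc N) : 0 ≤ sk r x :=
  mul_nonneg (nk_nonneg x) (Real.smoothTransition.nonneg _)

lemma sk_le (r : ℝ) (x : Euc N) : sk r x ≤ nk x :=
  mul_le_of_le_one_right (nk_nonneg x) (Real.smoothTransition.le_one _)

lemma sk_eq {r : ℝ} (hr : 0 < r) {x : Euc N} (h : r ≤ ‖x‖) : sk r x = nk x := by
  rw [sk, Real.smoothTransition.one_of_one_le, mul_one]
  have : r ^ 2 ≤ ‖x‖ ^ 2 := by gcongr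
  have h2 : 1 ≤ ‖x‖ ^ 2 / r ^ 2 := (one_le_div (by positivity)).2 this
  rw [mul_div_assoc]; linarith

lemma sk_eq_zero {r : ℝ} (hr : 0 < r) {x : Euc N} (h : 2 * ‖x‖ ^ 2 ≤ r ^ 2) : sk r x = 0 := by
  rw [sk, Real.smoothTransition.zero_of_nonpos, mul_zero]
  have : 2 * ‖x‖ ^ 2 / r ^ 2 ≤ 1 := (div_le_one (by positivity)).2 h
  linarith

lemma sk_scale {r : ℝ} (hr : 0 < r) (x : Euc N) :
    sk r x = r ^ (2 - (N : ℝ)) * sk 1 (r⁻¹ • x) := by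
  rw [sk, sk, nk_smul (inv_pos.2 hr), norm_smul, Real.norm_of_nonneg (inv_pos.2 hr).le,
    Real.inv_rpow hr.le]
  have : r ^ (2 - (N : ℝ)) ≠ 0 := (Real.rpow_pos_of_pos hr _).ne'
  rw [show 2 * (r⁻¹ * ‖x‖) ^ 2 / 1 ^ 2 - 1 = 2 * ‖x‖ ^ 2 / r ^ 2 - 1 by field_simp]
  field_simp

lemma contDiff_sk {r : ℝ} (hr : 0 < r) : ContDiff ℝ ∞ (sk r : Euc N → ℝ) := by
  rw [contDiff_iff_contDiffAt]
  intro x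
  by_cases hx : x = 0
  · subst hx
    have : (sk r : Euc N → ℝ) =ᶠ[𝓝 0] fun _ => 0 := by
      have hr2 : 2 * ‖(0 : Euc N)‖ ^ 2 < r ^ 2 := by
        rw [norm_zero]; nlinarith
      have ht : Tendsto (fun y : Euc N => 2 * ‖y‖ ^ 2) (𝓝 0) (𝓝 (2 * ‖(0 : Euc N)‖ ^ 2)) :=
        (continuous_const.mul (continuous_norm.pow 2)).tendsto 0
      filter_upwards [ht.eventually (gt_mem_nhds hr2)] with y hy
      exact sk_eq_zero hr hy.le
    exact contDiffAt_const.congr_of_eventuallyEq this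
  · refine (contDiffAt_rpow_norm _ hx).mul ?_
    refine Real.smoothTransition.contDiffAt.comp x ?_
    exact (((contDiffAt_const.mul (contDiff_norm_sq ℝ).contDiffAt).div_const _).sub contDiffAt_const)

lemma lap_nk {x : Euc N} (hx : x ≠ 0) : lap nk x = 0 := by
  have := lap_rpow_norm (2 - (N : ℝ)) hx
  rw [show (nk : Euc N → ℝ) = fun y => ‖y‖ ^ (2 - (N : ℝ)) from rfl, this]
  ring

lemma mo_eq_zero_of_lt {r : ℝ} (hr : 0 < r) {x : Euc N} (h : r < ‖x‖) : mo r x = 0 := by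
  have : sk r =ᶠ[𝓝 x] nk := by
    filter_upwards [continuous_norm.continuousAt.eventually (lt_mem_nhds h)] with y hy
    exact sk_eq hr (le_of_lt hy)
  rw [mo, lap_congr this, lap_nk (by rintro rfl; simp at h; linarith), neg_zero]

lemma mo_eq_zero_of_small {r : ℝ} (hr : 0 < r) {x : Euc N} (h : 2 * ‖x‖ ^ 2 < r ^ 2) :
    mo r x = 0 := by
  have : sk r =ᶠ[𝓝 x] fun _ => 0 := by
    have hc : Continuous fun y : Euc N => 2 * ‖y‖ ^ 2 := by fun_prop
    filter_upwards [hc.continuousAt.eventually (gt_mem_nhds h)] with y hy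
    exact sk_eq_zero hr (le_of_lt hy)
  rw [mo, lap_congr this]
  simp [lap]

lemma mo_support {r : ℝ} (hr : 0 < r) : Function.support (mo r : Euc N → ℝ) ⊆ closedBall 0 r := by
  intro x hx
  by_contra h
  exact hx (mo_eq_zero_of_lt hr (by simpa using h))

lemma hasCompactSupport_mo {r : ℝ} (hr : 0 < r) : HasCompactSupport (mo r : Euc N → ℝ) :=
  HasCompactSupport.of_support_subset_isCompact (isCompact_closedBall 0 r) (mo_support hr)

lemma contDiff_mo {r : ℝ} (hr : 0 < r) : ContDiff ℝ ∞ (mo r : Euc N → ℝ) :=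
  (contDiff_lap (contDiff_sk hr)).neg

lemma mo_scale {r : ℝ} (hr : 0 < r) (x : Euc N) :
    mo r x = (r ^ N)⁻¹ * mo 1 (r⁻¹ • x) := by
  have e : (sk r : Euc N → ℝ) = fun y => r ^ (2 - (N : ℝ)) * sk 1 (r⁻¹ • y + 0) := by
    funext y; rw [add_zero, sk_scale hr]
  have hs : ContDiff ℝ 2 (sk 1 : Euc N → ℝ) := contDiff_two_of_infty (contDiff_sk one_pos)
  have hs' : ContDiffAt ℝ 2 (fun y : Euc N => sk 1 (r⁻¹ • y + 0)) x :=
    (hs.comp (by fun_prop : ContDiff ℝ 2 fun y : Euc N => r⁻¹ • y + 0)).contDiffAt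
  rw [mo, e, lap_const_mul _ hs', lap_comp_affine hs, mo, add_zero,
    Real.rpow_sub hr, Real.rpow_natCast, Real.rpow_two]
  field_simp

lemma integral_mo {r : ℝ} (hr : 0 < r) : ∫ x : Euc N, mo r x = kap N := by
  simp_rw [mo_scale hr]
  rw [integral_const_mul, Measure.integral_comp_smul]
  simp only [finrank_euclideanSpace, Fintype.card_fin, inv_pow, inv_inv, smul_eq_mul]
  rw [abs_of_nonneg (by positivity), ← mul_assoc, inv_mul_cancel₀ (by positivity), one_mul, kap]

lemma mo_bound (N : ℕ) : ∃ C > 0, ∀ r > 0, ∀ x : Euc N, |mo r x| ≤ C * (r ^ N)⁻¹ := by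
  obtain ⟨C, hC⟩ := (hasCompactSupport_mo (N := N) one_pos).exists_bound_of_continuous
    (contDiff_mo one_pos).continuous
  refine ⟨|C| + 1, by positivity, fun r hr x => ?_⟩
  rw [mo_scale hr, abs_mul, abs_of_nonneg (by positivity), mul_comm]
  gcongr
  exact (hC _).trans ((le_abs_self C).trans (by linarith))

lemma locallyIntegrable_rpow (hN : 3 ≤ N) {p : ℝ} (hp : -(N : ℝ) < p) :
    LocallyIntegrable (fun x : Euc N => ‖x‖ ^ p) := by
  refine locallyIntegrable_of_norm_le_rpow (C := 1) (α := -p) (by simp; omega)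
    (by simp; linarith) (Eventually.of_forall fun x => ?_)
    (measurable_norm.pow_const p).aestronglyMeasurable
  rw [neg_neg, one_mul, Real.norm_of_nonneg (by positivity)]

lemma locallyIntegrable_nk (hN : 3 ≤ N) : LocallyIntegrable (nk : Euc N → ℝ) :=
  locallyIntegrable_rpow hN (by linarith)

end

section

variable {N : ℕ}

/-! ### The mass of the mollifier -/

lemma nontrivial_euc (hN : 3 ≤ N) : Nontrivial (Euc N) :=
  Module.nontrivial_of_finrank_pos (R := ℝ) (by simp; omega)

lemma kap_eq (hN : 3 ≤ N) : kap N = ((N : ℝ) - 2) * sphereArea N := by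
  set g : ℝ → ℝ := fun t => t ^ ((2 - (N : ℝ)) / 2) * Real.smoothTransition (2 * t - 1) with hg
  have hgs : ContDiff ℝ ∞ g := by
    rw [contDiff_iff_contDiffAt]
    intro t
    rcases lt_or_ge t (1 / 2) with h | h
    · have : g =ᶠ[𝓝 t] fun _ => 0 := by
        filter_upwards [gt_mem_nhds h] with s hs
        simp only [hg]
        rw [Real.smoothTransition.zero_of_nonpos (by linarith), mul_zero]
      exact contDiffAt_const.congr_of_eventuallyEq this
    · have ht : t ≠ 0 := by positivity
      have h1 : ContDiffAt ℝ ∞ (fun t : ℝ => t ^ ((2 - (N : ℝ)) / 2)) t :=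
        contDiffAt_id.rpow_const_of_ne ht
      have h2 : ContDiffAt ℝ ∞ (fun t : ℝ => Real.smoothTransition (2 * t - 1)) t :=
        Real.smoothTransition.contDiffAt.comp t (by fun_prop)
      exact h1.mul h2
  have hg1 : ContDiff ℝ ∞ (deriv g) := (contDiff_infty_iff_deriv.1 hgs).2
  have hg2 : Continuous (deriv (deriv g)) := ((contDiff_infty_iff_deriv.1 hg1).2).continuous
  have d0 : ∀ t, HasDerivAt g (deriv g t) t := fun t => (hgs.differentiable (by simp) t).hasDerivAt
  have d1 : ∀ t, HasDerivAt (deriv g) (deriv (deriv g) t) t :=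
    fun t => (hg1.differentiable (by simp) t).hasDerivAt
  have hE : (sk 1 : Euc N → ℝ) = fun y => g (‖y‖ ^ 2) := by
    funext y
    simp only [sk, nk, hg, one_pow, div_one]
    rw [rpow_norm_eq]
  set F : ℝ → ℝ := fun r => 4 * r ^ 2 * deriv (deriv g) (r ^ 2) + 2 * N * deriv g (r ^ 2) with hF
  have hmo : ∀ x : Euc N, mo 1 x = -F ‖x‖ := fun x => by
    rw [mo, hE, lap_radial (Eventually.of_forall d0) (d1 _)]
  set H : ℝ → ℝ := fun r => 2 * r ^ N * deriv g (r ^ 2) with hH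
  have hHd : ∀ r, HasDerivAt H (r ^ (N - 1) * F r) r := by
    intro r
    have h1 : HasDerivAt (fun r : ℝ => deriv g (r ^ 2)) _ r :=
      HasDerivAt.comp (h₂ := deriv g) (h := fun r : ℝ => r ^ 2) r (d1 (r ^ 2)) (hasDerivAt_pow 2 r)
    have h2 : HasDerivAt H _ r := ((hasDerivAt_pow N r).const_mul 2).mul h1
    convert h2 using 1
    simp only [hF]
    obtain ⟨M, rfl⟩ : ∃ M, N = M + 1 := ⟨N - 1, by omega⟩
    simp only [Nat.add_sub_cancel]
    push_cast
    ring
  have hFc : Continuous F := by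
    have := hg1.continuous
    fun_prop
  have hFz : ∀ r, 1 < r → F r = 0 := by
    intro r hr
    have := nontrivial_euc hN
    obtain ⟨x, hx⟩ := NormedSpace.exists_lt_norm ℝ (Euc N) 0
    set y : Euc N := (r / ‖x‖) • x with hy
    have hyr : ‖y‖ = r := by
      rw [hy, norm_smul, Real.norm_of_nonneg (by positivity)]; field_simp
    have := hmo y
    rw [mo_eq_zero_of_lt one_pos (by rw [hyr]; exact hr), hyr] at this
    linarith
  have hH0 : H 0 = 0 := by simp [hH]; left; omega
  have hH2 : H 2 = 2 - N := by
    have e : g =ᶠ[𝓝 ((2 : ℝ) ^ 2)] fun t => t ^ ((2 - (N : ℝ)) / 2) := by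
      filter_upwards [lt_mem_nhds (show (1 : ℝ) < 2 ^ 2 by norm_num)] with t ht
      simp only [hg]
      rw [Real.smoothTransition.one_of_one_le (by linarith), mul_one]
    have := (Real.hasDerivAt_rpow_const (x := (2 : ℝ) ^ 2) (p := (2 - (N : ℝ)) / 2)
      (Or.inl (by norm_num))).deriv
    simp only [hH]
    rw [e.deriv_eq, this, ← Real.rpow_natCast 2 2, ← Real.rpow_mul (by norm_num),
      show (2 : ℝ) ^ N = (2 : ℝ) ^ (N : ℝ) by rw [Real.rpow_natCast]]
    have : (2 : ℝ) ^ (N : ℝ) * 2 ^ (((2 : ℕ) : ℝ) * ((2 - (N : ℝ)) / 2 - 1)) = 1 := by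
      rw [← Real.rpow_add (by norm_num)]
      push_cast
      ring_nf
      simp
    linear_combination (2 - (N : ℝ)) * this
  have hint : ∫ r in Set.Ioi (0 : ℝ), r ^ (N - 1) • F r = 2 - N := by
    have e : ∫ r in Set.Ioi (0 : ℝ), r ^ (N - 1) • F r = ∫ r in Set.Ioc (0 : ℝ) 2, r ^ (N - 1) * F r := by
      refine (setIntegral_eq_of_subset_of_forall_sdiff_eq_zero measurableSet_Ioi
        Set.Ioc_subset_Ioi_self ?_)
      rintro r ⟨h0, h2⟩
      have : 1 < r := by
        by_contra! hh
        exact h2 ⟨h0, by linarith⟩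
      rw [hFz r this, smul_zero]
    rw [e, ← intervalIntegral.integral_of_le (by norm_num),
      intervalIntegral.integral_eq_sub_of_hasDerivAt (fun r _ => hHd r)
        (Continuous.intervalIntegrable (by fun_prop) _ _), hH0, hH2, sub_zero]
  rw [kap]
  simp_rw [hmo]
  have := nontrivial_euc hN
  rw [integral_neg, integral_fun_norm_addHaar, finrank_euclideanSpace, Fintype.card_fin, hint]
  simp only [sphereArea, measureReal_def, nsmul_eq_mul, smul_eq_mul]
  ring

lemma sphereArea_pos (hN : 3 ≤ N) : 0 < sphereArea N := by
  unfold sphereArea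
  have : 0 < (volume (ball (0 : Euc N) 1)).toReal :=
    ENNReal.toReal_pos (measure_ball_pos _ _ one_pos).ne' measure_ball_lt_top.ne
  have : (0 : ℝ) < N := by exact_mod_cast (by omega : 0 < N)
  positivity

lemma kap_pos (hN : 3 ≤ N) : 0 < kap N := by
  rw [kap_eq hN]
  have : (3 : ℝ) ≤ N := by exact_mod_cast hN
  exact mul_pos (by linarith) (sphereArea_pos hN)

lemma volume_closedBall_le (N : ℕ) : ∃ C > 0, ∀ r > 0, ∀ x : Euc N,
    (volume (closedBall x r)).toReal ≤ C * r ^ N := by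
  refine ⟨(volume (ball (0 : Euc N) 1)).toReal + 1, by positivity, fun r hr x => ?_⟩
  rw [Measure.addHaar_closedBall _ _ hr.le, finrank_euclideanSpace, Fintype.card_fin,
    ENNReal.toReal_mul, ENNReal.toReal_ofReal (by positivity), mul_comm]
  gcongr
  linarith

/-- The mollifiers converge to `kap N` times the Dirac mass. -/
lemma tendsto_integral_mo {g : Euc N → ℝ} (hg : Continuous g) (x : Euc N) :
    Tendsto (fun r => ∫ y, mo r (x - y) * g y) (𝓝[>] 0) (𝓝 (kap N * g x)) := by
  obtain ⟨C, hC, hCb⟩ := mo_bound N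
  obtain ⟨D, hD, hDb⟩ := volume_closedBall_le N
  have hCD : 0 < C * D := by positivity
  rw [Metric.tendsto_nhds]
  intro ε hε
  obtain ⟨δ, hδ, hδg⟩ := Metric.continuousAt_iff.1 hg.continuousAt (ε / (2 * (C * D)))
    (by positivity)
  filter_upwards [Ioo_mem_nhdsGT hδ] with r hr
  obtain ⟨hr0, hrδ⟩ := hr
  have hmc : Continuous (mo r : Euc N → ℝ) := (contDiff_mo hr0).continuous
  have hcs : HasCompactSupport (fun y => mo r (x - y)) :=
    (hasCompactSupport_mo hr0).comp_homeomorph (Homeomorph.subLeft x)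
  have h1 : Integrable (fun y => mo r (x - y) * g y) :=
    Continuous.integrable_of_hasCompactSupport (by fun_prop) hcs.mul_right
  have h2 : Integrable (fun y => mo r (x - y)) :=
    Continuous.integrable_of_hasCompactSupport (by fun_prop) hcs
  have e : ∫ y, mo r (x - y) = kap N := by
    rw [← integral_mo hr0, integral_sub_left_eq_self (fun y => mo r y) volume x]
  have e2 : (∫ y, mo r (x - y) * g y) - kap N * g x = ∫ y, mo r (x - y) * (g y - g x) := by
    rw [← e, ← integral_mul_const, ← integral_sub h1 (h2.mul_const _)]
    congr 1; funext y; ring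
  rw [Real.dist_eq, e2]
  have e3 : ∫ y, mo r (x - y) * (g y - g x) =
      ∫ y in closedBall x r, mo r (x - y) * (g y - g x) := by
    refine (setIntegral_eq_integral_of_forall_compl_eq_zero fun y hy => ?_).symm
    rw [mo_eq_zero_of_lt hr0, zero_mul]
    simpa [dist_eq_norm, norm_sub_rev] using hy
  rw [e3, ← Real.norm_eq_abs]
  have hb := norm_setIntegral_le_of_norm_le_const (s := closedBall x r) (μ := volume)
    (f := fun y => mo r (x - y) * (g y - g x)) (C := C * (r ^ N)⁻¹ * (ε / (2 * (C * D))))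
    measure_closedBall_lt_top (fun y hy => by
      rw [norm_mul]
      refine mul_le_mul (hCb r hr0 _) ?_ (norm_nonneg _) (by positivity)
      have := hδg (lt_of_le_of_lt (mem_closedBall.1 hy) hrδ)
      exact this.le)
  refine lt_of_le_of_lt hb ?_
  calc _ ≤ C * (r ^ N)⁻¹ * (ε / (2 * (C * D))) * (D * r ^ N) := by
        gcongr; exact hDb r hr0 x
    _ = ε / 2 := by field_simp
    _ < ε := by linarith

/-! ### Newtonian potentials of smooth functions -/

lemma integrable_nk_mul (hN : 3 ≤ N) {g : Euc N → ℝ} (hg : Continuous g)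
    (hgc : HasCompactSupport g) (x : Euc N) : Integrable (fun y => nk (x - y) * g y) := by
  have := integrable_cv (locallyIntegrable_nk hN) hg hgc x
  have h2 := this.comp_sub_left x
  simpa [smul_eq_mul] using h2

lemma integral_nk_mul_lap (hN : 3 ≤ N) {ψ : Euc N → ℝ} (hψ : ContDiff ℝ 2 ψ)
    (hψc : HasCompactSupport ψ) (x : Euc N) :
    ∫ y, nk (x - y) * lap ψ y = -(kap N * ψ x) := by
  have hlim : Tendsto (fun r => ∫ y, sk r (x - y) * lap ψ y) (𝓝[>] 0)
      (𝓝 (∫ y, nk (x - y) * lap ψ y)) := by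
    refine tendsto_integral_filter_of_dominated_convergence (fun y => ‖nk (x - y) * lap ψ y‖)
      ?_ ?_ (integrable_nk_mul hN (continuous_lap hψ) (hasCompactSupport_lap hψc) x).norm ?_
    · filter_upwards [self_mem_nhdsWithin] with r hr
      have h1 := (contDiff_sk (N := N) (r := r) hr).continuous
      have h2 := continuous_lap hψ
      exact Continuous.aestronglyMeasurable (by fun_prop)
    · refine Eventually.of_forall fun r => Eventually.of_forall fun y => ?_
      rw [norm_mul, norm_mul, Real.norm_of_nonneg (sk_nonneg _ _), Real.norm_of_nonneg (nk_nonneg _)]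
      gcongr
      exact sk_le _ _
    · have : ∀ᵐ y : Euc N, y ≠ x := by
        have := nontrivial_euc hN
        simp [ae_iff]
      filter_upwards [this] with y hy
      refine tendsto_const_nhds.congr' ?_
      have : 0 < ‖x - y‖ := norm_pos_iff.2 (sub_ne_zero.2 (Ne.symm hy))
      filter_upwards [Ioo_mem_nhdsGT this] with r hr
      rw [sk_eq hr.1 hr.2.le]
  have hlim2 := (tendsto_integral_mo hψ.continuous x).neg
  refine tendsto_nhds_unique hlim (hlim2.congr' ?_)
  filter_upwards [self_mem_nhdsWithin] with r hr
  have hs := contDiff_two_of_infty (contDiff_sk (N := N) (r := r) hr)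
  have e : ∀ y, lap (fun y => sk r (x - y)) y = -mo r (x - y) := by
    intro y
    have := lap_comp_affine hs (-1) x y
    simp only [neg_smul, one_smul, neg_add_eq_sub] at this
    rw [this, mo]; ring
  rw [integral_mul_lap (φ := fun y => sk r (x - y))
    (hs.comp (by fun_prop : ContDiff ℝ 2 fun y : Euc N => x - y)) hψ hψc, ← integral_neg]
  simp_rw [e, neg_mul]

/-- The regularised kernel is the potential of the mollifier. -/
lemma integral_nk_mul_mo (hN : 3 ≤ N) {R : ℝ} (hR : 0 < R) (x : Euc N) :
    ∫ y, nk (x - y) * mo R y = kap N * sk R x := by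
  have hN' : (3 : ℝ) ≤ N := by exact_mod_cast hN
  obtain ⟨C, hC, hCb⟩ := mo_bound N
  obtain ⟨D, hD, hDb⟩ := volume_closedBall_le N
  have hi : ∀ r > 0, Integrable (fun y : Euc N => nk (x - y) * mo r y) := fun r hr =>
    integrable_nk_mul hN (contDiff_mo hr).continuous (hasCompactSupport_mo hr) x
  have key : ∀ M, R < M → ∫ y, nk (x - y) * mo R y =
      kap N * (sk R x - sk M x) + ∫ y, nk (x - y) * mo M y := by
    intro M hM
    have hM0 := hR.trans hM
    have hsR := contDiff_two_of_infty (contDiff_sk (N := N) hR)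
    have hsM := contDiff_two_of_infty (contDiff_sk (N := N) hM0)
    have hc : HasCompactSupport fun y : Euc N => sk R y - sk M y := by
      refine HasCompactSupport.of_support_subset_isCompact (isCompact_closedBall 0 M) fun y hy => ?_
      by_contra h
      have h : M < ‖y‖ := by simpa using h
      exact hy (by simp only [sk_eq hR (hM.le.trans h.le), sk_eq hM0 h.le, sub_self])
    have := integral_nk_mul_lap hN (hsR.sub hsM) hc x
    have e : ∀ y : Euc N, lap (fun y => sk R y - sk M y) y = mo M y - mo R y := by
      intro y
      rw [lap_sub hsR.contDiffAt hsM.contDiffAt, mo, mo]; ring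
    simp_rw [e, mul_sub] at this
    rw [integral_sub (hi M hM0) (hi R hR)] at this
    linarith
  have hlim : Tendsto (fun M => kap N * (sk R x - sk M x) + ∫ y, nk (x - y) * mo M y) atTop
      (𝓝 (kap N * (sk R x - 0) + 0)) := by
    refine Tendsto.add (Tendsto.const_mul _ (Tendsto.sub tendsto_const_nhds ?_)) ?_
    · refine tendsto_const_nhds.congr' ?_
      filter_upwards [eventually_ge_atTop (2 * ‖x‖ + 1)] with M hM
      have hx := norm_nonneg x
      rw [sk_eq_zero (by linarith)]
      nlinarith
    · have hz : Tendsto (fun M : ℝ => C * D * (M / 2) ^ (-((N : ℝ) - 2))) atTop (𝓝 (C * D * 0)) :=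
        ((tendsto_rpow_neg_atTop (by linarith)).comp
          (tendsto_id.atTop_div_const two_pos)).const_mul _
      rw [mul_zero] at hz
      refine squeeze_zero_norm' ?_ hz
      filter_upwards [eventually_ge_atTop (8 * ‖x‖ + 1)] with M hM
      have hx := norm_nonneg x
      have hM0 : 0 < M := by linarith
      have e3 : ∫ y, nk (x - y) * mo M y = ∫ y in closedBall 0 M, nk (x - y) * mo M y := by
        refine (setIntegral_eq_integral_of_forall_compl_eq_zero fun y hy => ?_).symm
        rw [mo_eq_zero_of_lt hM0, mul_zero]
        simpa using hy
      rw [e3]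
      have hb := norm_setIntegral_le_of_norm_le_const (s := closedBall (0 : Euc N) M) (μ := volume)
        (f := fun y => nk (x - y) * mo M y) (C := (M / 2) ^ (2 - (N : ℝ)) * (C * (M ^ N)⁻¹))
        measure_closedBall_lt_top (fun y hy => by
          rw [norm_mul]
          by_cases hs : 2 * ‖y‖ ^ 2 < M ^ 2
          · rw [mo_eq_zero_of_small hM0 hs, norm_zero, mul_zero]; positivity
          · refine mul_le_mul ?_ (hCb M hM0 _) (norm_nonneg _) (by positivity)
            rw [Real.norm_of_nonneg (nk_nonneg _)]
            refine nk_le hN (by positivity) ?_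
            have h1 : 5 / 8 * M ≤ ‖y‖ := by
              by_contra! hh
              have := norm_nonneg y
              nlinarith
            have := norm_sub_norm_le y x
            rw [norm_sub_rev] at this
            linarith)
      refine hb.trans ?_
      calc _ ≤ (M / 2) ^ (2 - (N : ℝ)) * (C * (M ^ N)⁻¹) * (D * M ^ N) := by
            gcongr; exact hDb M hM0 0
        _ = _ := by rw [neg_sub]; field_simp
  rw [sub_zero, add_zero] at hlim
  refine tendsto_nhds_unique (tendsto_const_nhds.congr' ?_) hlim
  filter_upwards [eventually_gt_atTop R] with M hM using key M hM

end

section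

variable {N : ℕ}

/-! ### Dyadic decomposition of the singular part of the kernel -/

/-- The dyadic piece of the kernel at scale `r`. -/
def dy (r : ℝ) (x : Euc N) : ℝ := sk (r * (1 / 2)) x - sk r x

/-- The potential with the singular part of the kernel. -/
def trunc (R : ℝ) (f : Euc N → ℝ) (x : Euc N) : ℝ := ∫ t, f t * (nk (x - t) - sk R (x - t))

lemma contDiff_dy {r : ℝ} (hr : 0 < r) : ContDiff ℝ ∞ (dy r : Euc N → ℝ) :=
  (contDiff_sk (by positivity)).sub (contDiff_sk hr)

lemma dy_eq_zero {r : ℝ} (hr : 0 < r) {x : Euc N} (h : r ≤ ‖x‖) : dy r x = 0 := by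
  rw [dy, sk_eq (by positivity) (by linarith), sk_eq hr h, sub_self]

lemma hasCompactSupport_dy {r : ℝ} (hr : 0 < r) : HasCompactSupport (dy r : Euc N → ℝ) := by
  refine HasCompactSupport.of_support_subset_isCompact (isCompact_closedBall 0 r) fun y hy => ?_
  by_contra h
  have h : r < ‖y‖ := by simpa using h
  exact hy (dy_eq_zero hr h.le)

lemma dy_scale {r : ℝ} (hr : 0 < r) :
    (dy r : Euc N → ℝ) = fun x => r ^ (2 - (N : ℝ)) • dy 1 (r⁻¹ • x) := by
  funext x
  rw [dy, dy, sk_scale (by positivity), sk_scale hr, sk_scale (r := 1 * (1 / 2)) (by positivity),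
    Real.mul_rpow hr.le (by positivity), smul_smul, mul_inv, smul_eq_mul]
  norm_num
  rw [mul_comm r⁻¹]
  ring

lemma rpow_two_sub (N : ℕ) {r : ℝ} (hr : 0 < r) : r ^ (2 - (N : ℝ)) = r ^ 2 * (r ^ N)⁻¹ := by
  rw [Real.rpow_sub hr, Real.rpow_natCast, Real.rpow_two]; rfl

lemma fderiv_smul_comp_smul {F : Type*} [NormedAddCommGroup F] [NormedSpace ℝ F]
    {g : Euc N → F} (hg : Differentiable ℝ g) (a c : ℝ) :
    fderiv ℝ (fun x => a • g (c • x)) = fun x => (a * c) • fderiv ℝ g (c • x) := by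
  funext y
  rw [fderiv_fun_const_smul, fderiv_comp_smul, smul_smul]
  exact (hg.comp (by fun_prop : Differentiable ℝ fun y : Euc N => c • y)) y

lemma fderiv_dy {r : ℝ} (hr : 0 < r) : fderiv ℝ (dy r : Euc N → ℝ) =
    fun x => (r ^ (2 - (N : ℝ)) * r⁻¹) • fderiv ℝ (dy 1) (r⁻¹ • x) := by
  rw [dy_scale hr]
  exact fderiv_smul_comp_smul ((contDiff_dy one_pos).differentiable (by simp)) _ _

lemma fderiv_fderiv_dy {r : ℝ} (hr : 0 < r) : fderiv ℝ (fderiv ℝ (dy r : Euc N → ℝ)) =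
    fun x => (r ^ (2 - (N : ℝ)) * r⁻¹ * r⁻¹) • fderiv ℝ (fderiv ℝ (dy 1)) (r⁻¹ • x) := by
  have hs1 : ContDiff ℝ ∞ (fderiv ℝ (dy 1 : Euc N → ℝ)) :=
    (contDiff_dy one_pos).fderiv_right (by norm_num)
  rw [fderiv_dy hr]
  exact fderiv_smul_comp_smul (hs1.differentiable (by simp)) _ _

lemma exists_bound_smul_comp_smul {F : Type*} [NormedAddCommGroup F] [NormedSpace ℝ F]
    {g : Euc N → F} (hg : Continuous g) (hgc : HasCompactSupport g) :
    ∃ C > 0, ∀ a ≥ (0 : ℝ), ∀ x, ‖a • g x‖ ≤ C * a := by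
  obtain ⟨C, hC⟩ := hgc.exists_bound_of_continuous hg
  have := (norm_nonneg _).trans (hC 0)
  refine ⟨C + 1, by linarith, fun a ha x => ?_⟩
  rw [norm_smul, Real.norm_of_nonneg ha, mul_comm]
  exact mul_le_mul_of_nonneg_right ((hC x).trans (by linarith)) ha

lemma dy_bound (N : ℕ) : ∃ C > 0, ∀ r > 0, ∀ x : Euc N, ‖dy r x‖ ≤ C * (r ^ 2 * (r ^ N)⁻¹) ∧
    ‖fderiv ℝ (dy r) x‖ ≤ C * (r * (r ^ N)⁻¹) ∧
    ‖fderiv ℝ (fderiv ℝ (dy r)) x‖ ≤ C * (r ^ N)⁻¹ := by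
  have hs := contDiff_dy (N := N) one_pos
  have hc := hasCompactSupport_dy (N := N) one_pos
  have hs1 : ContDiff ℝ ∞ (fderiv ℝ (dy 1 : Euc N → ℝ)) := hs.fderiv_right (by norm_num)
  have hs2 : ContDiff ℝ ∞ (fderiv ℝ (fderiv ℝ (dy 1 : Euc N → ℝ))) := hs1.fderiv_right (by norm_num)
  obtain ⟨C0, p0, hC0⟩ := exists_bound_smul_comp_smul hs.continuous hc
  obtain ⟨C1, p1, hC1⟩ := exists_bound_smul_comp_smul hs1.continuous (hc.fderiv ℝ)
  obtain ⟨C2, p2, hC2⟩ := exists_bound_smul_comp_smul hs2.continuous ((hc.fderiv ℝ).fderiv ℝ)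
  refine ⟨C0 + C1 + C2, by linarith, fun r hr x => ⟨?_, ?_, ?_⟩⟩
  · rw [dy_scale hr]
    refine (hC0 _ (by positivity) _).trans ?_
    rw [rpow_two_sub N hr]
    gcongr
    linarith
  · rw [fderiv_dy hr]
    refine (hC1 _ (by positivity) _).trans ?_
    rw [rpow_two_sub N hr, show r ^ 2 * (r ^ N)⁻¹ * r⁻¹ = r * (r ^ N)⁻¹ by field_simp]
    gcongr
    linarith
  · rw [fderiv_fderiv_dy hr]
    refine (hC2 _ (by positivity) _).trans ?_
    rw [rpow_two_sub N hr, show r ^ 2 * (r ^ N)⁻¹ * r⁻¹ * r⁻¹ = (r ^ N)⁻¹ by field_simp]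
    gcongr
    linarith

section
variable {F : Type*} [NormedAddCommGroup F] [NormedSpace ℝ F]

lemma norm_integral_le_of_ball {G : Euc N → F} {x : Euc N} {r A : ℝ} (hA : 0 ≤ A) (hr : 0 < r)
    (h0 : ∀ t, r < ‖x - t‖ → G t = 0) (h1 : ∀ t, ‖x - t‖ ≤ r → ‖G t‖ ≤ A) {D : ℝ}
    (hD : ∀ r > 0, ∀ x : Euc N, (volume (closedBall x r)).toReal ≤ D * r ^ N) :
    ‖∫ t, G t‖ ≤ A * (D * r ^ N) := by
  have e : ∫ t, G t = ∫ t in closedBall x r, G t := by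
    refine (setIntegral_eq_integral_of_forall_compl_eq_zero fun y hy => h0 y ?_).symm
    simpa [dist_eq_norm, norm_sub_rev] using hy
  rw [e]
  refine (norm_setIntegral_le_of_norm_le_const measure_closedBall_lt_top fun t ht => h1 t ?_).trans
    (by gcongr; exact hD r hr x)
  simpa [dist_eq_norm, norm_sub_rev] using ht

lemma integral_fderiv_eq_zero {g : Euc N → F} [FiniteDimensional ℝ F] (hg : ContDiff ℝ 1 g)
    (hgc : HasCompactSupport g) : ∫ x, fderiv ℝ g x = 0 := by
  have hi : Integrable (fderiv ℝ g) :=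
    (hg.continuous_fderiv (by norm_num)).integrable_of_hasCompactSupport (hgc.fderiv ℝ)
  ext v
  rw [ContinuousLinearMap.integral_apply hi]
  have := integral_smul_fderiv_eq_neg_fderiv_smul_of_integrable (μ := (volume : Measure (Euc N)))
    (f := fun _ : Euc N => (1 : ℝ)) (g := g) (v := v) (by simp)
    (by simpa using hi.apply_continuousLinearMap v)
    (by simpa using hg.continuous.integrable_of_hasCompactSupport hgc)
    (fun x _ => by fun_prop) (fun x _ => hg.differentiable (by norm_num) x)
  simpa using this

end

lemma locallyIntegrable_of_bound {f : Euc N → ℝ} (hf : Measurable f) {M : ℝ}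
    (hM : ∀ x, |f x| ≤ M) : LocallyIntegrable f :=
  (locallyIntegrable_const M).mono hf.aestronglyMeasurable
    (Eventually.of_forall fun x => (hM x).trans (le_abs_self M))

lemma fderiv_cv {F : Type*} [NormedAddCommGroup F] [NormedSpace ℝ F]
    {f : Euc N → ℝ} {g : Euc N → F} (hf : LocallyIntegrable f)
    (hg : ContDiff ℝ 1 g) (hgc : HasCompactSupport g) : fderiv ℝ (cv f g) = cv f (fderiv ℝ g) :=
  funext fun x => (hasFDerivAt_cv hf hg hgc x).fderiv

lemma norm_cv_fderiv_le {F : Type*} [NormedAddCommGroup F] [NormedSpace ℝ F]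
    [FiniteDimensional ℝ F] {f : Euc N → ℝ} {g : Euc N → F} (hf : LocallyIntegrable f)
    (hg : ContDiff ℝ 1 g) (hgc : HasCompactSupport g) {r A B D : ℝ} {x : Euc N} (hA : 0 ≤ A)
    (hB : 0 ≤ B) (hr : 0 < r) (h0 : ∀ y, r < ‖y‖ → fderiv ℝ g y = 0)
    (h1 : ∀ y, ‖fderiv ℝ g y‖ ≤ B) (h2 : ∀ t, ‖x - t‖ ≤ r → |f t - f x| ≤ A)
    (hD : ∀ r > 0, ∀ x : Euc N, (volume (closedBall x r)).toReal ≤ D * r ^ N) :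
    ‖cv f (fderiv ℝ g) x‖ ≤ A * B * (D * r ^ N) := by
  have hi := integrable_cv hf (hg.continuous_fderiv (by norm_num)) (hgc.fderiv ℝ) x
  have hi2 : Integrable fun t => fderiv ℝ g (x - t) :=
    ((hg.continuous_fderiv (by norm_num)).integrable_of_hasCompactSupport
      (hgc.fderiv ℝ)).comp_sub_left x
  have e3 : cv f (fderiv ℝ g) x = ∫ t, (f t - f x) • fderiv ℝ g (x - t) := by
    simp_rw [sub_smul]
    rw [integral_sub hi (hi2.smul (f x) : Integrable fun t => f x • fderiv ℝ g (x - t)), integral_smul,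
      integral_sub_left_eq_self (fun t => fderiv ℝ g t) volume x,
      integral_fderiv_eq_zero hg hgc, smul_zero, sub_zero]
    rfl
  rw [e3]
  refine norm_integral_le_of_ball (x := x) (by positivity) hr
    (fun t ht => by rw [h0 _ ht, smul_zero]) (fun t ht => ?_) hD
  rw [norm_smul]
  exact mul_le_mul (h2 t ht) (h1 _) (norm_nonneg _) hA

lemma norm_cv_dy_le (N : ℕ) : ∃ C > 0, ∀ (f : Euc N → ℝ) (M : ℝ), Measurable f →
    (∀ x, |f x| ≤ M) → ∀ r > 0, ∀ x, ‖iteratedFDeriv ℝ 0 (cv f (dy r)) x‖ ≤ C * M * r ^ 2 ∧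
      ‖iteratedFDeriv ℝ 1 (cv f (dy r)) x‖ ≤ C * M * r ∧
      ∀ H γ : ℝ, 0 ≤ H → 0 < γ → (∀ y z, |f y - f z| ≤ H * dist y z ^ γ) →
        ‖iteratedFDeriv ℝ 2 (cv f (dy r)) x‖ ≤ C * H * r ^ γ := by
  obtain ⟨C, hC, hCb⟩ := dy_bound N
  obtain ⟨D, hD, hDb⟩ := volume_closedBall_le N
  refine ⟨C * D, by positivity, fun f M hf hM r hr x => ?_⟩
  have hM0 : 0 ≤ M := (abs_nonneg _).trans (hM 0)
  have hfl := locallyIntegrable_of_bound hf hM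
  have hs := contDiff_dy (N := N) hr
  have hs1 : ContDiff ℝ ∞ (fderiv ℝ (dy r : Euc N → ℝ)) := hs.fderiv_right (by norm_num)
  have hc := hasCompactSupport_dy (N := N) hr
  have hz1 : ∀ y : Euc N, r < ‖y‖ → dy r =ᶠ[𝓝 y] fun _ => 0 := fun y hy => by
    filter_upwards [continuous_norm.continuousAt.eventually (lt_mem_nhds hy)] with z hz
    exact dy_eq_zero hr (le_of_lt hz)
  have hz2 : ∀ y : Euc N, r < ‖y‖ → fderiv ℝ (dy r) =ᶠ[𝓝 y] fun _ => 0 := fun y hy => by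
    filter_upwards [(hz1 y hy).fderiv (𝕜 := ℝ)] with z hz
    rw [hz]; simp
  have hz3 : ∀ y : Euc N, r < ‖y‖ → fderiv ℝ (fderiv ℝ (dy r)) y = 0 := fun y hy => by
    rw [(hz2 y hy).fderiv_eq]; simp
  have hrN : (r ^ N)⁻¹ * r ^ N = 1 := inv_mul_cancel₀ (by positivity)
  have e1 := fderiv_cv hfl (hs.of_le (by norm_num)) hc
  have e2 := fderiv_cv hfl (hs1.of_le (by norm_num)) (hc.fderiv ℝ)
  refine ⟨?_, ?_, fun H γ hH hγ hfH => ?_⟩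
  · rw [norm_iteratedFDeriv_zero]
    refine (norm_integral_le_of_ball (x := x) (A := M * (C * (r ^ 2 * (r ^ N)⁻¹))) (by positivity) hr
      (fun t ht => by rw [(hz1 _ ht).eq_of_nhds, smul_zero])
      (fun t _ => by rw [norm_smul]; exact mul_le_mul (hM t) (hCb r hr _).1 (norm_nonneg _) hM0)
      hDb).trans (le_of_eq ?_)
    linear_combination (C * D * M * r ^ 2) * hrN
  · rw [← norm_iteratedFDeriv_fderiv, norm_iteratedFDeriv_zero, e1]
    refine (norm_integral_le_of_ball (x := x) (A := M * (C * (r * (r ^ N)⁻¹))) (by positivity) hr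
      (fun t ht => by rw [(hz2 _ ht).eq_of_nhds, smul_zero])
      (fun t _ => by rw [norm_smul]; exact mul_le_mul (hM t) (hCb r hr _).2.1 (norm_nonneg _) hM0)
      hDb).trans (le_of_eq ?_)
    linear_combination (C * D * M * r) * hrN
  · rw [← norm_iteratedFDeriv_fderiv, ← norm_iteratedFDeriv_fderiv, norm_iteratedFDeriv_zero, e1, e2]
    refine (norm_cv_fderiv_le hfl (hs1.of_le (by norm_num)) (hc.fderiv ℝ)
      (A := H * r ^ γ) (B := C * (r ^ N)⁻¹) (by positivity) (by positivity) hr hz3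
      (fun y => (hCb r hr y).2.2) (fun t ht => (hfH t x).trans ?_) hDb).trans (le_of_eq ?_)
    · rw [dist_comm, dist_eq_norm]
      gcongr
    linear_combination (C * D * H * r ^ γ) * hrN

lemma lap_eq_iteratedFDeriv {u : Euc N → ℝ} {x : Euc N} (hu : ContDiffAt ℝ 2 u x) :
    lap u x = ∑ i, iteratedFDeriv ℝ 2 u x ![bv i, bv i] := by
  unfold lap
  refine Finset.sum_congr rfl fun i _ => ?_
  have hd : DifferentiableAt ℝ (fderiv ℝ u) x :=
    (hu.fderiv_right (m := 1) (by norm_num)).differentiableAt (by simp)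
  rw [iteratedFDeriv_two_apply, fderiv_clm_apply hd (differentiableAt_const _)]
  simp

/-- The dyadic scales. -/
def sc (R : ℝ) (j : ℕ) : ℝ := R * (1 / 2) ^ j

lemma sc_pos {R : ℝ} (hR : 0 < R) (j : ℕ) : 0 < sc R j := by unfold sc; positivity

lemma sc_tendsto {R : ℝ} (hR : 0 < R) : Tendsto (sc R) atTop (𝓝[>] 0) := by
  refine tendsto_nhdsWithin_iff.2 ⟨?_, Eventually.of_forall fun j => sc_pos hR j⟩
  have := (tendsto_pow_atTop_nhds_zero_of_lt_one (r := (1 / 2 : ℝ)) (by norm_num)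
    (by norm_num)).const_mul R
  rwa [mul_zero] at this

lemma summable_sc_rpow {R : ℝ} (hR : 0 < R) {s : ℝ} (hs : 0 < s) :
    Summable fun j => sc R j ^ s := by
  have e : (fun j => sc R j ^ s) = fun j => R ^ s * ((1 / 2 : ℝ) ^ s) ^ j := by
    funext j
    rw [sc, Real.mul_rpow hR.le (by positivity), ← Real.rpow_natCast, ← Real.rpow_natCast,
      ← Real.rpow_mul (by norm_num), ← Real.rpow_mul (by norm_num), mul_comm s]
  rw [e]
  refine (summable_geometric_of_lt_one (by positivity) ?_).mul_left _
  exact Real.rpow_lt_one (by norm_num) (by norm_num) hs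

lemma sum_dy (R : ℝ) (J : ℕ) (x : Euc N) :
    ∑ j ∈ Finset.range J, dy (sc R j) x = sk (sc R J) x - sk R x := by
  have : ∀ j, dy (sc R j) x = sk (sc R (j + 1)) x - sk (sc R j) x := fun j => by
    rw [dy, sc, sc, pow_succ, mul_assoc]
  simp_rw [this]
  rw [Finset.sum_range_sub (fun j => sk (sc R j) x)]
  simp [sc]

lemma trunc_eq_tsum (hN : 3 ≤ N) {f : Euc N → ℝ} {M : ℝ} (hf : Measurable f)
    (hM : ∀ x, |f x| ≤ M) {R : ℝ} (hR : 0 < R) :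
    trunc R f = fun x => ∑' j, cv f (dy (sc R j)) x := by
  funext x
  have hfl := locallyIntegrable_of_bound hf hM
  have hM0 : 0 ≤ M := (abs_nonneg _).trans (hM 0)
  obtain ⟨C, hC, hCb⟩ := norm_cv_dy_le N
  have hsum : Summable fun j => cv f (dy (sc R j)) x := by
    refine Summable.of_norm_bounded (g := fun j => C * M * sc R j ^ 2) ?_ fun j => ?_
    · have := summable_sc_rpow hR two_pos
      simp_rw [Real.rpow_two] at this
      exact this.mul_left _
    · simpa using (hCb f M hf hM _ (sc_pos hR j) x).1
  refine tendsto_nhds_unique ?_ hsum.hasSum.tendsto_sum_nat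
  have e : ∀ J, ∑ j ∈ Finset.range J, cv f (dy (sc R j)) x =
      ∫ t, f t * (sk (sc R J) (x - t) - sk R (x - t)) := by
    intro J
    unfold cv
    rw [← integral_finsetSum]
    · simp_rw [← sum_dy, Finset.mul_sum, smul_eq_mul]
    · exact fun j _ => integrable_cv hfl (contDiff_dy (sc_pos hR j)).continuous
        (hasCompactSupport_dy (sc_pos hR j)) x
  simp_rw [e]
  have hbi : Integrable fun t : Euc N => M * (closedBall (0 : Euc N) R).indicator nk (x - t) := by
    have : Integrable ((closedBall (0 : Euc N) R).indicator nk) :=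
      ((locallyIntegrable_nk hN).integrableOn_isCompact (isCompact_closedBall 0 R)).integrable_indicator
        measurableSet_closedBall
    exact (this.comp_sub_left x).const_mul M
  have hscle : ∀ J, sc R J ≤ R := fun J => by
    unfold sc
    exact mul_le_of_le_one_right hR.le (pow_le_one₀ (by norm_num) (by norm_num))
  refine tendsto_integral_of_dominated_convergence _ (fun J => ?_) hbi (fun J => ?_) ?_
  · have h1 := (contDiff_sk (N := N) (sc_pos hR J)).continuous.measurable
    have h2 := (contDiff_sk (N := N) hR).continuous.measurable
    exact (by fun_prop : Measurable fun t => f t * (sk (sc R J) (x - t) - sk R (x - t))).aestronglyMeasurable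
  · refine Eventually.of_forall fun t => ?_
    rw [norm_mul]
    refine mul_le_mul (hM t) ?_ (norm_nonneg _) hM0
    by_cases h : x - t ∈ closedBall (0 : Euc N) R
    · rw [Set.indicator_of_mem h, Real.norm_eq_abs, abs_le]
      have := sk_nonneg (sc R J) (x - t)
      have := sk_nonneg R (x - t)
      have := sk_le (sc R J) (x - t)
      have := sk_le R (x - t)
      constructor <;> linarith
    · have h' : R ≤ ‖x - t‖ := by
        have : R < ‖x - t‖ := by simpa using h
        exact this.le
      rw [Set.indicator_of_notMem h, sk_eq (sc_pos hR J) ((hscle J).trans h'), sk_eq hR h']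
      simp
  · have := nontrivial_euc hN
    have : ∀ᵐ y : Euc N, y ≠ x := by simp [ae_iff]
    filter_upwards [this] with t ht
    refine tendsto_const_nhds.congr' ?_
    have hp : 0 < ‖x - t‖ := norm_pos_iff.2 (sub_ne_zero.2 (Ne.symm ht))
    filter_upwards [(sc_tendsto hR).eventually (Ioo_mem_nhdsGT hp)] with J hJ
    rw [sk_eq hJ.1 hJ.2.le]

lemma contDiff_cv_dy {f : Euc N → ℝ} {M : ℝ} (hf : Measurable f)
    (hM : ∀ x, |f x| ≤ M) {R : ℝ} (hR : 0 < R) (j : ℕ) : ContDiff ℝ ∞ (cv f (dy (sc R j))) :=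
  contDiff_cv (locallyIntegrable_of_bound hf hM) (contDiff_dy (sc_pos hR j))
    (hasCompactSupport_dy (sc_pos hR j))

lemma contDiff_one_trunc (hN : 3 ≤ N) {f : Euc N → ℝ} {M : ℝ} (hf : Measurable f)
    (hM : ∀ x, |f x| ≤ M) {R : ℝ} (hR : 0 < R) : ContDiff ℝ 1 (trunc R f) := by
  obtain ⟨C, hC, hCb⟩ := norm_cv_dy_le N
  rw [trunc_eq_tsum hN hf hM hR]
  refine contDiff_tsum (N := 1)
    (v := fun k j => if k = 0 then C * M * sc R j ^ 2 else C * M * sc R j)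
    (fun j => (contDiff_cv_dy hf hM hR j).of_le (by norm_num)) ?_ ?_
  · intro k hk
    by_cases h : k = 0
    · simp only [h, if_true]
      have := summable_sc_rpow hR two_pos
      simp_rw [Real.rpow_two] at this
      exact this.mul_left _
    · simp only [h, if_false]
      have := summable_sc_rpow hR one_pos
      simp_rw [Real.rpow_one] at this
      exact this.mul_left _
  · intro k j x hk
    have hk : k ≤ 1 := by exact_mod_cast hk
    have := hCb f M hf hM _ (sc_pos hR j) x
    interval_cases k
    · simpa using this.1
    · simpa using this.2.1

lemma trunc_holder (hN : 3 ≤ N) {f : Euc N → ℝ} {M : ℝ} (hf : Measurable f)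
    (hM : ∀ x, |f x| ≤ M) {H γ : ℝ} (hH : 0 ≤ H) (hγ : 0 < γ)
    (hfH : ∀ y z, |f y - f z| ≤ H * dist y z ^ γ) {R : ℝ} (hR : 0 < R) :
    ContDiff ℝ 2 (trunc R f) ∧ ∀ x, lap (trunc R f) x = cv f (mo R) x - kap N * f x := by
  obtain ⟨C, hC, hCb⟩ := norm_cv_dy_le N
  have hfl := locallyIntegrable_of_bound hf hM
  have hcd : ∀ j, ContDiff ℝ 2 (cv f (dy (sc R j))) :=
    fun j => contDiff_two_of_infty (contDiff_cv_dy hf hM hR j)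
  set v : ℕ → ℕ → ℝ := fun k j => if k = 0 then C * M * sc R j ^ 2 else if k = 1 then C * M * sc R j
      else C * H * sc R j ^ γ with hv
  have hvs : ∀ k : ℕ, (k : ℕ∞) ≤ 2 → Summable (v k) := by
    intro k _
    simp only [hv]
    by_cases h : k = 0
    · simp only [h, if_true]
      have := summable_sc_rpow hR two_pos
      simp_rw [Real.rpow_two] at this
      exact this.mul_left _
    · simp only [h, if_false]
      by_cases h' : k = 1
      · simp only [h', if_true]
        have := summable_sc_rpow hR one_pos
        simp_rw [Real.rpow_one] at this
        exact this.mul_left _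
      · simp only [h', if_false]
        exact (summable_sc_rpow hR hγ).mul_left _
  have hvb : ∀ (k : ℕ) (j : ℕ) (x : Euc N), (k : ℕ∞) ≤ 2 →
      ‖iteratedFDeriv ℝ k (cv f (dy (sc R j))) x‖ ≤ v k j := by
    intro k j x hk
    have hk : k ≤ 2 := by exact_mod_cast hk
    have := hCb f M hf hM _ (sc_pos hR j) x
    simp only [hv]
    interval_cases k
    · simpa using this.1
    · simpa using this.2.1
    · simpa using this.2.2 H γ hH hγ hfH
  have hcdt : ContDiff ℝ 2 (trunc R f) := by
    rw [trunc_eq_tsum hN hf hM hR]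
    exact contDiff_tsum (N := 2) hcd hvs hvb
  refine ⟨hcdt, fun x => ?_⟩
  have hfc : Continuous f := by
    rw [continuous_iff_continuousAt]
    intro x
    have hL : LocHolderOn γ Set.univ f := fun y _ =>
      ⟨1, one_pos, H + 1, by positivity, fun a _ b _ => (hfH a b).trans (by gcongr; linarith)⟩
    exact (LocHolderOn.continuousOn hγ hL).continuousAt univ_mem
  have hit : iteratedFDeriv ℝ 2 (trunc R f) = fun x => ∑' j, iteratedFDeriv ℝ 2 (cv f (dy (sc R j))) x := by
    rw [trunc_eq_tsum hN hf hM hR]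
    exact iteratedFDeriv_tsum (N := 2) hcd hvs hvb le_rfl
  have hs2 : Summable fun j => iteratedFDeriv ℝ 2 (cv f (dy (sc R j))) x :=
    Summable.of_norm_bounded (hvs 2 le_rfl) fun j => hvb 2 j x le_rfl
  have hsum : HasSum (fun j => lap (cv f (dy (sc R j))) x) (lap (trunc R f) x) := by
    rw [lap_eq_iteratedFDeriv hcdt.contDiffAt, hit]
    have el : ∀ j, lap (cv f (dy (sc R j))) x =
        ∑ i, iteratedFDeriv ℝ 2 (cv f (dy (sc R j))) x ![bv i, bv i] :=
      fun j => lap_eq_iteratedFDeriv (hcd j).contDiffAt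
    simp only [el]
    refine hasSum_sum fun i _ => ?_
    exact ContinuousMultilinearMap.hasSum_eval hs2.hasSum _
  refine tendsto_nhds_unique hsum.tendsto_sum_nat ?_
  have e : ∀ J, ∑ j ∈ Finset.range J, lap (cv f (dy (sc R j))) x =
      cv f (mo R) x - ∫ t, mo (sc R J) (x - t) * f t := by
    intro J
    have el : ∀ j, lap (cv f (dy (sc R j))) x = cv f (lap (dy (sc R j))) x :=
      fun j => lap_cv hfl (contDiff_two_of_infty (contDiff_dy (sc_pos hR j)))
        (hasCompactSupport_dy (sc_pos hR j)) x
    simp only [el]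
    have hi : ∀ r > 0, Integrable fun t => f t • mo r (x - t) := fun r hr =>
      integrable_cv hfl (contDiff_mo hr).continuous (hasCompactSupport_mo hr) x
    unfold cv
    rw [← integral_finsetSum]
    · have em : ∀ t, mo (sc R J) (x - t) * f t = f t • mo (sc R J) (x - t) := fun t => mul_comm _ _
      simp only [em]
      rw [← integral_sub (hi R hR) (hi _ (sc_pos hR J))]
      congr 1
      funext t
      rw [← Finset.smul_sum, ← smul_sub]
      congr 1
      have : ∀ r > 0, ∀ y : Euc N, lap (dy r) y = mo r y - mo (r * (1 / 2)) y := fun r hr y => by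
        have := lap_sub (x := y) (contDiff_two_of_infty (contDiff_sk (N := N)
          (show 0 < r * (1 / 2) by positivity))).contDiffAt
          (contDiff_two_of_infty (contDiff_sk (N := N) hr)).contDiffAt
        rw [show (dy r : Euc N → ℝ) = fun y => sk (r * (1 / 2)) y - sk r y from rfl, this, mo, mo]
        ring
      have el2 : ∀ j, lap (dy (sc R j)) (x - t) =
          mo (sc R j) (x - t) - mo (sc R j * (1 / 2)) (x - t) := fun j => this _ (sc_pos hR j) _
      simp only [el2]
      have e2 : ∀ j, sc R j * (1 / 2) = sc R (j + 1) := fun j => by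
        rw [sc, sc, pow_succ, mul_assoc]
      simp_rw [e2]
      rw [Finset.sum_range_sub' (fun j => mo (sc R j) (x - t))]
      simp [sc]
    · exact fun j _ => integrable_cv hfl
        (continuous_lap (contDiff_two_of_infty (contDiff_dy (sc_pos hR j))))
        (hasCompactSupport_lap (hasCompactSupport_dy (sc_pos hR j))) x
  simp_rw [e]
  exact tendsto_const_nhds.sub ((tendsto_integral_mo hfc x).comp (sc_tendsto hR))

end

section

variable {N : ℕ}

/-! ### Regularity of Newtonian potentials away from the origin -/

/-- The (unnormalised) Newtonian potential. -/
def pot (f : Euc N → ℝ) (x : Euc N) : ℝ := ∫ y, nk (x - y) * f y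

lemma pot_nonneg {f : Euc N → ℝ} (hf : ∀ x, 0 ≤ f x) (x : Euc N) : 0 ≤ pot f x :=
  integral_nonneg fun y => mul_nonneg (nk_nonneg _) (hf y)

lemma measurable_pot {f : Euc N → ℝ} (hf : Measurable f) : Measurable (pot f) := by
  have h : Measurable fun p : Euc N × Euc N => nk (p.1 - p.2) * f p.2 :=
    (measurable_nk.comp (measurable_fst.sub measurable_snd)).mul (hf.comp measurable_snd)
  exact (h.stronglyMeasurable.integral_prod_right).measurable

lemma ae_ne_zero (hN : 3 ≤ N) : ∀ᵐ x : Euc N, x ≠ 0 := by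
  have := nontrivial_euc hN
  simp [ae_iff]

lemma cv_pot (hN : 3 ≤ N) {f : Euc N → ℝ} (hf : Measurable f) (hf0 : ∀ x, 0 ≤ f x)
    (hfi : ∀ x ≠ 0, Integrable fun y => nk (x - y) * f y) (hu : LocallyIntegrable (pot f))
    {ψ : Euc N → ℝ} (hψ : Continuous ψ) (hψc : HasCompactSupport ψ) (x : Euc N) :
    cv (pot f) ψ x = ∫ y, f y * ∫ s, nk (x - y - s) * ψ s := by
  have hm : Measurable fun p : Euc N × Euc N => nk (p.1 - p.2) * f p.2 * ψ (x - p.1) :=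
    ((measurable_nk.comp (measurable_fst.sub measurable_snd)).mul (hf.comp measurable_snd)).mul
      (hψ.measurable.comp (measurable_const.sub measurable_fst))
  have hF : Integrable (Function.uncurry fun t y => nk (t - y) * f y * ψ (x - t))
      ((volume : Measure (Euc N)).prod (volume : Measure (Euc N))) := by
    refine (integrable_prod_iff hm.aestronglyMeasurable).2 ⟨?_, ?_⟩
    · filter_upwards [ae_ne_zero hN] with t ht
      exact (hfi t ht).mul_const _
    · have h1 : Integrable fun t => ‖pot f t • ψ (x - t)‖ := (integrable_cv hu hψ hψc x).norm
      refine h1.congr (Eventually.of_forall fun t => ?_)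
      simp only
      simp_rw [norm_mul (_ * _)]
      rw [integral_mul_const, smul_eq_mul, norm_mul]
      congr 1
      rw [Real.norm_of_nonneg (pot_nonneg hf0 t), pot]
      congr 1
      funext y
      exact (Real.norm_of_nonneg (mul_nonneg (nk_nonneg _) (hf0 y))).symm
  calc cv (pot f) ψ x = ∫ t, ∫ y, nk (t - y) * f y * ψ (x - t) := by
        unfold cv pot
        congr 1
        funext t
        rw [integral_mul_const, smul_eq_mul]
    _ = ∫ y, ∫ t, nk (t - y) * f y * ψ (x - t) := integral_integral_swap hF
    _ = _ := by
        congr 1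
        funext y
        rw [← integral_const_mul,
          ← integral_sub_left_eq_self (fun s => f y * (nk (x - y - s) * ψ s)) volume x]
        congr 1
        funext t
        rw [show x - y - (x - t) = t - y by abel]
        ring

lemma pot_eq (hN : 3 ≤ N) {f : Euc N → ℝ} (hf : Measurable f) (hf0 : ∀ x, 0 ≤ f x)
    (hfi : ∀ x ≠ 0, Integrable fun y => nk (x - y) * f y) (hu : LocallyIntegrable (pot f))
    {R : ℝ} (hR : 0 < R) {x : Euc N} (hx : x ≠ 0) :
    pot f x = (kap N)⁻¹ * cv (pot f) (mo R) x + trunc R f x := by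
  have hk := kap_pos hN
  rw [cv_pot hN hf hf0 hfi hu (contDiff_mo hR).continuous (hasCompactSupport_mo hR)]
  have e : ∀ y, f y * ∫ s, nk (x - y - s) * mo R s = kap N * (sk R (x - y) * f y) := fun y => by
    rw [integral_nk_mul_mo hN hR]; ring
  simp_rw [e]
  rw [integral_const_mul, inv_mul_cancel_left₀ hk.ne']
  have hs : Integrable fun y => sk R (x - y) * f y := by
    refine (hfi x hx).mono ?_ (Eventually.of_forall fun y => ?_)
    · exact (((contDiff_sk hR).continuous.measurable.comp
        (measurable_const.sub measurable_id)).mul hf).aestronglyMeasurable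
    · rw [norm_mul, norm_mul, Real.norm_of_nonneg (sk_nonneg _ _), Real.norm_of_nonneg (nk_nonneg _)]
      exact mul_le_mul_of_nonneg_right (sk_le _ _) (norm_nonneg _)
  unfold pot trunc
  have e2 : ∀ t, f t * (nk (x - t) - sk R (x - t)) = nk (x - t) * f t - sk R (x - t) * f t :=
    fun t => by ring
  simp_rw [e2]
  rw [integral_sub (hfi x hx) hs]
  ring

lemma lap_cv_pot (hN : 3 ≤ N) {f : Euc N → ℝ} (hf : Measurable f) (hf0 : ∀ x, 0 ≤ f x)
    (hfi : ∀ x ≠ 0, Integrable fun y => nk (x - y) * f y) (hu : LocallyIntegrable (pot f))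
    {R : ℝ} (hR : 0 < R) (x : Euc N) :
    lap (cv (pot f) (mo R)) x = -(kap N * cv f (mo R) x) := by
  have h2 : ContDiff ℝ 2 (mo R : Euc N → ℝ) := contDiff_two_of_infty (contDiff_mo hR)
  have hc := hasCompactSupport_mo (N := N) hR
  rw [lap_cv hu h2 hc, cv_pot hN hf hf0 hfi hu (continuous_lap h2) (hasCompactSupport_lap hc)]
  have e : ∀ y, f y * ∫ s, nk (x - y - s) * lap (mo R) s = -kap N * (f y • mo R (x - y)) := fun y => by
    rw [integral_nk_mul_lap hN h2 hc, smul_eq_mul]; ring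
  simp_rw [e]
  rw [integral_const_mul, neg_mul]
  rfl

lemma trunc_eventuallyEq {f g : Euc N → ℝ} {x₀ : Euc N} {ρ R : ℝ} (hR : 0 < R) (hρ : R < ρ)
    (h : ∀ y, ‖y - x₀‖ ≤ ρ → f y = g y) : trunc R f =ᶠ[𝓝 x₀] trunc R g := by
  filter_upwards [ball_mem_nhds x₀ (sub_pos.2 hρ)] with x hx
  unfold trunc
  congr 1
  funext t
  by_cases ht : ‖t - x₀‖ ≤ ρ
  · rw [h t ht]
  · have h1 : ‖t - x₀‖ ≤ ‖x - t‖ + ‖x - x₀‖ := by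
      calc ‖t - x₀‖ = ‖(x - x₀) - (x - t)‖ := by congr 1; abel
        _ ≤ _ := by rw [add_comm]; exact norm_sub_le _ _
    rw [mem_ball, dist_eq_norm] at hx
    rw [sk_eq hR (by linarith), sub_self, mul_zero, mul_zero]

lemma contDiffAt_one_pot (hN : 3 ≤ N) {f : Euc N → ℝ} (hf : Measurable f) (hf0 : ∀ x, 0 ≤ f x)
    (hfi : ∀ x ≠ 0, Integrable fun y => nk (x - y) * f y) (hu : LocallyIntegrable (pot f))
    {x₀ : Euc N} (hx₀ : x₀ ≠ 0) {ε M : ℝ} (hε : 0 < ε) (hM : ∀ y ∈ ball x₀ ε, f y ≤ M) :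
    ContDiffAt ℝ 1 (pot f) x₀ := by
  have hR : 0 < ε / 4 := by positivity
  have hM0 : 0 ≤ M := (hf0 x₀).trans (hM x₀ (mem_ball_self hε))
  have h1 : ContDiff ℝ 1 (trunc (ε / 4) ((ball x₀ ε).indicator f)) := by
    refine contDiff_one_trunc hN (hf.indicator measurableSet_ball) (M := M) (fun x => ?_) hR
    by_cases hx : x ∈ ball x₀ ε
    · rw [Set.indicator_of_mem hx, abs_of_nonneg (hf0 x)]; exact hM x hx
    · rwa [Set.indicator_of_notMem hx, abs_zero]
  have h2 : trunc (ε / 4) f =ᶠ[𝓝 x₀] trunc (ε / 4) ((ball x₀ ε).indicator f) := by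
    refine trunc_eventuallyEq (ρ := ε / 2) hR (by linarith) fun y hy => ?_
    rw [Set.indicator_of_mem]
    rw [mem_ball, dist_eq_norm]; linarith
  have h3 : ContDiffAt ℝ 1 (fun x => (kap N)⁻¹ * cv (pot f) (mo (ε / 4)) x +
      trunc (ε / 4) ((ball x₀ ε).indicator f) x) x₀ :=
    (contDiffAt_const.mul ((contDiff_cv hu (contDiff_mo hR)
      (hasCompactSupport_mo hR)).of_le (by norm_num)).contDiffAt).add h1.contDiffAt
  refine h3.congr_of_eventuallyEq ?_
  filter_upwards [h2, isOpen_ne.mem_nhds hx₀] with x hx hx0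
  rw [← hx]
  exact pot_eq hN hf hf0 hfi hu hR hx0

/-- A Lipschitz cutoff: `1` on `closedBall x₀ ρ`, `0` off `ball x₀ (2ρ)`. -/
def clampCut (x₀ : Euc N) (ρ : ℝ) (y : Euc N) : ℝ := max 0 (min 1 (2 - ‖y - x₀‖ / ρ))

lemma clampCut_nonneg (x₀ : Euc N) (ρ : ℝ) (y : Euc N) : 0 ≤ clampCut x₀ ρ y := le_max_left _ _

lemma clampCut_le_one (x₀ : Euc N) (ρ : ℝ) (y : Euc N) : clampCut x₀ ρ y ≤ 1 :=
  max_le zero_le_one (min_le_left _ _)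

lemma clampCut_eq_one {x₀ : Euc N} {ρ : ℝ} (hρ : 0 < ρ) {y : Euc N} (h : ‖y - x₀‖ ≤ ρ) :
    clampCut x₀ ρ y = 1 := by
  have : ‖y - x₀‖ / ρ ≤ 1 := (div_le_one hρ).2 h
  rw [clampCut, min_eq_left (by linarith), max_eq_right zero_le_one]

lemma clampCut_eq_zero {x₀ : Euc N} {ρ : ℝ} (hρ : 0 < ρ) {y : Euc N} (h : 2 * ρ ≤ ‖y - x₀‖) :
    clampCut x₀ ρ y = 0 := by
  have : 2 ≤ ‖y - x₀‖ / ρ := (le_div_iff₀ hρ).2 h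
  rw [clampCut, max_eq_left]
  exact (min_le_right _ _).trans (by linarith)

lemma continuous_clampCut (x₀ : Euc N) (ρ : ℝ) : Continuous (clampCut x₀ ρ) := by
  unfold clampCut; fun_prop

lemma abs_clampCut_sub_le {x₀ : Euc N} {ρ γ : ℝ} (hρ : 0 < ρ) (hγ : 0 < γ) (hγ1 : γ ≤ 1)
    (y z : Euc N) : |clampCut x₀ ρ y - clampCut x₀ ρ z| ≤ (dist y z / ρ) ^ γ := by
  have h1 : |clampCut x₀ ρ y - clampCut x₀ ρ z| ≤ 1 := by
    rw [abs_le]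
    have := clampCut_nonneg x₀ ρ y
    have := clampCut_nonneg x₀ ρ z
    have := clampCut_le_one x₀ ρ y
    have := clampCut_le_one x₀ ρ z
    constructor <;> linarith
  have h2 : |clampCut x₀ ρ y - clampCut x₀ ρ z| ≤ dist y z / ρ := by
    unfold clampCut
    refine (abs_max_sub_max_le_max (0 : ℝ) _ 0 _).trans ?_
    rw [sub_self, abs_zero, max_eq_right (abs_nonneg _)]
    refine (abs_min_sub_min_le_max (1 : ℝ) _ 1 _).trans ?_
    rw [sub_self, abs_zero, max_eq_right (abs_nonneg _), show (2 - ‖y - x₀‖ / ρ - (2 - ‖z - x₀‖ / ρ))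
      = (‖z - x₀‖ - ‖y - x₀‖) / ρ by ring, abs_div, abs_of_pos hρ]
    gcongr
    refine (abs_norm_sub_norm_le _ _).trans ?_
    rw [sub_sub_sub_cancel_right, dist_comm, dist_eq_norm]
  rcases le_total (dist y z / ρ) 1 with h | h
  · exact h2.trans (Real.self_le_rpow_of_le_one (by positivity) h hγ1)
  · exact h1.trans (Real.one_le_rpow h hγ.le)

lemma clampCut_mul_holder {f : Euc N → ℝ} {x₀ : Euc N} {ρ γ C M : ℝ} (hρ : 0 < ρ) (hγ : 0 < γ)
    (hγ1 : γ ≤ 1) (hC : 0 ≤ C) (hM0 : 0 ≤ M) (hM : ∀ y ∈ ball x₀ (2 * ρ), |f y| ≤ M)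
    (hf : ∀ y ∈ ball x₀ (2 * ρ), ∀ z ∈ ball x₀ (2 * ρ), |f y - f z| ≤ C * dist y z ^ γ) (y z : Euc N) :
    |clampCut x₀ ρ y * f y - clampCut x₀ ρ z * f z| ≤ (C + M * (ρ ^ γ)⁻¹) * dist y z ^ γ := by
  have key : ∀ y z, y ∈ ball x₀ (2 * ρ) →
      |clampCut x₀ ρ y * f y - clampCut x₀ ρ z * f z| ≤ (C + M * (ρ ^ γ)⁻¹) * dist y z ^ γ := by
    intro y z hy
    have h1 := abs_clampCut_sub_le (x₀ := x₀) hρ hγ hγ1 y z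
    rw [Real.div_rpow dist_nonneg hρ.le] at h1
    have h2 : |clampCut x₀ ρ y - clampCut x₀ ρ z| * |f y| ≤ M * (ρ ^ γ)⁻¹ * dist y z ^ γ := by
      calc _ ≤ dist y z ^ γ / ρ ^ γ * M := mul_le_mul h1 (hM y hy) (abs_nonneg _) (by positivity)
        _ = _ := by ring
    by_cases hz : z ∈ ball x₀ (2 * ρ)
    · have e : clampCut x₀ ρ y * f y - clampCut x₀ ρ z * f z =
        clampCut x₀ ρ z * (f y - f z) + (clampCut x₀ ρ y - clampCut x₀ ρ z) * f y := by ring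
      rw [e]
      refine (abs_add_le _ _).trans ?_
      rw [abs_mul, abs_mul, abs_of_nonneg (clampCut_nonneg _ _ _), add_mul]
      refine add_le_add ?_ h2
      refine le_trans ?_ (hf y hy z hz)
      exact mul_le_of_le_one_left (abs_nonneg _) (clampCut_le_one _ _ _)
    · have hz : clampCut x₀ ρ z = 0 := clampCut_eq_zero hρ (by
        simpa [dist_eq_norm] using hz)
      rw [hz, sub_zero] at h2
      rw [hz, zero_mul, sub_zero, abs_mul, add_mul]
      have : 0 ≤ C * dist y z ^ γ := by positivity
      linarith
  by_cases hy : y ∈ ball x₀ (2 * ρ)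
  · exact key y z hy
  by_cases hz : z ∈ ball x₀ (2 * ρ)
  · rw [abs_sub_comm, dist_comm]; exact key z y hz
  · have h1 : clampCut x₀ ρ z = 0 := clampCut_eq_zero hρ (by simpa [dist_eq_norm] using hz)
    have h2 : clampCut x₀ ρ y = 0 := clampCut_eq_zero hρ (by simpa [dist_eq_norm] using hy)
    rw [h1, h2]
    simp only [zero_mul, sub_zero, abs_zero]
    positivity

lemma pot_regularity (hN : 3 ≤ N) {f : Euc N → ℝ} (hf : Measurable f) (hf0 : ∀ x, 0 ≤ f x)
    (hfi : ∀ x ≠ 0, Integrable fun y => nk (x - y) * f y) (hu : LocallyIntegrable (pot f))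
    {γ : ℝ} (hγ : 0 < γ) (hγ1 : γ ≤ 1) (hfH : LocHolderOn γ {x : Euc N | x ≠ 0} f)
    {x₀ : Euc N} (hx₀ : x₀ ≠ 0) :
    ContDiffAt ℝ 2 (pot f) x₀ ∧ lap (pot f) x₀ = -(kap N * f x₀) := by
  obtain ⟨ε, hε, C, hC, hH⟩ := hfH x₀ hx₀
  set ρ := min ε ‖x₀‖ / 2 with hρd
  have hρ : 0 < ρ := half_pos (lt_min hε (norm_pos_iff.2 hx₀))
  have hsub : ∀ y ∈ ball x₀ (2 * ρ), y ∈ ball x₀ ε ∩ {x : Euc N | x ≠ 0} := fun y hy => by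
    rw [mem_ball, hρd, mul_div_cancel₀ _ two_ne_zero] at hy
    refine ⟨hy.trans_le (min_le_left _ _), fun h0 => ?_⟩
    rw [h0, dist_zero_left] at hy
    exact absurd (hy.trans_le (min_le_right _ _)) (lt_irrefl _)
  have hH' : ∀ y ∈ ball x₀ (2 * ρ), ∀ z ∈ ball x₀ (2 * ρ), |f y - f z| ≤ C * dist y z ^ γ :=
    fun y hy z hz => hH y (hsub y hy) z (hsub z hz)
  have hM : ∀ y ∈ ball x₀ (2 * ρ), |f y| ≤ |f x₀| + C * (2 * ρ) ^ γ := fun y hy => by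
    have h1 := hH' y hy x₀ (mem_ball_self (by positivity))
    have h2 : dist y x₀ ^ γ ≤ (2 * ρ) ^ γ :=
      Real.rpow_le_rpow dist_nonneg (mem_ball.1 hy).le hγ.le
    have h3 : |f y| ≤ |f x₀| + |f y - f x₀| := by
      calc |f y| = |f x₀ + (f y - f x₀)| := by ring_nf
        _ ≤ _ := abs_add_le _ _
    have := mul_le_mul_of_nonneg_left h2 hC.le
    linarith
  set M := |f x₀| + C * (2 * ρ) ^ γ with hMd
  have hM0 : 0 ≤ M := by positivity
  set g : Euc N → ℝ := fun y => clampCut x₀ ρ y * f y with hg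
  have hgm : Measurable g := (continuous_clampCut x₀ ρ).measurable.mul hf
  have hgM : ∀ y, |g y| ≤ M := fun y => by
    simp only [hg]
    by_cases hy : y ∈ ball x₀ (2 * ρ)
    · rw [abs_mul, abs_of_nonneg (clampCut_nonneg _ _ _)]
      exact (mul_le_of_le_one_left (abs_nonneg _) (clampCut_le_one _ _ _)).trans (hM y hy)
    · rw [clampCut_eq_zero hρ (by simpa [dist_eq_norm] using hy)]
      simpa using hM0
  have hgH := clampCut_mul_holder hρ hγ hγ1 hC.le hM0 hM hH'
  have hR : 0 < ρ / 2 := by positivity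
  obtain ⟨ht2, htl⟩ := trunc_holder hN hgm hgM (by positivity) hγ hgH hR
  have hfg : ∀ y, ‖y - x₀‖ ≤ ρ → f y = g y := fun y hy => by
    simp only [hg]; rw [clampCut_eq_one hρ hy, one_mul]
  have hte := trunc_eventuallyEq hR (by linarith) hfg
  have hcd : ContDiffAt ℝ 2 (cv (pot f) (mo (ρ / 2))) x₀ :=
    (contDiff_two_of_infty (contDiff_cv hu (contDiff_mo hR) (hasCompactSupport_mo hR))).contDiffAt
  have he : pot f =ᶠ[𝓝 x₀] fun x => (kap N)⁻¹ * cv (pot f) (mo (ρ / 2)) x + trunc (ρ / 2) g x := by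
    filter_upwards [hte, isOpen_ne.mem_nhds hx₀] with x hx hx0
    rw [← hx]
    exact pot_eq hN hf hf0 hfi hu hR hx0
  refine ⟨((contDiffAt_const.mul hcd).add ht2.contDiffAt).congr_of_eventuallyEq he, ?_⟩
  rw [lap_congr he, lap_add (contDiffAt_const.mul hcd) ht2.contDiffAt, lap_const_mul _ hcd,
    lap_cv_pot hN hf hf0 hfi hu hR, htl]
  have hcv : cv f (mo (ρ / 2)) x₀ = cv g (mo (ρ / 2)) x₀ := by
    unfold cv
    congr 1
    funext t
    by_cases ht : ‖t - x₀‖ ≤ ρ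
    · rw [hfg t ht]
    · rw [mo_eq_zero_of_lt hR (by rw [norm_sub_rev]; linarith), smul_zero, smul_zero]
  have hk := (kap_pos hN).ne'
  rw [hcv, ← hfg x₀ (by simpa using hρ.le)]
  field_simp
  ring

end

section

variable {N : ℕ}

/-! ### The integral operator and supersolutions -/

/-- Potentials admissible for the critical Hardy problem. -/
structure AdmV (N : ℕ) (γ c : ℝ) (V : Euc N → ℝ) : Prop where
  hN : 3 ≤ N
  hγ : 0 < γ
  hγ1 : γ < 1
  reg : LocHolderOn γ {x : Euc N | x ≠ 0} V
  pos : ∀ x : Euc N, x ≠ 0 → 0 < V x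
  hc : 0 < c
  lo : ∀ x : Euc N, x ≠ 0 → ‖x‖ ^ (-2 : ℝ) - c ≤ V x
  hi : ∀ x : Euc N, x ≠ 0 → V x ≤ ‖x‖ ^ (-2 : ℝ)

lemma mu0_pos (hN : 3 ≤ N) : 0 < mu0 N := by
  have : (3 : ℝ) ≤ N := by exact_mod_cast hN
  unfold mu0
  have : 0 < (N : ℝ) - 2 := by linarith
  positivity

lemma measurable_of_continuousOn_ne {v : Euc N → ℝ} (hv : ContinuousOn v {x | x ≠ 0}) :
    Measurable v :=
  measurable_of_continuousOn_compl_singleton 0 hv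

/-- The source term `μ₀ V v`. -/
def src (V v : Euc N → ℝ) (x : Euc N) : ℝ := mu0 N * V x * v x

/-- The normalised Newtonian potential of `μ₀ V f`, for extended nonnegative `f`. -/
def TL (V : Euc N → ℝ) (f : Euc N → ENNReal) (x : Euc N) : ENNReal :=
  ENNReal.ofReal (kap N)⁻¹ * ∫⁻ y, ENNReal.ofReal (nk (x - y) * (mu0 N * V y)) * f y

lemma TL_mono {V : Euc N → ℝ} (hN : 3 ≤ N) {f g : Euc N → ENNReal} (h : ∀ x ≠ 0, f x ≤ g x)
    (x : Euc N) : TL V f x ≤ TL V g x := by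
  unfold TL
  refine mul_le_mul_right (lintegral_mono_ae ?_) _
  filter_upwards [ae_ne_zero hN] with y hy
  exact mul_le_mul_right (h y hy) _

lemma TL_ofReal {V v : Euc N → ℝ} (hv0 : ∀ x, 0 ≤ v x) (x : Euc N) :
    TL V (fun y => ENNReal.ofReal (v y)) x =
      ENNReal.ofReal (kap N)⁻¹ * ∫⁻ y, ENNReal.ofReal (nk (x - y) * src V v y) := by
  unfold TL src
  congr 2
  funext y
  rw [← ENNReal.ofReal_mul' (hv0 y)]
  congr 1
  ring

section
variable {γ c : ℝ} {V : Euc N → ℝ}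

lemma AdmV.continuousOn (A : AdmV N γ c V) : ContinuousOn V {x | x ≠ 0} :=
  LocHolderOn.continuousOn A.hγ A.reg

lemma AdmV.measurable (A : AdmV N γ c V) : Measurable V := measurable_of_continuousOn_ne A.continuousOn

lemma AdmV.src_nonneg (A : AdmV N γ c V) {v : Euc N → ℝ} (hv0 : ∀ x, 0 ≤ v x) (hv : v 0 = 0)
    (x : Euc N) : 0 ≤ src V v x := by
  unfold src
  by_cases hx : x = 0
  · rw [hx, hv, mul_zero]
  · exact mul_nonneg (mul_nonneg (mu0_pos A.hN).le (A.pos x hx).le) (hv0 x)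

lemma AdmV.src_holder (A : AdmV N γ c V) {v : Euc N → ℝ}
    (hv : LocHolderOn γ {x : Euc N | x ≠ 0} v) : LocHolderOn γ {x : Euc N | x ≠ 0} (src V v) :=
  LocHolderOn.mul A.hγ (LocHolderOn.mul A.hγ
    (locHolderOn_of_contDiffAt A.hγ A.hγ1 fun _ _ => contDiffAt_const) A.reg) hv

lemma AdmV.src_measurable (A : AdmV N γ c V) {v : Euc N → ℝ} (hv : Measurable v) :
    Measurable (src V v) := (A.measurable.const_mul _).mul hv

lemma AdmV.pot_of_TL_le (A : AdmV N γ c V) {v U : Euc N → ℝ} (hvm : Measurable v)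
    (hv0 : ∀ x, 0 ≤ v x) (hv : v 0 = 0) (hU : ∀ x ≠ 0, 0 ≤ U x)
    (h : ∀ x ≠ 0, TL V (fun y => ENNReal.ofReal (v y)) x ≤ ENNReal.ofReal (U x)) {x : Euc N}
    (hx : x ≠ 0) : Integrable (fun y => nk (x - y) * src V v y) ∧
      TL V (fun y => ENNReal.ofReal (v y)) x = ENNReal.ofReal ((kap N)⁻¹ * pot (src V v) x) ∧
      (kap N)⁻¹ * pot (src V v) x ≤ U x := by
  have hk : 0 < (kap N)⁻¹ := inv_pos.2 (kap_pos A.hN)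
  have hm : Measurable fun y => nk (x - y) * src V v y :=
    (measurable_nk.comp (measurable_const.sub measurable_id)).mul (A.src_measurable hvm)
  have hn : ∀ y, 0 ≤ nk (x - y) * src V v y := fun y =>
    mul_nonneg (nk_nonneg _) (A.src_nonneg hv0 hv y)
  have hi : Integrable fun y => nk (x - y) * src V v y := by
    refine ⟨hm.aestronglyMeasurable, ?_⟩
    rw [hasFiniteIntegral_iff_ofReal (Eventually.of_forall hn)]
    have h1 := (h x hx).trans_lt ENNReal.ofReal_lt_top
    rw [TL_ofReal hv0] at h1
    refine lt_of_not_ge fun htop => ?_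
    rw [top_le_iff.1 htop, ENNReal.mul_top (by simpa using hk)] at h1
    exact lt_irrefl _ h1
  have e : TL V (fun y => ENNReal.ofReal (v y)) x = ENNReal.ofReal ((kap N)⁻¹ * pot (src V v) x) := by
    rw [TL_ofReal hv0, ENNReal.ofReal_mul hk.le, pot,
      ofReal_integral_eq_lintegral_ofReal hi (Eventually.of_forall hn)]
  refine ⟨hi, e, ?_⟩
  have := h x hx
  rwa [e, ENNReal.ofReal_le_ofReal_iff (hU x hx)] at this

lemma AdmV.locallyIntegrable_pot (A : AdmV N γ c V) {v U : Euc N → ℝ} (hvm : Measurable v)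
    (hv0 : ∀ x, 0 ≤ v x) (hv : v 0 = 0) (hU : ∀ x ≠ 0, 0 ≤ U x) (hUi : LocallyIntegrable U)
    (h : ∀ x ≠ 0, TL V (fun y => ENNReal.ofReal (v y)) x ≤ ENNReal.ofReal (U x)) :
    LocallyIntegrable (pot (src V v)) := by
  have hk := kap_pos A.hN
  have h1 : LocallyIntegrable fun x => kap N * U x := hUi.smul (kap N)
  refine h1.mono (measurable_pot (A.src_measurable hvm)).aestronglyMeasurable ?_
  filter_upwards [ae_ne_zero A.hN] with x hx
  have h2 := (A.pot_of_TL_le hvm hv0 hv hU h hx).2.2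
  rw [Real.norm_of_nonneg (pot_nonneg (A.src_nonneg hv0 hv) x)]
  rw [inv_mul_le_iff₀ hk] at h2
  exact h2.trans (le_abs_self _)

end

/-! ### Potentials of bounded compactly supported functions -/

lemma integral_nk_bound (hN : 3 ≤ N) {R : ℝ} : ∃ C, ∀ x : Euc N,
    ∫ y in closedBall (0 : Euc N) R, nk (x - y) ≤ C ∧
      IntegrableOn (fun y => nk (x - y)) (closedBall (0 : Euc N) R) := by
  have hI1 : IntegrableOn (nk : Euc N → ℝ) (closedBall 0 1) :=
    (locallyIntegrable_nk hN).integrableOn_isCompact (isCompact_closedBall 0 1)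
  refine ⟨(∫ y in closedBall (0 : Euc N) 1, nk y) + (volume (closedBall (0 : Euc N) R)).toReal,
    fun x => ?_⟩
  have h1 : Integrable fun y => (closedBall (0 : Euc N) 1).indicator nk (x - y) :=
    (hI1.integrable_indicator measurableSet_closedBall).comp_sub_left x
  have h2 : Integrable ((closedBall (0 : Euc N) R).indicator fun _ => (1 : ℝ)) :=
    (integrable_indicator_iff measurableSet_closedBall).2
      (integrableOn_const measure_closedBall_lt_top.ne)
  have hb : ∀ y, (closedBall (0 : Euc N) R).indicator (fun y => nk (x - y)) y ≤
      (closedBall (0 : Euc N) 1).indicator nk (x - y) +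
        (closedBall (0 : Euc N) R).indicator (fun _ => (1 : ℝ)) y := fun y => by
    by_cases hy : y ∈ closedBall (0 : Euc N) R
    · rw [Set.indicator_of_mem hy, Set.indicator_of_mem hy]
      by_cases hy1 : x - y ∈ closedBall (0 : Euc N) 1
      · rw [Set.indicator_of_mem hy1]; linarith
      · rw [Set.indicator_of_notMem hy1, zero_add]
        have : 1 ≤ ‖x - y‖ := by
          have : 1 < ‖x - y‖ := by simpa using hy1
          exact this.le
        simpa using nk_le hN one_pos this
    · rw [Set.indicator_of_notMem hy, Set.indicator_of_notMem hy, add_zero]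
      exact Set.indicator_nonneg (fun _ _ => nk_nonneg _) _
  have hi : Integrable ((closedBall (0 : Euc N) R).indicator fun y => nk (x - y)) := by
    refine (h1.add h2).mono ?_ (Eventually.of_forall fun y => ?_)
    · exact ((measurable_nk.comp (measurable_const.sub measurable_id)).indicator
        measurableSet_closedBall).aestronglyMeasurable
    · have h0 : 0 ≤ (closedBall (0 : Euc N) R).indicator (fun y => nk (x - y)) y :=
        Set.indicator_nonneg (fun _ _ => nk_nonneg _) _
      rw [Real.norm_of_nonneg h0]
      exact (hb y).trans (le_abs_self _)
  refine ⟨?_, (integrable_indicator_iff measurableSet_closedBall).1 hi⟩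
  rw [← integral_indicator measurableSet_closedBall]
  refine (integral_mono hi (h1.add h2) hb).trans (le_of_eq ?_)
  have e := integral_add h1 h2
  simp only [Pi.add_apply]
  rw [e, integral_sub_left_eq_self ((closedBall (0 : Euc N) 1).indicator nk) volume x,
    integral_indicator measurableSet_closedBall, integral_indicator measurableSet_closedBall]
  simp [Measure.real]

section
variable {f : Euc N → ℝ} {M R : ℝ}

lemma integrable_nk_mul_of_bounded (hN : 3 ≤ N) (hf : Measurable f) (hf0 : ∀ x, 0 ≤ f x)
    (hM : ∀ x, f x ≤ M) (hR : ∀ x, R < ‖x‖ → f x = 0) (x : Euc N) :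
    Integrable fun y => nk (x - y) * f y := by
  obtain ⟨C, hC⟩ := integral_nk_bound hN (R := R)
  have h1 := ((integrable_indicator_iff measurableSet_closedBall).2 (hC x).2).mul_const M
  refine h1.mono ((measurable_nk.comp
    (measurable_const.sub measurable_id)).mul hf).aestronglyMeasurable
    (Eventually.of_forall fun y => ?_)
  rw [norm_mul, norm_mul]
  by_cases hy : y ∈ closedBall (0 : Euc N) R
  · rw [Set.indicator_of_mem hy]
    refine mul_le_mul_of_nonneg_left ?_ (norm_nonneg _)
    rw [Real.norm_of_nonneg (hf0 y)]
    exact (hM y).trans (le_abs_self M)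
  · rw [hR y (by simpa using hy), norm_zero, mul_zero]
    positivity

lemma pot_bounded (hN : 3 ≤ N) (hf : Measurable f) (hf0 : ∀ x, 0 ≤ f x)
    (hM : ∀ x, f x ≤ M) (hR : ∀ x, R < ‖x‖ → f x = 0) : ∃ C, ∀ x, pot f x ≤ C := by
  obtain ⟨C, hC⟩ := integral_nk_bound hN (R := R)
  have hM0 : 0 ≤ M := (hf0 0).trans (hM 0)
  refine ⟨C * M, fun x => ?_⟩
  have h1 := ((integrable_indicator_iff measurableSet_closedBall).2 (hC x).2).mul_const M
  refine (integral_mono (integrable_nk_mul_of_bounded hN hf hf0 hM hR x) h1 fun y => ?_).trans ?_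
  · by_cases hy : y ∈ closedBall (0 : Euc N) R
    · simp only [Set.indicator_of_mem hy]
      exact mul_le_mul_of_nonneg_left (hM y) (nk_nonneg _)
    · simp only [Set.indicator_of_notMem hy]
      rw [hR y (by simpa using hy)]; simp
  · rw [integral_mul_const, integral_indicator measurableSet_closedBall]
    exact mul_le_mul_of_nonneg_right (hC x).1 hM0

lemma pot_decay (hN : 3 ≤ N) (hf : Measurable f) (hf0 : ∀ x, 0 ≤ f x)
    (hM : ∀ x, f x ≤ M) (hR : ∀ x, R < ‖x‖ → f x = 0) :
    ∃ C ≥ 0, ∀ x ≠ 0, 2 * R ≤ ‖x‖ → pot f x ≤ C * ‖x‖ ^ (2 - (N : ℝ)) := by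
  have hM0 : 0 ≤ M := (hf0 0).trans (hM 0)
  refine ⟨(2 : ℝ)⁻¹ ^ (2 - (N : ℝ)) * M * (volume (closedBall (0 : Euc N) R)).toReal, by positivity,
    fun x hx0 hx => ?_⟩
  have h2 : Integrable ((closedBall (0 : Euc N) R).indicator
      fun _ => (‖x‖ * 2⁻¹) ^ (2 - (N : ℝ)) * M) :=
    (integrable_indicator_iff measurableSet_closedBall).2
      (integrableOn_const measure_closedBall_lt_top.ne)
  refine (integral_mono (integrable_nk_mul_of_bounded hN hf hf0 hM hR x) h2 fun y => ?_).trans ?_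
  · by_cases hy : y ∈ closedBall (0 : Euc N) R
    · simp only [Set.indicator_of_mem hy]
      have hy' : ‖y‖ ≤ R := by simpa using hy
      have h3 : ‖x‖ - ‖y‖ ≤ ‖x - y‖ := norm_sub_norm_le _ _
      have h4 : 0 < ‖x‖ := norm_pos_iff.2 hx0
      exact mul_le_mul (nk_le hN (by positivity) (by linarith)) (hM y) (hf0 y) (by positivity)
    · simp only [Set.indicator_of_notMem hy]
      rw [hR y (by simpa using hy)]; simp
  · rw [integral_indicator measurableSet_closedBall, setIntegral_const, smul_eq_mul,
      Real.mul_rpow (norm_nonneg _) (by norm_num)]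
    refine le_of_eq ?_
    simp only [Measure.real]
    ring

end

end

section

variable {N : ℕ}

/-! ### Supersolutions dominate their potentials -/

/-- The critical Hardy profile. -/
def gam (x : Euc N) : ℝ := ‖x‖ ^ (-((N : ℝ) - 2) / 2)

lemma gam_pos {x : Euc N} (hx : x ≠ 0) : 0 < gam x := Real.rpow_pos_of_pos (norm_pos_iff.2 hx) _

lemma gam_nonneg (x : Euc N) : 0 ≤ gam x := by unfold gam; positivity

lemma contDiffAt_gam {x : Euc N} (hx : x ≠ 0) {n : WithTop ℕ∞} :
    ContDiffAt ℝ n (gam : Euc N → ℝ) x := contDiffAt_rpow_norm _ hx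

lemma lap_gam {x : Euc N} (hx : x ≠ 0) : lap gam x = -(mu0 N * ‖x‖ ^ (-2 : ℝ) * gam x) := by
  have := lap_rpow_norm (-((N : ℝ) - 2) / 2) hx
  rw [show (gam : Euc N → ℝ) = fun y => ‖y‖ ^ (-((N : ℝ) - 2) / 2) from rfl, this]
  rw [show -((N : ℝ) - 2) / 2 - 2 = -2 + -((N : ℝ) - 2) / 2 by ring,
    Real.rpow_add (norm_pos_iff.2 hx)]
  unfold mu0
  ring

lemma tendsto_norm_nhdsNE : Tendsto (fun x : Euc N => ‖x‖) (𝓝[≠] 0) (𝓝[>] 0) := by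
  refine tendsto_nhdsWithin_iff.2 ⟨?_, ?_⟩
  · have := (continuous_norm (E := Euc N)).tendsto 0
    rw [norm_zero] at this
    exact this.mono_left nhdsWithin_le_nhds
  · filter_upwards [self_mem_nhdsWithin] with x hx
    exact norm_pos_iff.2 hx

lemma eventually_le_rpow_zero {p q : ℝ} (hpq : p < q) (C : ℝ) {δ : ℝ} (hδ : 0 < δ) :
    ∀ᶠ x in 𝓝[≠] (0 : Euc N), C * ‖x‖ ^ q ≤ δ * ‖x‖ ^ p := by
  have h1 : Tendsto (fun r : ℝ => C * r ^ (q - p)) (𝓝[>] 0) (𝓝 0) := by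
    have h := ((Real.continuousAt_rpow_const 0 (q - p) (Or.inr (by linarith))).tendsto.mono_left
      (nhdsWithin_le_nhds (s := Set.Ioi 0))).const_mul C
    rwa [Real.zero_rpow (by linarith), mul_zero] at h
  filter_upwards [(h1.comp tendsto_norm_nhdsNE).eventually (gt_mem_nhds hδ), self_mem_nhdsWithin]
    with x hx hx0
  have hp : 0 < ‖x‖ := norm_pos_iff.2 hx0
  have : ‖x‖ ^ q = ‖x‖ ^ (q - p) * ‖x‖ ^ p := by rw [← Real.rpow_add hp]; ring_nf
  rw [this, ← mul_assoc]
  exact mul_le_mul_of_nonneg_right (le_of_lt hx) (by positivity)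

lemma eventually_le_rpow_infty {p q : ℝ} (hpq : q < p) (C : ℝ) {δ : ℝ} (hδ : 0 < δ) :
    ∀ᶠ x in cocompact (Euc N), C * ‖x‖ ^ q ≤ δ * ‖x‖ ^ p := by
  have h1 : Tendsto (fun r : ℝ => C * r ^ (-(p - q))) atTop (𝓝 0) := by
    simpa using (tendsto_rpow_neg_atTop (sub_pos.2 hpq)).const_mul C
  have hn := tendsto_norm_cocompact_atTop (E := Euc N)
  filter_upwards [(h1.comp hn).eventually (gt_mem_nhds hδ), hn.eventually (eventually_gt_atTop 0)]
    with x hx hp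
  have : ‖x‖ ^ q = ‖x‖ ^ (-(p - q)) * ‖x‖ ^ p := by rw [← Real.rpow_add hp]; ring_nf
  rw [this, ← mul_assoc]
  exact mul_le_mul_of_nonneg_right (le_of_lt hx) (by positivity)

/-- Smooth cutoff to an annulus. -/
def ann (n : ℕ) (y : Euc N) : ℝ :=
  Real.smoothTransition (n * ‖y‖ ^ 2 - 1) * Real.smoothTransition (n - ‖y‖ ^ 2)

lemma contDiff_ann (n : ℕ) {m : ℕ∞} : ContDiff ℝ m (ann n : Euc N → ℝ) := by
  have h : ContDiff ℝ m fun y : Euc N => ‖y‖ ^ 2 := contDiff_norm_sq ℝ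
  exact (Real.smoothTransition.contDiff.comp ((contDiff_const.mul h).sub contDiff_const)).mul
    (Real.smoothTransition.contDiff.comp (contDiff_const.sub h))

lemma ann_nonneg (n : ℕ) (y : Euc N) : 0 ≤ ann n y :=
  mul_nonneg (Real.smoothTransition.nonneg _) (Real.smoothTransition.nonneg _)

lemma ann_le_one (n : ℕ) (y : Euc N) : ann n y ≤ 1 :=
  mul_le_one₀ (Real.smoothTransition.le_one _) (Real.smoothTransition.nonneg _)
    (Real.smoothTransition.le_one _)

lemma ann_eq_zero_near (n : ℕ) : ∀ᶠ y in 𝓝 (0 : Euc N), ann n y = 0 := by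
  have h : Continuous fun y : Euc N => (n : ℝ) * ‖y‖ ^ 2 - 1 := by fun_prop
  filter_upwards [h.continuousAt.eventually_lt (continuousAt_const (y := (0 : ℝ))) (by simp)] with y hy
  rw [ann, Real.smoothTransition.zero_of_nonpos hy.le, zero_mul]

lemma ann_eq_zero_far (n : ℕ) {y : Euc N} (h : (n : ℝ) + 1 < ‖y‖) : ann n y = 0 := by
  have : (n : ℝ) - ‖y‖ ^ 2 ≤ 0 := by nlinarith [norm_nonneg y, (n.cast_nonneg : (0 : ℝ) ≤ n)]
  rw [ann, Real.smoothTransition.zero_of_nonpos this, mul_zero]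

lemma ann_eventually_one {y : Euc N} (hy : y ≠ 0) : ∀ᶠ n : ℕ in atTop, ann n y = 1 := by
  have hp : 0 < ‖y‖ ^ 2 := by positivity
  filter_upwards [(tendsto_natCast_atTop_atTop (R := ℝ)).eventually
    (eventually_ge_atTop (2 / ‖y‖ ^ 2 + (1 + ‖y‖ ^ 2)))] with n hn
  have h2 : 0 < 2 / ‖y‖ ^ 2 := by positivity
  have h1 : 2 / ‖y‖ ^ 2 ≤ n := by linarith
  rw [div_le_iff₀ hp] at h1
  rw [ann, Real.smoothTransition.one_of_one_le (by linarith),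
    Real.smoothTransition.one_of_one_le (by linarith), mul_one]

variable {γ c : ℝ} {V : Euc N → ℝ}

lemma AdmV.potential_cutoff_le (A : AdmV N γ c V) {v : Euc N → ℝ} (hv0 : ∀ x ≠ 0, 0 ≤ v x)
    (hvH : LocHolderOn γ {x : Euc N | x ≠ 0} v)
    (hvt : ∀ x ≠ 0, ∃ φ : Euc N → ℝ, ContDiffAt ℝ 2 φ x ∧ φ x = v x ∧ (∀ᶠ y in 𝓝 x, v y ≤ φ y) ∧
      lap φ x ≤ -(mu0 N * V x * v x)) (n : ℕ) :
    (∀ x, 0 ≤ src V v x * ann n x) ∧ Measurable (fun x => src V v x * ann n x) ∧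
    (∀ x, Integrable fun y => nk (x - y) * (src V v y * ann n y)) ∧
      ∀ x ≠ 0, (kap N)⁻¹ * pot (fun x => src V v x * ann n x) x ≤ v x := by
  set f : Euc N → ℝ := fun x => src V v x * ann n x with hf
  have hsH := A.src_holder hvH
  have hfH : LocHolderOn γ {x : Euc N | x ≠ 0} f := LocHolderOn.mul A.hγ hsH
    (locHolderOn_of_contDiffAt A.hγ A.hγ1 fun x _ => (contDiff_ann n).contDiffAt)
  have h00 : ∀ x, x = 0 → f x = 0 := fun x hx => by
    simp only [hf]; rw [hx, (ann_eq_zero_near n).self_of_nhds, mul_zero]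
  have hf0 : ∀ x, 0 ≤ f x := fun x => by
    by_cases hx : x = 0
    · exact (h00 x hx).ge
    · exact mul_nonneg (mul_nonneg (mul_nonneg (mu0_pos A.hN).le (A.pos x hx).le) (hv0 x hx))
        (ann_nonneg _ _)
  have hfc : Continuous f := by
    rw [continuous_iff_continuousAt]
    intro x
    by_cases hx : x = 0
    · rw [hx]
      refine continuousAt_const (y := (0 : ℝ)) |>.congr ?_
      filter_upwards [ann_eq_zero_near n] with y hy
      simp only [hf]; rw [hy, mul_zero]
    · exact (LocHolderOn.continuousOn A.hγ hfH).continuousAt (isOpen_ne.mem_nhds hx)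
  have hfar : ∀ x : Euc N, (n : ℝ) + 1 < ‖x‖ → f x = 0 := fun x hx => by
    simp only [hf]; rw [ann_eq_zero_far n hx, mul_zero]
  have hfcs : HasCompactSupport f := by
    refine HasCompactSupport.of_support_subset_isCompact (isCompact_closedBall 0 ((n : ℝ) + 1))
      fun y hy => ?_
    by_contra h
    exact hy (hfar y (by simpa using h))
  obtain ⟨M, hM⟩ := hfcs.exists_bound_of_continuous hfc
  have hM' : ∀ x, f x ≤ M := fun x => (le_abs_self _).trans (hM x)
  have hfm := hfc.measurable
  have hint := integrable_nk_mul_of_bounded A.hN hfm hf0 hM' hfar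
  obtain ⟨B, hB⟩ := pot_bounded A.hN hfm hf0 hM' hfar
  obtain ⟨D, hD0, hD⟩ := pot_decay A.hN hfm hf0 hM' hfar
  have hk := kap_pos A.hN
  have hN3 : (3 : ℝ) ≤ N := by exact_mod_cast A.hN
  refine ⟨hf0, hfm, hint, ?_⟩
  have hul : LocallyIntegrable (pot f) :=
    locallyIntegrable_of_bound (measurable_pot hfm) (M := B) fun x => by
      rw [abs_of_nonneg (pot_nonneg hf0 x)]; exact hB x
  have hreg : ∀ x ≠ 0, ContDiffAt ℝ 2 (pot f) x ∧ lap (pot f) x = -(kap N * f x) := fun x hx =>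
    pot_regularity A.hN hfm hf0 (fun x _ => hint x) hul A.hγ A.hγ1.le hfH hx
  have hvc : ContinuousOn v {x | x ≠ 0} := LocHolderOn.continuousOn A.hγ hvH
  have main : ∀ δ > 0, ∀ x ≠ 0, 0 ≤ v x + δ * gam x - (kap N)⁻¹ * pot f x := by
    intro δ hδ
    refine comparison ?_ ?_ ?_ ?_
    · refine ((hvc.add ?_)).sub ?_
      · exact fun x hx => (contDiffAt_gam (n := 0) hx).continuousAt.continuousWithinAt.const_mul _
      · exact fun x hx => ((hreg x hx).1.continuousAt.const_mul _).continuousWithinAt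
    · filter_upwards [eventually_le_rpow_zero (N := N) (p := -((N : ℝ) - 2) / 2) (q := 0)
        (by linarith) ((kap N)⁻¹ * B) hδ, self_mem_nhdsWithin] with x hx hx0
      have h1 := hv0 x hx0
      have h2 : (kap N)⁻¹ * pot f x ≤ (kap N)⁻¹ * B := by gcongr; exact hB x
      rw [Real.rpow_zero, mul_one] at hx
      unfold gam
      linarith
    · filter_upwards [eventually_le_rpow_infty (N := N) (p := -((N : ℝ) - 2) / 2)
        (q := 2 - (N : ℝ)) (by linarith) ((kap N)⁻¹ * D) hδ,
        tendsto_norm_cocompact_atTop.eventually (eventually_ge_atTop (2 * ((n : ℝ) + 1)))] with x hx hxn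
      have hx0 : x ≠ 0 := fun h => by
        rw [h, norm_zero] at hxn
        linarith [(n.cast_nonneg : (0 : ℝ) ≤ n)]
      have h1 := hv0 x hx0
      have h2 : (kap N)⁻¹ * pot f x ≤ (kap N)⁻¹ * (D * ‖x‖ ^ (2 - (N : ℝ))) := by
        gcongr; exact hD x hx0 hxn
      unfold gam
      linarith
    · intro x hx _
      obtain ⟨φ, hφ, hφx, hφv, hφl⟩ := hvt x hx
      have hg : ContDiffAt ℝ 2 (gam : Euc N → ℝ) x := contDiffAt_gam hx
      obtain ⟨hp, hpl⟩ := hreg x hx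
      refine ⟨fun y => φ y + δ * gam y - (kap N)⁻¹ * pot f y,
        (hφ.add (contDiffAt_const.mul hg)).sub (contDiffAt_const.mul hp), by simp only [hφx], ?_, ?_⟩
      · filter_upwards [hφv] with y hy
        linarith
      · rw [lap_sub (hφ.add (contDiffAt_const.mul hg)) (contDiffAt_const.mul hp),
          lap_add hφ (contDiffAt_const.mul hg), lap_const_mul _ hg, lap_const_mul _ hp, hpl, lap_gam hx,
          mul_neg (kap N)⁻¹, inv_mul_cancel_left₀ hk.ne']
        have h1 : f x ≤ mu0 N * V x * v x := by
          simp only [hf]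
          exact mul_le_of_le_one_right (mul_nonneg (mul_nonneg (mu0_pos A.hN).le (A.pos x hx).le)
            (hv0 x hx)) (ann_le_one _ _)
        have h2 : 0 < δ * (mu0 N * ‖x‖ ^ (-2 : ℝ) * gam x) := by
          have := mu0_pos A.hN
          have := gam_pos hx
          have : 0 < ‖x‖ ^ (-2 : ℝ) := Real.rpow_pos_of_pos (norm_pos_iff.2 hx) _
          positivity
        linarith
  intro x hx
  refine le_of_forall_pos_le_add fun ε hε => ?_
  have := main (ε / gam x) (div_pos hε (gam_pos hx)) x hx
  rw [div_mul_cancel₀ _ (gam_pos hx).ne'] at this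
  linarith

/-- A nonnegative viscosity supersolution dominates the potential of its source term. -/
lemma AdmV.TL_le_of_supersolution (A : AdmV N γ c V) {v : Euc N → ℝ} (hv0 : ∀ x ≠ 0, 0 ≤ v x)
    (hvH : LocHolderOn γ {x : Euc N | x ≠ 0} v)
    (hvt : ∀ x ≠ 0, ∃ φ : Euc N → ℝ, ContDiffAt ℝ 2 φ x ∧ φ x = v x ∧ (∀ᶠ y in 𝓝 x, v y ≤ φ y) ∧
      lap φ x ≤ -(mu0 N * V x * v x)) :
    ∀ x ≠ 0, TL V (fun y => ENNReal.ofReal (v y)) x ≤ ENNReal.ofReal (v x) := by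
  intro x hx
  have hk : 0 < (kap N)⁻¹ := inv_pos.2 (kap_pos A.hN)
  have hn := A.potential_cutoff_le hv0 hvH hvt
  have e : ∫⁻ y, ENNReal.ofReal (nk (x - y) * (mu0 N * V y)) * ENNReal.ofReal (v y) =
      ∫⁻ y, liminf (fun n : ℕ => ENNReal.ofReal (nk (x - y) * (src V v y * ann n y))) atTop := by
    refine lintegral_congr_ae ?_
    filter_upwards [ae_ne_zero A.hN] with y hy
    refine (Tendsto.liminf_eq ?_).symm
    refine tendsto_const_nhds.congr' ?_
    filter_upwards [ann_eventually_one hy] with n hn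
    rw [hn, mul_one, ← ENNReal.ofReal_mul' (hv0 y hy), src]
    congr 1
    ring
  have hb : ∀ n : ℕ, ∫⁻ y, ENNReal.ofReal (nk (x - y) * (src V v y * ann n y)) ≤
      ENNReal.ofReal (kap N * v x) := fun n => by
    obtain ⟨h0, hm, hi, hle⟩ := hn n
    rw [← ofReal_integral_eq_lintegral_ofReal (hi x)
      (Eventually.of_forall fun y => mul_nonneg (nk_nonneg _) (h0 y))]
    refine ENNReal.ofReal_le_ofReal ?_
    have := hle x hx
    rwa [inv_mul_le_iff₀ (kap_pos A.hN)] at this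
  unfold TL
  rw [e]
  have hle : ∫⁻ y, liminf (fun n : ℕ => ENNReal.ofReal (nk (x - y) * (src V v y * ann n y))) atTop ≤
      ENNReal.ofReal (kap N * v x) := by
    refine (lintegral_liminf_le fun n => ?_).trans ?_
    · exact ((measurable_nk.comp (measurable_const.sub measurable_id)).mul (hn n).2.1).ennreal_ofReal
    · refine (liminf_le_limsup).trans (limsup_le_of_le ?_ (Eventually.of_forall hb))
      isBoundedDefault
  calc _ ≤ ENNReal.ofReal (kap N)⁻¹ * ENNReal.ofReal (kap N * v x) := by gcongr
    _ = ENNReal.ofReal (v x) := by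
      rw [← ENNReal.ofReal_mul hk.le, inv_mul_cancel_left₀ (kap_pos A.hN).ne']

end

section

variable {N : ℕ}

/-! ### Barriers -/

lemma hasDerivAt_rpow_mul_log {s t : ℝ} (ht : 0 < t) :
    HasDerivAt (fun t => t ^ s * Real.log t) (s * (t ^ (s - 1) * Real.log t) + t ^ (s - 1)) t := by
  have := (Real.hasDerivAt_rpow_const (p := s) (Or.inl ht.ne')).mul (Real.hasDerivAt_log ht.ne')
  refine this.congr_deriv ?_
  rw [Real.rpow_sub_one ht.ne']
  ring

lemma contDiffAt_gam_log {x : Euc N} (hx : x ≠ 0) {n : WithTop ℕ∞} :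
    ContDiffAt ℝ n (fun y : Euc N => gam y * Real.log ‖y‖) x :=
  (contDiffAt_gam hx).mul (contDiffAt_log_norm hx)

lemma lap_gam_log {x : Euc N} (hx : x ≠ 0) : lap (fun y : Euc N => gam y * Real.log ‖y‖) x =
    -(mu0 N * ‖x‖ ^ (-2 : ℝ) * (gam x * Real.log ‖x‖)) := by
  have hx2 : 0 < ‖x‖ ^ 2 := by positivity
  set s : ℝ := -((N : ℝ) - 2) / 4 with hs
  have e : (fun y : Euc N => gam y * Real.log ‖y‖) =
      fun y => (fun t : ℝ => 2⁻¹ * (t ^ s * Real.log t)) (‖y‖ ^ 2) := by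
    funext y
    simp only [gam]
    rw [rpow_norm_eq, Real.log_pow, show -((N : ℝ) - 2) / 2 / 2 = s by rw [hs]; ring]
    push_cast; ring
  have h1 : ∀ᶠ t in 𝓝 (‖x‖ ^ 2), HasDerivAt (fun t : ℝ => 2⁻¹ * (t ^ s * Real.log t))
      (2⁻¹ * (s * (t ^ (s - 1) * Real.log t) + t ^ (s - 1))) t :=
    (eventually_gt_nhds hx2).mono fun t ht => (hasDerivAt_rpow_mul_log ht).const_mul _
  have h2 := (((hasDerivAt_rpow_mul_log (s := s - 1) hx2).const_mul s).add
    (Real.hasDerivAt_rpow_const (p := s - 1) (Or.inl hx2.ne'))).const_mul (2⁻¹ : ℝ)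
  rw [e, lap_radial h1 h2, show (-2 : ℝ) = 2 * (-1) by norm_num, Real.rpow_mul (norm_nonneg _),
    Real.rpow_two, Real.rpow_neg_one, Real.rpow_sub_one hx2.ne' (s - 1), Real.rpow_sub_one hx2.ne' s]
  have e1 : gam x = (‖x‖ ^ 2) ^ s := by
    rw [gam, rpow_norm_eq, show -((N : ℝ) - 2) / 2 / 2 = s by rw [hs]; ring]
  have e2 : mu0 N = 4 * s ^ 2 := by rw [mu0, hs]; ring
  have e3 : (N : ℝ) = 2 - 4 * s := by rw [hs]; ring
  rw [e1, e2, e3, Real.log_pow]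
  push_cast
  field_simp
  ring

/-- The subsolution supported in the ball of radius `r₀`. -/
def subsol (r₀ : ℝ) (x : Euc N) : ℝ :=
  gam x * (Real.log r₀ - r₀ - Real.log (min ‖x‖ r₀) + min ‖x‖ r₀)

lemma log_add_lt {r r₀ : ℝ} (hr : 0 < r) (hrr : r < r₀) (hr₀ : r₀ < 1) :
    0 < Real.log r₀ - r₀ - Real.log r + r := by
  have h3 : 0 < r₀ := hr.trans hrr
  have h1 : Real.log (r / r₀) < r / r₀ - 1 :=
    Real.log_lt_sub_one_of_pos (by positivity) (by rw [Ne, div_eq_one_iff_eq (by linarith)]; exact hrr.ne)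
  rw [Real.log_div hr.ne' (by linarith)] at h1
  have h2 : r - r₀ ≥ r / r₀ - 1 := by
    have : r / r₀ - 1 = (r - r₀) / r₀ := by field_simp
    rw [this, ge_iff_le, div_le_iff₀ h3]
    nlinarith
  linarith

lemma subsol_eq {r₀ : ℝ} {x : Euc N} (h : ‖x‖ < r₀) :
    subsol r₀ x = gam x * (Real.log r₀ - r₀ - Real.log ‖x‖ + ‖x‖) := by
  rw [subsol, min_eq_left h.le]

lemma subsol_eq_zero {r₀ : ℝ} {x : Euc N} (h : r₀ ≤ ‖x‖) : subsol r₀ x = 0 := by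
  rw [subsol, min_eq_right h]; ring

lemma subsol_pos {r₀ : ℝ} (hr₀ : r₀ < 1) {x : Euc N} (hx : x ≠ 0) (h : ‖x‖ < r₀) :
    0 < subsol r₀ x := by
  rw [subsol_eq h]
  exact mul_pos (gam_pos hx) (log_add_lt (norm_pos_iff.2 hx) h hr₀)

lemma subsol_nonneg {r₀ : ℝ} (hr₀ : r₀ < 1) {x : Euc N} (hx : x ≠ 0) : 0 ≤ subsol r₀ x := by
  rcases lt_or_ge ‖x‖ r₀ with h | h
  · exact (subsol_pos hr₀ hx h).le
  · exact (subsol_eq_zero h).ge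

lemma gam_zero (hN : 3 ≤ N) : gam (0 : Euc N) = 0 := by
  have : (3 : ℝ) ≤ N := by exact_mod_cast hN
  rw [gam, norm_zero, Real.zero_rpow]
  have : -((N : ℝ) - 2) / 2 < 0 := by linarith
  exact this.ne

lemma lipschitzWith_min_norm (R : ℝ) : LipschitzWith 1 fun x : Euc N => min ‖x‖ R :=
  lipschitzWith_one_norm.min_const R

lemma lipschitzWith_max_norm (R : ℝ) : LipschitzWith 1 fun x : Euc N => max ‖x‖ R :=
  lipschitzWith_one_norm.max_const R

section
variable {γ : ℝ}

lemma subsol_holder (hγ : 0 < γ) (hγ1 : γ < 1) {r₀ : ℝ} (hr₀ : 0 < r₀) :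
    LocHolderOn γ {x : Euc N | x ≠ 0} (subsol r₀) :=
  LocHolderOn.mul hγ (locHolderOn_of_contDiffAt hγ hγ1 fun _ hx => contDiffAt_gam hx)
    (locHolderOn_comp (ψ := fun r => Real.log r₀ - r₀ - Real.log r + r) hγ hγ1
      (lipschitzWith_min_norm r₀) fun _ hx =>
        (contDiffAt_const.sub (contDiffAt_id.log (lt_min (norm_pos_iff.2 hx) hr₀).ne')).add contDiffAt_id)

/-- The supersolution with decay exponent `-(N-2)/2 - δ`. -/
def supsol (δ R : ℝ) (x : Euc N) : ℝ :=
  gam x * (δ⁻¹ + Real.log R - Real.log (min ‖x‖ R)) * (max ‖x‖ R / R) ^ (-δ)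

lemma supsol_holder (hγ : 0 < γ) (hγ1 : γ < 1) {δ R : ℝ} (hR : 0 < R) :
    LocHolderOn γ {x : Euc N | x ≠ 0} (supsol δ R) :=
  LocHolderOn.mul hγ
    (LocHolderOn.mul hγ (locHolderOn_of_contDiffAt hγ hγ1 fun _ hx => contDiffAt_gam hx)
    (locHolderOn_comp (ψ := fun r => δ⁻¹ + Real.log R - Real.log r) hγ hγ1
      (lipschitzWith_min_norm R) fun _ hx =>
        contDiffAt_const.sub (contDiffAt_id.log (lt_min (norm_pos_iff.2 hx) hR).ne')))
    (locHolderOn_comp (ψ := fun r => (r / R) ^ (-δ)) hγ hγ1 (lipschitzWith_max_norm R) fun _ _ =>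
      (contDiffAt_id.div_const R).rpow_const_of_ne
        (div_pos (lt_max_of_lt_right hR) hR).ne')

end

section
variable {δ R : ℝ}

lemma supsol_eq (hR : 0 < R) {x : Euc N} (h : ‖x‖ ≤ R) :
    supsol δ R x = gam x * (δ⁻¹ + Real.log R - Real.log ‖x‖) := by
  rw [supsol, min_eq_left h, max_eq_right h, div_self hR.ne', Real.one_rpow, mul_one]

lemma gam_mul_rpow {x : Euc N} (hx : x ≠ 0) (δ : ℝ) :
    gam x * ‖x‖ ^ (-δ) = ‖x‖ ^ (-((N : ℝ) - 2) / 2 - δ) := by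
  rw [gam, ← Real.rpow_add (norm_pos_iff.2 hx)]
  rfl

lemma supsol_eq_far (hR : 0 < R) {x : Euc N} (hx : x ≠ 0) (h : R ≤ ‖x‖) :
    supsol δ R x = δ⁻¹ * R ^ δ * ‖x‖ ^ (-((N : ℝ) - 2) / 2 - δ) := by
  rw [supsol, min_eq_right h, max_eq_left h, add_sub_cancel_right,
    Real.div_rpow (norm_nonneg _) hR.le, Real.rpow_neg hR.le, ← gam_mul_rpow hx]
  field_simp

lemma supsol_le (hδ : 0 < δ) (hR : 0 < R) {x : Euc N} (hx : x ≠ 0) :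
    supsol δ R x ≤ δ⁻¹ * R ^ δ * ‖x‖ ^ (-((N : ℝ) - 2) / 2 - δ) := by
  rcases le_total R ‖x‖ with h | h
  · exact (supsol_eq_far hR hx h).le
  · have hp := norm_pos_iff.2 hx
    rw [supsol_eq hR h, ← gam_mul_rpow hx]
    have h1 : δ * (Real.log R - Real.log ‖x‖) + 1 ≤ R ^ δ * ‖x‖ ^ (-δ) := by
      rw [Real.rpow_def_of_pos hR, Real.rpow_def_of_pos hp, ← Real.exp_add]
      refine (Real.add_one_le_exp _).trans (le_of_eq ?_)
      congr 1
      ring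
    have h2 : δ⁻¹ + Real.log R - Real.log ‖x‖ = δ⁻¹ * (δ * (Real.log R - Real.log ‖x‖) + 1) := by
      field_simp; ring
    rw [h2]
    calc _ ≤ gam x * (δ⁻¹ * (R ^ δ * ‖x‖ ^ (-δ))) := by
          gcongr
          exact (gam_pos hx).le
      _ = _ := by ring

lemma supsol_pos (hδ : 0 < δ) (hR : 0 < R) {x : Euc N} (hx : x ≠ 0) : 0 < supsol δ R x := by
  have hp := norm_pos_iff.2 hx
  have h1 : Real.log (min ‖x‖ R) ≤ Real.log R := Real.log_le_log (lt_min hp hR) (min_le_right _ _)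
  have h2 : 0 < δ⁻¹ := by positivity
  have h3 : 0 < max ‖x‖ R := lt_max_of_lt_right hR
  exact mul_pos (mul_pos (gam_pos hx) (by linarith)) (by positivity)

lemma subsol_le_supsol {r₀ : ℝ} (hr₀ : r₀ < 1) (hδ : 0 < δ) (hR : 1 ≤ R)
    {x : Euc N} (hx : x ≠ 0) : subsol r₀ x ≤ supsol δ R x := by
  rcases lt_or_ge ‖x‖ r₀ with h | h
  · rw [subsol_eq h, supsol_eq (by linarith) (by linarith)]
    have h1 : Real.log r₀ ≤ 0 := Real.log_nonpos ((norm_nonneg x).trans h.le) hr₀.le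
    have h2 : 0 ≤ Real.log R := Real.log_nonneg hR
    have h3 : 0 < δ⁻¹ := by positivity
    exact mul_le_mul_of_nonneg_left (by linarith) (gam_nonneg x)
  · rw [subsol_eq_zero h]
    exact (supsol_pos hδ (by linarith) hx).le

end

section
variable {γ c : ℝ} {V : Euc N → ℝ}

lemma AdmV.TL_supsol_le (A : AdmV N γ c V) {δ R : ℝ} (hδ : 0 < δ) (hR : 0 < R)
    (hVR : ∀ x : Euc N, R ≤ ‖x‖ → mu0 N * (V x * ‖x‖ ^ 2) ≤ mu0 N - δ ^ 2) {x : Euc N} (hx : x ≠ 0) :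
    TL V (fun y => ENNReal.ofReal (supsol δ R y)) x ≤ ENNReal.ofReal (supsol δ R x) := by
  refine A.TL_le_of_supersolution (fun x hx => (supsol_pos hδ hR hx).le)
    (supsol_holder A.hγ A.hγ1 hR) (fun x hx => ?_) x hx
  have hpos := supsol_pos hδ hR hx
  have hp := norm_pos_iff.2 hx
  rcases lt_or_ge ‖x‖ R with h | h
  · have hg : ContDiffAt ℝ 2 (gam : Euc N → ℝ) x := contDiffAt_gam hx
    have hgl : ContDiffAt ℝ 2 (fun y : Euc N => gam y * Real.log ‖y‖) x := contDiffAt_gam_log hx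
    refine ⟨fun y => (δ⁻¹ + Real.log R) * gam y - gam y * Real.log ‖y‖,
      (contDiffAt_const.mul hg).sub hgl, ?_, ?_, ?_⟩
    · rw [supsol_eq hR h.le]; ring
    · filter_upwards [continuous_norm.continuousAt.eventually (gt_mem_nhds h)] with y hy
      rw [supsol_eq hR (le_of_lt hy)]
      exact le_of_eq (by ring)
    · rw [lap_sub (contDiffAt_const.mul hg) hgl, lap_const_mul _ hg, lap_gam hx, lap_gam_log hx]
      have h1 : mu0 N * V x * supsol δ R x ≤ mu0 N * ‖x‖ ^ (-2 : ℝ) * supsol δ R x := by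
        have := A.hi x hx
        have := (mu0_pos A.hN).le
        gcongr
      refine le_trans (le_of_eq ?_) (neg_le_neg h1)
      rw [supsol_eq hR h.le]
      ring
  · have hr : ContDiffAt ℝ 2 (fun y : Euc N => ‖y‖ ^ (-((N : ℝ) - 2) / 2 - δ)) x :=
      contDiffAt_rpow_norm _ hx
    refine ⟨fun y => δ⁻¹ * R ^ δ * ‖y‖ ^ (-((N : ℝ) - 2) / 2 - δ),
      contDiffAt_const.mul hr, (supsol_eq_far hR hx h).symm, ?_, ?_⟩
    · filter_upwards [isOpen_ne.mem_nhds hx] with y hy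
      exact supsol_le hδ hR hy
    · rw [lap_const_mul _ hr, lap_rpow_norm _ hx,
        show -((N : ℝ) - 2) / 2 - δ - 2 = -((N : ℝ) - 2) / 2 - δ + -2 by ring, Real.rpow_add hp]
      have h1 : mu0 N * V x * supsol δ R x ≤ (mu0 N - δ ^ 2) * ‖x‖ ^ (-2 : ℝ) * supsol δ R x := by
        refine mul_le_mul_of_nonneg_right ?_ hpos.le
        rw [Real.rpow_neg hp.le, Real.rpow_two, ← div_eq_mul_inv, le_div_iff₀ (by positivity)]
        linarith [hVR x h]
      refine le_trans (le_of_eq ?_) (neg_le_neg h1)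
      rw [supsol_eq_far hR hx h]
      unfold mu0
      ring

lemma lap_subsol_gt (A : AdmV N γ c V) {r₀ : ℝ} (hr₀ : r₀ < 1) (hcr : mu0 N * c * r₀ < 1)
    {x : Euc N} (hx : x ≠ 0) (h : ‖x‖ < r₀) : ContDiffAt ℝ 2 (subsol r₀) x ∧
      -(mu0 N * V x * subsol r₀ x) < lap (subsol r₀) x := by
  have hp := norm_pos_iff.2 hx
  have hg : ContDiffAt ℝ 2 (gam : Euc N → ℝ) x := contDiffAt_gam hx
  have hgl : ContDiffAt ℝ 2 (fun y : Euc N => gam y * Real.log ‖y‖) x := contDiffAt_gam_log hx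
  have hg1 : ContDiffAt ℝ 2 (fun y : Euc N => ‖y‖ ^ (-((N : ℝ) - 2) / 2 + 1)) x :=
    contDiffAt_rpow_norm _ hx
  have e1 : ∀ y : Euc N, y ≠ 0 → ‖y‖ ^ (-((N : ℝ) - 2) / 2 + 1) = gam y * ‖y‖ := fun y hy => by
    rw [Real.rpow_add (norm_pos_iff.2 hy), Real.rpow_one]; rfl
  have e : subsol r₀ =ᶠ[𝓝 x] fun y => (Real.log r₀ - r₀) * gam y - gam y * Real.log ‖y‖ +
      ‖y‖ ^ (-((N : ℝ) - 2) / 2 + 1) := by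
    filter_upwards [continuous_norm.continuousAt.eventually (gt_mem_nhds h),
      isOpen_ne.mem_nhds hx] with y hy hy0
    rw [subsol_eq hy, e1 y hy0]
    ring
  have hs := ((contDiffAt_const (c := Real.log r₀ - r₀)).mul hg).sub hgl
  refine ⟨(hs.add hg1).congr_of_eventuallyEq e, ?_⟩
  rw [lap_congr e, lap_add hs hg1, lap_sub (contDiffAt_const.mul hg) hgl, lap_const_mul _ hg,
    lap_gam hx, lap_gam_log hx, lap_rpow_norm _ hx,
    show -((N : ℝ) - 2) / 2 + 1 - 2 = -((N : ℝ) - 2) / 2 + 1 + -2 by ring, Real.rpow_add hp, e1 x hx]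
  have hh := log_add_lt hp h hr₀
  set H := Real.log r₀ - r₀ - Real.log ‖x‖ + ‖x‖ with hH
  have hHr : ‖x‖ * H ≤ r₀ := by
    have h1 : Real.log (r₀ / ‖x‖) ≤ r₀ / ‖x‖ - 1 := Real.log_le_sub_one_of_pos (div_pos (hp.trans h) hp)
    rw [Real.log_div (by linarith) hp.ne'] at h1
    have h2 : H ≤ r₀ / ‖x‖ := by rw [hH]; linarith
    calc ‖x‖ * H ≤ ‖x‖ * (r₀ / ‖x‖) := by gcongr
      _ = r₀ := by field_simp
  have hVl := A.lo x hx
  have hm := mu0_pos A.hN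
  have hgp := gam_pos hx
  rw [Real.rpow_neg hp.le, Real.rpow_two] at *
  have k1 : mu0 N * c * H * ‖x‖ < 1 := by
    have := mul_le_mul_of_nonneg_left hHr (mul_nonneg hm.le A.hc.le)
    linarith
  have k2 : mu0 N * c * H < ‖x‖⁻¹ := by
    rw [← one_div, lt_div_iff₀ hp]; exact k1
  have k3 : mu0 N * H * ((‖x‖ ^ 2)⁻¹ - V x) ≤ mu0 N * H * c :=
    mul_le_mul_of_nonneg_left (by linarith) (by positivity)
  have k4 : gam x * (mu0 N * H * ((‖x‖ ^ 2)⁻¹ - V x)) < gam x * ‖x‖⁻¹ :=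
    mul_lt_mul_of_pos_left (by linarith) hgp
  rw [subsol_eq h, ← hH]
  have e4 : (-((N : ℝ) - 2) / 2 + 1) * (-((N : ℝ) - 2) / 2 + 1 + N - 2) = 1 - mu0 N := by
    unfold mu0; ring
  have e5 : (1 - mu0 N) * (gam x * ‖x‖ * (‖x‖ ^ 2)⁻¹) =
      gam x * ‖x‖⁻¹ - mu0 N * (‖x‖ ^ 2)⁻¹ * (gam x * ‖x‖) := by
    field_simp
  rw [e4, e5]
  have e6 : (Real.log r₀ - r₀) * -(mu0 N * (‖x‖ ^ 2)⁻¹ * gam x) -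
      -(mu0 N * (‖x‖ ^ 2)⁻¹ * (gam x * Real.log ‖x‖)) +
      (gam x * ‖x‖⁻¹ - mu0 N * (‖x‖ ^ 2)⁻¹ * (gam x * ‖x‖)) =
      gam x * ‖x‖⁻¹ - mu0 N * (‖x‖ ^ 2)⁻¹ * (gam x * H) := by rw [hH]; ring
  rw [e6]
  linarith

lemma AdmV.subsol_le_TL (A : AdmV N γ c V) {r₀ : ℝ} (hr₀0 : 0 < r₀) (hr₀ : r₀ < 1)
    (hcr : mu0 N * c * r₀ < 1) {U : Euc N → ℝ} (hU : ∀ x ≠ 0, 0 ≤ U x)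
    (hUi : LocallyIntegrable U)
    (h : ∀ x ≠ 0, TL V (fun y => ENNReal.ofReal (subsol r₀ y)) x ≤ ENNReal.ofReal (U x)) :
    ∀ x ≠ 0, ENNReal.ofReal (subsol r₀ x) ≤ TL V (fun y => ENNReal.ofReal (subsol r₀ y)) x := by
  have hk := kap_pos A.hN
  have hN3 : (3 : ℝ) ≤ N := by exact_mod_cast A.hN
  have hsH : LocHolderOn γ {x : Euc N | x ≠ 0} (subsol r₀) := subsol_holder A.hγ A.hγ1 hr₀0
  have hsc : ContinuousOn (subsol r₀) {x : Euc N | x ≠ 0} := LocHolderOn.continuousOn A.hγ hsH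
  have hsm := measurable_of_continuousOn_ne hsc
  have hs0 : subsol r₀ (0 : Euc N) = 0 := by rw [subsol, gam_zero A.hN, zero_mul]
  have hsn : ∀ x : Euc N, 0 ≤ subsol r₀ x := fun x => by
    by_cases hx : x = 0
    · rw [hx, hs0]
    · exact subsol_nonneg hr₀ hx
  have hp := fun x (hx : x ≠ 0) => A.pot_of_TL_le hsm hsn hs0 hU h hx
  have hul := A.locallyIntegrable_pot hsm hsn hs0 hU hUi h
  have hreg : ∀ x ≠ 0, ContDiffAt ℝ 2 (pot (src V (subsol r₀))) x ∧
      lap (pot (src V (subsol r₀))) x = -(kap N * src V (subsol r₀) x) := fun x hx =>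
    pot_regularity A.hN (A.src_measurable hsm) (A.src_nonneg hsn hs0) (fun x hx => (hp x hx).1) hul
      A.hγ A.hγ1.le (A.src_holder hsH) hx
  have hpn : ∀ x, 0 ≤ (kap N)⁻¹ * pot (src V (subsol r₀)) x := fun x =>
    mul_nonneg (inv_pos.2 hk).le (pot_nonneg (A.src_nonneg hsn hs0) x)
  set q : ℝ := -(3 * ((N : ℝ) - 2) / 4) with hq
  have main : ∀ δ > 0, ∀ x ≠ 0, 0 ≤ (kap N)⁻¹ * pot (src V (subsol r₀)) x + δ * ‖x‖ ^ q - subsol r₀ x := by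
    intro δ hδ
    refine comparison ?_ ?_ ?_ ?_
    · refine (ContinuousOn.add ?_ ?_).sub hsc
      · exact fun x hx => ((hreg x hx).1.continuousAt.const_mul _).continuousWithinAt
      · exact fun x hx => ((contDiffAt_rpow_norm (n := 0) q hx).continuousAt.const_mul _).continuousWithinAt
    · filter_upwards [eventually_le_rpow_zero (N := N) (p := q) (q := -((N : ℝ) - 2) / 2 - ((N : ℝ) - 2) / 8)
        (by rw [hq]; linarith) ((((N : ℝ) - 2) / 8)⁻¹ * 1 ^ (((N : ℝ) - 2) / 8)) hδ,
        self_mem_nhdsWithin] with x hx hx0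
      have h1 := subsol_le_supsol (δ := ((N : ℝ) - 2) / 8) (R := 1) hr₀ (by linarith) le_rfl hx0
      have h2 := supsol_le (δ := ((N : ℝ) - 2) / 8) (R := 1) (by linarith) one_pos hx0
      have h3 := hpn x
      linarith
    · filter_upwards [tendsto_norm_cocompact_atTop.eventually (eventually_ge_atTop r₀)] with x hx
      rw [subsol_eq_zero hx, sub_zero]
      exact add_nonneg (hpn x) (by positivity)
    · intro x hx hneg
      have hlt : ‖x‖ < r₀ := by
        by_contra! hge
        rw [subsol_eq_zero hge, sub_zero] at hneg
        exact absurd hneg (not_lt.2 (add_nonneg (hpn x) (by positivity)))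
      obtain ⟨hsd, hsl⟩ := lap_subsol_gt A hr₀ hcr hx hlt
      obtain ⟨hpd, hpl⟩ := hreg x hx
      have hqd : ContDiffAt ℝ 2 (fun y : Euc N => ‖y‖ ^ q) x := contDiffAt_rpow_norm _ hx
      refine ⟨_, ((contDiffAt_const.mul hpd).add (contDiffAt_const.mul hqd)).sub hsd, rfl,
        Eventually.of_forall fun _ => le_rfl, ?_⟩
      rw [lap_sub ((contDiffAt_const.mul hpd).add (contDiffAt_const.mul hqd)) hsd,
        lap_add (contDiffAt_const.mul hpd) (contDiffAt_const.mul hqd), lap_const_mul _ hpd,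
        lap_const_mul _ hqd, hpl, lap_rpow_norm _ hx, mul_neg (kap N)⁻¹, inv_mul_cancel_left₀ hk.ne']
      have h1 : δ * (q * (q + N - 2) * ‖x‖ ^ (q - 2)) ≤ 0 := by
        have h2 : q * (q + N - 2) ≤ 0 := mul_nonpos_of_nonpos_of_nonneg (by rw [hq]; linarith)
          (by rw [hq]; linarith)
        exact mul_nonpos_of_nonneg_of_nonpos hδ.le
          (mul_nonpos_of_nonpos_of_nonneg h2 (by positivity))
      unfold src
      linarith
  intro x hx
  rw [(hp x hx).2.1]
  refine ENNReal.ofReal_le_ofReal (le_of_forall_pos_le_add fun ε hε => ?_)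
  have hxq : 0 < ‖x‖ ^ q := Real.rpow_pos_of_pos (norm_pos_iff.2 hx) _
  have := main (ε / ‖x‖ ^ q) (div_pos hε hxq) x hx
  rw [div_mul_cancel₀ _ hxq.ne'] at this
  linarith

end

end

section

variable {N : ℕ}

/-! ### The minimal solution -/

lemma measurable_TL {V : Euc N → ℝ} (hV : Measurable V) {f : Euc N → ENNReal} (hf : Measurable f) :
    Measurable (TL V f) := by
  have h : Measurable fun p : Euc N × Euc N =>
      ENNReal.ofReal (nk (p.1 - p.2) * (mu0 N * V p.2)) * f p.2 :=
    ((measurable_nk.comp (measurable_fst.sub measurable_snd)).mul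
      ((hV.comp measurable_snd).const_mul _)).ennreal_ofReal.mul (hf.comp measurable_snd)
  exact h.lintegral_prod_right'.const_mul _

lemma exists_least_fixedPoint (hN : 3 ≤ N) {V : Euc N → ℝ} (hV : Measurable V)
    {w : Euc N → ENNReal} (hw : Measurable w) (h : ∀ x ≠ 0, w x ≤ TL V w x) :
    ∃ F : Euc N → ENNReal, Measurable F ∧ (∀ x ≠ 0, w x ≤ F x) ∧ (∀ x ≠ 0, TL V F x = F x) ∧
      ∀ G : Euc N → ENNReal, (∀ x ≠ 0, w x ≤ G x) → (∀ x ≠ 0, TL V G x ≤ G x) →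
        ∀ x ≠ 0, F x ≤ G x := by
  set f : ℕ → Euc N → ENNReal := fun n => (TL V)^[n] w with hf
  have hs : ∀ n, f (n + 1) = TL V (f n) := fun n => Function.iterate_succ_apply' _ _ _
  have hm : ∀ n, Measurable (f n) := fun n => by
    induction n with
    | zero => exact hw
    | succ n ih => rw [hs]; exact measurable_TL hV ih
  have hmono : ∀ n, ∀ x ≠ 0, f n x ≤ f (n + 1) x := fun n => by
    induction n with
    | zero => exact h
    | succ n ih => intro x _; rw [hs n, hs (n + 1)]; exact TL_mono hN ih x
  have hmono' : ∀ x ≠ 0, Monotone fun n => f n x := fun x hx =>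
    monotone_nat_of_le_succ fun n => hmono n x hx
  refine ⟨fun x => ⨆ n, f n x, Measurable.iSup hm, fun x _ => le_iSup (fun n => f n x) 0,
    fun x hx => ?_, fun G hG hTG => ?_⟩
  · have e : TL V (fun y => ⨆ n, f n y) x = ⨆ n, TL V (f n) x := by
      unfold TL
      rw [← ENNReal.mul_iSup, ← lintegral_iSup']
      · simp_rw [ENNReal.mul_iSup]
      · intro n
        exact (((measurable_nk.comp (measurable_const.sub measurable_id)).mul
          (hV.const_mul _)).ennreal_ofReal.mul (hm n)).aemeasurable
      · filter_upwards [ae_ne_zero hN] with y hy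
        intro m n hmn
        exact mul_le_mul_right (hmono' y hy hmn) _
    rw [e]
    simp_rw [← hs]
    exact (hmono' x hx).iSup_nat_add 1
  · have : ∀ n, ∀ x ≠ 0, f n x ≤ G x := fun n => by
      induction n with
      | zero => exact hG
      | succ n ih => intro x hx; rw [hs]; exact (TL_mono hN ih x).trans (hTG x hx)
    exact fun x hx => iSup_le fun n => this n x hx

variable {γ c : ℝ} {V : Euc N → ℝ}

/-- The regularity of a finite fixed point of `TL V`. -/
lemma AdmV.regularity_of_fixedPoint (A : AdmV N γ c V) {u U : Euc N → ℝ} (hum : Measurable u)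
    (hu0 : ∀ x, 0 ≤ u x) (hu : u 0 = 0) (hUi : LocallyIntegrable U)
    (hUc : ContinuousOn U {x | x ≠ 0}) (huU : ∀ x ≠ 0, u x ≤ U x)
    (h : ∀ x ≠ 0, TL V (fun y => ENNReal.ofReal (u y)) x = ENNReal.ofReal (u x)) :
    (∀ x ≠ 0, ContDiffAt ℝ 2 u x ∧ lap u x = -(mu0 N * V x * u x)) ∧
      ∀ x ≠ 0, Integrable (fun y => nk (x - y) * src V u y) ∧
        u x = (kap N)⁻¹ * pot (src V u) x := by
  have hk := kap_pos A.hN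
  have hU0 : ∀ x ≠ 0, 0 ≤ U x := fun x hx => (hu0 x).trans (huU x hx)
  have hle : ∀ x ≠ 0, TL V (fun y => ENNReal.ofReal (u y)) x ≤ ENNReal.ofReal (U x) :=
    fun x hx => (h x hx).trans_le (ENNReal.ofReal_le_ofReal (huU x hx))
  have hP := fun x (hx : x ≠ 0) => A.pot_of_TL_le hum hu0 hu hU0 hle hx
  have hLI := A.locallyIntegrable_pot hum hu0 hu hU0 hUi hle
  have hs0 := A.src_nonneg hu0 hu
  have hsm := A.src_measurable hum
  have hrep : ∀ x ≠ 0, u x = (kap N)⁻¹ * pot (src V u) x := fun x hx => by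
    have h1 := (hP x hx).2.1
    rw [h x hx, ENNReal.ofReal_eq_ofReal_iff (hu0 x)
      (mul_nonneg (inv_pos.2 hk).le (pot_nonneg hs0 x))] at h1
    exact h1
  have hev : ∀ x : Euc N, x ≠ 0 → u =ᶠ[𝓝 x] fun y => (kap N)⁻¹ * pot (src V u) y := fun x hx => by
    filter_upwards [isOpen_ne.mem_nhds hx] with y hy using hrep y hy
  have hC1 : ∀ x : Euc N, x ≠ 0 → ContDiffAt ℝ 1 u x := fun x hx => by
    have hb : ∀ᶠ y in 𝓝 x, mu0 N * V y * U y < mu0 N * V x * U x + 1 :=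
      (((A.continuousOn.continuousAt (isOpen_ne.mem_nhds hx)).const_mul (mu0 N)).mul
        (hUc.continuousAt (isOpen_ne.mem_nhds hx))).eventually_lt continuousAt_const (by simp)
    obtain ⟨ε, hε, hball⟩ := Metric.eventually_nhds_iff_ball.1
      (hb.and (isOpen_ne.mem_nhds hx : ∀ᶠ y in 𝓝 x, y ≠ 0))
    refine ContDiffAt.congr_of_eventuallyEq (contDiffAt_const.mul
      (contDiffAt_one_pot (M := mu0 N * V x * U x + 1) A.hN hsm hs0
        (fun x hx => (hP x hx).1) hLI hx hε fun y hy => ?_)) (hev x hx)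
    have := mu0_pos A.hN
    have := A.pos y (hball y hy).2
    refine le_trans ?_ (hball y hy).1.le
    unfold src
    have := huU y (hball y hy).2
    gcongr
  have hH : LocHolderOn γ {x : Euc N | x ≠ 0} u := locHolderOn_of_contDiffAt A.hγ A.hγ1 hC1
  refine ⟨fun x hx => ?_, fun x hx => ⟨(hP x hx).1, hrep x hx⟩⟩
  obtain ⟨h1, h2⟩ := pot_regularity A.hN hsm hs0 (fun x hx => (hP x hx).1) hLI A.hγ A.hγ1.le
    (A.src_holder hH) hx
  refine ⟨(contDiffAt_const.mul h1).congr_of_eventuallyEq (hev x hx), ?_⟩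
  rw [lap_congr (hev x hx), lap_const_mul _ h1, h2, src]
  field_simp

lemma AdmV.exists_far_bound (A : AdmV N γ c V) {ϱ μ' : ℝ}
    (hVinf : limsup (fun x : Euc N => V x * ‖x‖ ^ 2) (normAtTop N) = ϱ)
    (h1 : ϱ * mu0 N < μ') (h2 : μ' < mu0 N) : ∃ R, 1 ≤ R ∧ ∀ x : Euc N, R ≤ ‖x‖ →
      mu0 N * (V x * ‖x‖ ^ 2) ≤ mu0 N - Real.sqrt (mu0 N - μ') ^ 2 := by
  have hm := mu0_pos A.hN
  have hb : ∀ᶠ x in normAtTop N, V x * ‖x‖ ^ 2 ≤ 1 := by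
    have : ∀ᶠ r : ℝ in atTop, 0 < r := eventually_gt_atTop 0
    filter_upwards [this.comap norm] with x hx
    have h3 := (A.hi x (norm_pos_iff.1 hx))
    rw [Real.rpow_neg hx.le, Real.rpow_two, ← one_div, le_div_iff₀ (by positivity)] at h3
    exact h3
  have h3 : ∀ᶠ x in normAtTop N, V x * ‖x‖ ^ 2 < μ' / mu0 N := by
    refine eventually_lt_of_limsup_lt ?_ ⟨1, by simpa using hb⟩
    rw [hVinf, lt_div_iff₀ hm]
    exact h1
  rw [normAtTop, eventually_comap] at h3
  obtain ⟨R, hR⟩ := eventually_atTop.1 h3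
  refine ⟨max R 1, le_max_right _ _, fun x hx => ?_⟩
  have h4 := hR ‖x‖ ((le_max_left _ _).trans hx) x rfl
  rw [lt_div_iff₀ hm] at h4
  rw [Real.sq_sqrt (by linarith)]
  linarith

lemma locallyIntegrable_supsol (hN : 3 ≤ N) {δ R : ℝ} (hδ : 0 < δ) (hδ1 : δ < ((N : ℝ) - 2) / 2) (hR : 0 < R) :
    LocallyIntegrable (supsol δ R : Euc N → ℝ) := by
  have h3 : (3 : ℝ) ≤ N := by exact_mod_cast hN
  have h1 := (locallyIntegrable_rpow hN (p := -((N : ℝ) - 2) / 2 - δ) (by linarith)).smul (δ⁻¹ * R ^ δ)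
  have hc : ContinuousOn (supsol δ R : Euc N → ℝ) {x | x ≠ 0} :=
    LocHolderOn.continuousOn (γ := 1 / 2) (by norm_num) (supsol_holder (by norm_num) (by norm_num) hR)
  refine h1.mono (measurable_of_continuousOn_ne hc).aestronglyMeasurable ?_
  filter_upwards [ae_ne_zero hN] with x hx
  rw [Real.norm_of_nonneg (supsol_pos hδ hR hx).le]
  exact (supsol_le hδ hR hx).trans (le_abs_self _)

/-- The solution obtained by monotone iteration from the subsolution `subsol r₀`. -/
structure IsMin (V : Euc N → ℝ) (ϱ r₀ : ℝ) (u : Euc N → ℝ) : Prop where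
  r₀_pos : 0 < r₀
  r₀_lt : r₀ < 1
  pos : ∀ x ≠ 0, 0 < u x
  contDiffAt : ∀ x ≠ 0, ContDiffAt ℝ 2 u x
  lap_eq : ∀ x ≠ 0, lap u x = -(mu0 N * V x * u x)
  subsol_le : ∀ x ≠ 0, subsol r₀ x ≤ u x
  le_supsol : ∀ μ', ϱ * mu0 N < μ' → μ' < mu0 N →
    ∃ R, 1 ≤ R ∧ ∀ x ≠ 0, u x ≤ supsol (Real.sqrt (mu0 N - μ')) R x
  le_of_super : ∀ v : Euc N → ℝ, (∀ x ≠ 0, 0 ≤ v x) →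
    (∀ x ≠ 0, TL V (fun y => ENNReal.ofReal (v y)) x ≤ ENNReal.ofReal (v x)) →
    (∀ x ≠ 0, subsol r₀ x ≤ v x) → ∀ x ≠ 0, u x ≤ v x

lemma AdmV.exists_isMin (A : AdmV N γ c V) {ϱ : ℝ} (hϱ : ϱ < 1)
    (hVinf : limsup (fun x : Euc N => V x * ‖x‖ ^ 2) (normAtTop N) = ϱ) :
    ∃ r₀ u, IsMin V ϱ r₀ u := by
  have hm := mu0_pos A.hN
  have h3 : (3 : ℝ) ≤ N := by exact_mod_cast A.hN
  have hc := A.hc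
  obtain ⟨r₀, hr₀0, hr₀, hcr⟩ : ∃ r₀ : ℝ, 0 < r₀ ∧ r₀ < 1 ∧ mu0 N * c * r₀ < 1 := by
    refine ⟨(1 + 1 + mu0 N * c)⁻¹, by positivity, inv_lt_one_of_one_lt₀ (by nlinarith), ?_⟩
    rw [← div_eq_mul_inv, div_lt_one (by positivity)]
    linarith
  have hδ : ∀ μ', μ' < mu0 N → 0 < Real.sqrt (mu0 N - μ') := fun μ' h => Real.sqrt_pos.2 (by linarith)
  have hTsup : ∀ μ', ϱ * mu0 N < μ' → μ' < mu0 N → ∃ R, 1 ≤ R ∧ ∀ x ≠ 0,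
      TL V (fun y => ENNReal.ofReal (supsol (Real.sqrt (mu0 N - μ')) R y)) x ≤
        ENNReal.ofReal (supsol (Real.sqrt (mu0 N - μ')) R x) := fun μ' h1 h2 => by
    obtain ⟨R, hR, hVR⟩ := A.exists_far_bound hVinf h1 h2
    exact ⟨R, hR, fun x hx => A.TL_supsol_le (hδ μ' h2) (by linarith) hVR hx⟩
  obtain ⟨μ, hμ1, hμ2, hμ3⟩ : ∃ μ, ϱ * mu0 N < μ ∧ μ < mu0 N ∧
      Real.sqrt (mu0 N - μ) < ((N : ℝ) - 2) / 2 := by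
    have h4 : max ϱ 0 < 1 := max_lt hϱ one_pos
    have h5 := le_max_left ϱ 0
    have h6 := le_max_right ϱ 0
    refine ⟨(max ϱ 0 + 1) / 2 * mu0 N, by nlinarith, by nlinarith, ?_⟩
    rw [Real.sqrt_lt' (by linarith), div_pow, show ((N : ℝ) - 2) ^ 2 / 2 ^ 2 = mu0 N by rw [mu0]; norm_num]
    nlinarith
  obtain ⟨R, hR, hTU⟩ := hTsup μ hμ1 hμ2
  set U : Euc N → ℝ := supsol (Real.sqrt (mu0 N - μ)) R with hU
  have hR0 : 0 < R := by linarith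
  have hUi : LocallyIntegrable U := locallyIntegrable_supsol A.hN (hδ μ hμ2) hμ3 hR0
  have hU0 : ∀ x ≠ 0, 0 ≤ U x := fun x hx => (supsol_pos (hδ μ hμ2) hR0 hx).le
  have hUc : ContinuousOn U {x | x ≠ 0} :=
    LocHolderOn.continuousOn A.hγ (supsol_holder A.hγ A.hγ1 hR0)
  have hsubc : ContinuousOn (subsol r₀ : Euc N → ℝ) {x | x ≠ 0} :=
    LocHolderOn.continuousOn A.hγ (subsol_holder A.hγ A.hγ1 hr₀0)
  have hsub : ∀ x ≠ 0, ENNReal.ofReal (subsol r₀ x) ≤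
      TL V (fun y => ENNReal.ofReal (subsol r₀ y)) x :=
    A.subsol_le_TL hr₀0 hr₀ hcr hU0 hUi fun x hx => (TL_mono A.hN (fun y hy =>
      ENNReal.ofReal_le_ofReal (subsol_le_supsol hr₀ (hδ μ hμ2) hR hy)) x).trans (hTU x hx)
  obtain ⟨F, hFm, hF1, hF2, hF3⟩ := exists_least_fixedPoint A.hN A.measurable
    (measurable_of_continuousOn_ne hsubc).ennreal_ofReal hsub
  have hFU : ∀ μ', ϱ * mu0 N < μ' → μ' < mu0 N →
    ∃ R, 1 ≤ R ∧ ∀ x ≠ 0, F x ≤ ENNReal.ofReal (supsol (Real.sqrt (mu0 N - μ')) R x) := by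
    intro μ' h1 h2
    obtain ⟨R, hR, h⟩ := hTsup μ' h1 h2
    exact ⟨R, hR, hF3 _ (fun x hx => ENNReal.ofReal_le_ofReal
      (subsol_le_supsol hr₀ (hδ μ' h2) hR hx)) h⟩
  have hFt : ∀ x ≠ 0, F x ≠ ⊤ := fun x hx => by
    obtain ⟨R, -, h⟩ := hFU μ hμ1 hμ2
    exact ((h x hx).trans_lt ENNReal.ofReal_lt_top).ne
  set u : Euc N → ℝ := ({0}ᶜ : Set (Euc N)).indicator fun x => (F x).toReal with hu
  have hux : ∀ x ≠ 0, u x = (F x).toReal := fun x hx => Set.indicator_of_mem (by simpa using hx) _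
  have hu0 : u 0 = 0 := Set.indicator_of_notMem (by simp) _
  have hof : ∀ x ≠ 0, ENNReal.ofReal (u x) = F x := fun x hx => by
    rw [hux x hx, ENNReal.ofReal_toReal (hFt x hx)]
  have hum : Measurable u := hFm.ennreal_toReal.indicator (measurableSet_singleton 0).compl
  have hun : ∀ x, 0 ≤ u x := Set.indicator_nonneg fun _ _ => ENNReal.toReal_nonneg
  have huG : ∀ v : Euc N → ℝ, (∀ x ≠ 0, 0 ≤ v x) → (∀ x ≠ 0, F x ≤ ENNReal.ofReal (v x)) →
      ∀ x ≠ 0, u x ≤ v x := fun v hv h x hx => by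
    rw [← ENNReal.ofReal_le_ofReal_iff (hv x hx), hof x hx]
    exact h x hx
  have hsup : ∀ μ', ϱ * mu0 N < μ' → μ' < mu0 N →
      ∃ R, 1 ≤ R ∧ ∀ x ≠ 0, u x ≤ supsol (Real.sqrt (mu0 N - μ')) R x := by
    intro μ' h1 h2
    obtain ⟨R, hR, h⟩ := hFU μ' h1 h2
    exact ⟨R, hR, huG _ (fun x hx => (supsol_pos (hδ μ' h2) (by linarith) hx).le) h⟩
  have hsubu : ∀ x ≠ 0, subsol r₀ x ≤ u x := fun x hx => by
    rw [← ENNReal.ofReal_le_ofReal_iff (hun x), hof x hx]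
    exact hF1 x hx
  obtain ⟨R', hR', huU⟩ := hsup μ hμ1 hμ2
  have hR'0 : 0 < R' := by linarith
  have hfix : ∀ x ≠ 0, TL V (fun y => ENNReal.ofReal (u y)) x = ENNReal.ofReal (u x) := fun x hx => by
    rw [hof x hx, ← hF2 x hx]
    exact le_antisymm (TL_mono A.hN (fun y hy => (hof y hy).le) x)
      (TL_mono A.hN (fun y hy => (hof y hy).ge) x)
  obtain ⟨hreg, hrep⟩ := A.regularity_of_fixedPoint hum hun hu0
    (locallyIntegrable_supsol A.hN (hδ μ hμ2) hμ3 hR'0)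
    (LocHolderOn.continuousOn A.hγ (supsol_holder A.hγ A.hγ1 hR'0)) huU hfix
  refine ⟨r₀, u, hr₀0, hr₀, fun x hx => ?_, fun x hx => (hreg x hx).1, fun x hx => (hreg x hx).2,
    hsubu, hsup, fun v hv hTv hsv => huG v hv (hF3 _ (fun x hx => ENNReal.ofReal_le_ofReal (hsv x hx)) hTv)⟩
  rw [(hrep x hx).2]
  have := nontrivial_euc A.hN
  refine mul_pos (inv_pos.2 (kap_pos A.hN)) ((integral_pos_iff_support_of_nonneg
    (fun y => mul_nonneg (nk_nonneg _) (A.src_nonneg hun hu0 y)) (hrep x hx).1).2 ?_)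
  refine lt_of_lt_of_le (b := volume (ball (0 : Euc N) r₀ \ {0, x})) ?_ (measure_mono fun y hy => ?_)
  · rw [measure_sdiff_null ((Set.toFinite _).measure_zero _)]
    exact measure_ball_pos _ _ hr₀0
  · simp only [Set.mem_sdiff, mem_ball_zero_iff, Set.mem_insert_iff, Set.mem_singleton_iff, not_or] at hy
    have h1 : 0 < u y := (subsol_pos hr₀ hy.2.1 hy.1).trans_le (hsubu y hy.2.1)
    have h2 := A.pos y hy.2.1
    have h4 : 0 < nk (x - y) := nk_pos (sub_ne_zero.2 (Ne.symm hy.2.2))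
    exact (mul_pos h4 (mul_pos (mul_pos hm h2) h1)).ne'

end

section

variable {N : ℕ}

lemma tendsto_neg_log_norm : Tendsto (fun x : Euc N => -Real.log ‖x‖) (𝓝[≠] 0) atTop :=
  tendsto_neg_atBot_atTop.comp (Real.tendsto_log_nhdsNE_zero.comp
    (tendsto_norm_nhdsNE.mono_right (nhdsWithin_mono _ fun _ h => ne_of_gt h)))

lemma IsMin.tendsto {V : Euc N → ℝ} {ϱ r₀ : ℝ} {u : Euc N → ℝ} (h : IsMin V ϱ r₀ u) (hN : 3 ≤ N)
    (hϱ : ϱ < 1) :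
    Tendsto (fun x => u x / (gam x * -Real.log ‖x‖)) (𝓝[≠] 0) (𝓝 1) := by
  have hm := mu0_pos hN
  obtain ⟨R, hR, hU⟩ := h.le_supsol ((ϱ + 1) / 2 * mu0 N) (by nlinarith) (by nlinarith)
  set δ := Real.sqrt (mu0 N - (ϱ + 1) / 2 * mu0 N)
  have hT : ∀ a : ℝ, Tendsto (fun x : Euc N => 1 + a / -Real.log ‖x‖) (𝓝[≠] 0) (𝓝 1) := fun a => by
    simpa using (tendsto_neg_log_norm.const_div_atTop a).const_add 1
  have hr : ∀ᶠ x : Euc N in 𝓝[≠] 0, ‖x‖ < r₀ :=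
    (continuous_norm.continuousAt.eventually (gt_mem_nhds (by simpa using h.r₀_pos))).filter_mono
      nhdsWithin_le_nhds
  refine tendsto_of_tendsto_of_tendsto_of_le_of_le' (hT (Real.log r₀ - r₀)) (hT (δ⁻¹ + Real.log R)) ?_ ?_
  · filter_upwards [hr, self_mem_nhdsWithin] with x hx hx0
    have hp : 0 < ‖x‖ := norm_pos_iff.2 hx0
    have hL : 0 < -Real.log ‖x‖ := neg_pos.2 (Real.log_neg hp (hx.trans h.r₀_lt))
    have hL' : Real.log ‖x‖ ≠ 0 := (neg_pos.1 hL).ne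
    have hg := gam_pos hx0
    have h1 := h.subsol_le x hx0
    rw [subsol_eq hx] at h1
    rw [le_div_iff₀ (by positivity)]
    refine le_trans ?_ h1
    have : (1 + (Real.log r₀ - r₀) / -Real.log ‖x‖) * (gam x * -Real.log ‖x‖) =
        gam x * (Real.log r₀ - r₀ - Real.log ‖x‖) := by field_simp; ring
    rw [this]
    gcongr
    linarith
  · filter_upwards [hr, self_mem_nhdsWithin] with x hx hx0
    have hp : 0 < ‖x‖ := norm_pos_iff.2 hx0
    have hL : 0 < -Real.log ‖x‖ := neg_pos.2 (Real.log_neg hp (hx.trans h.r₀_lt))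
    have hL' : Real.log ‖x‖ ≠ 0 := (neg_pos.1 hL).ne
    have hg := gam_pos hx0
    have h1 := hU x hx0
    rw [supsol_eq (by linarith) (by linarith [h.r₀_lt])] at h1
    rw [div_le_iff₀ (by positivity)]
    refine h1.trans (le_of_eq ?_)
    field_simp
    ring

lemma gam_sq {x : Euc N} (hx : x ≠ 0) : gam x * gam x = ‖x‖ ^ (2 - (N : ℝ)) := by
  rw [gam, ← Real.rpow_add (norm_pos_iff.2 hx)]
  ring_nf

lemma IsMin.exists_bound {V : Euc N → ℝ} {ϱ r₀ : ℝ} {u : Euc N → ℝ} (h : IsMin V ϱ r₀ u)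
    (hN : 3 ≤ N) (hϱ : ϱ < 1) : ∃ p C : ℝ, 1 - (N : ℝ) < p ∧ 0 ≤ C ∧
      ∀ x ≠ 0, u x * gam x ≤ C * ‖x‖ ^ p := by
  have hm := mu0_pos hN
  have hlt : max ((ϱ + 1) / 2 * mu0 N) (mu0 N - 1 / 4) < mu0 N := max_lt (by nlinarith) (by linarith)
  obtain ⟨R, hR, hU⟩ := h.le_supsol (max ((ϱ + 1) / 2 * mu0 N) (mu0 N - 1 / 4))
    (lt_max_of_lt_left (by nlinarith)) hlt
  set δ := Real.sqrt (mu0 N - max ((ϱ + 1) / 2 * mu0 N) (mu0 N - 1 / 4))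
  have hδ : 0 < δ := Real.sqrt_pos.2 (by linarith)
  have hδ1 : δ < 1 := by
    rw [Real.sqrt_lt' one_pos]
    have := le_max_right ((ϱ + 1) / 2 * mu0 N) (mu0 N - 1 / 4)
    linarith
  refine ⟨2 - N - δ, δ⁻¹ * R ^ δ, by linarith, by positivity, fun x hx => ?_⟩
  calc u x * gam x ≤ δ⁻¹ * R ^ δ * ‖x‖ ^ (-((N : ℝ) - 2) / 2 - δ) * gam x :=
        mul_le_mul_of_nonneg_right ((hU x hx).trans (supsol_le hδ (by linarith) hx)) (gam_nonneg x)
    _ = δ⁻¹ * R ^ δ * ‖x‖ ^ (2 - N - δ) := by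
        rw [← gam_mul_rpow hx, sub_eq_add_neg _ δ, Real.rpow_add (norm_pos_iff.2 hx), ← gam_sq hx]
        ring

end

section

variable {N : ℕ}

/-! ### Test functions with Lipschitz gradient -/

lemma norm_bv (i : Fin N) : ‖(bv i : Euc N)‖ = 1 := by simp [bv]

lemma lipschitzWith_fderiv_apply {ξ : Euc N → ℝ} {L : NNReal} (h : LipschitzWith L (fderiv ℝ ξ))
    (i : Fin N) : LipschitzWith L fun x => fderiv ℝ ξ x (bv i) := by
  refine LipschitzWith.of_dist_le_mul fun x y => ?_
  rw [Real.dist_eq, ← sub_apply]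
  refine ((fderiv ℝ ξ x - fderiv ℝ ξ y).le_opNorm (bv i)).trans ?_
  rw [norm_bv, mul_one, ← dist_eq_norm]
  exact h.dist_le_mul x y

lemma abs_lap_le {ξ : Euc N → ℝ} {L : NNReal} (h : LipschitzWith L (fderiv ℝ ξ)) (x : Euc N) :
    |lap ξ x| ≤ N * L := by
  refine (Finset.abs_sum_le_sum_abs _ _).trans ?_
  have : ∀ i ∈ (Finset.univ : Finset (Fin N)), |fderiv ℝ (fun y => fderiv ℝ ξ y (bv i)) x (bv i)| ≤ L :=
    fun i _ => by
      refine ((fderiv ℝ (fun y => fderiv ℝ ξ y (bv i)) x).le_opNorm (bv i)).trans ?_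
      rw [norm_bv, mul_one]
      exact norm_fderiv_le_of_lipschitz ℝ (lipschitzWith_fderiv_apply h i)
  refine (Finset.sum_le_sum this).trans (le_of_eq ?_)
  simp

lemma measurable_lap (ξ : Euc N → ℝ) : Measurable (lap ξ) :=
  Finset.measurable_sum _ fun _ _ => measurable_fderiv_apply_const ℝ _ _

lemma ae_differentiableAt_fderiv {ξ : Euc N → ℝ} (hξ : IsC11c ξ) :
    ∀ᵐ x, DifferentiableAt ℝ (fderiv ℝ ξ) x := by
  obtain ⟨-, -, L, hL⟩ := hξ
  exact hL.ae_differentiableAt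

lemma exists_fderiv_bound {ξ : Euc N → ℝ} (hξ : IsC11c ξ) : ∃ M, ∀ x, ‖fderiv ℝ ξ x‖ ≤ M := by
  obtain ⟨hc, -, L, hL⟩ := hξ
  exact (hc.fderiv (𝕜 := ℝ)).exists_bound_of_continuous hL.continuous

lemma integral_mul_lap_of_isC11c {φ ξ : Euc N → ℝ} (hφ : ContDiff ℝ 2 φ) (hφc : HasCompactSupport φ)
    (hξ : IsC11c ξ) : ∫ y, φ y * lap ξ y = ∫ y, lap φ y * ξ y := by
  obtain ⟨hξc, hξd, L, hL⟩ := hξ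
  have hLi := lipschitzWith_fderiv_apply hL
  have h1 : ContDiff ℝ 1 φ := hφ.of_le (by norm_num)
  obtain ⟨D, hD⟩ := h1.lipschitzWith_of_hasCompactSupport hφc one_ne_zero
  have hφi : ∀ i : Fin N, ContDiff ℝ 1 fun y => fderiv ℝ φ y (bv i) := fun i =>
    (hφ.fderiv_right (m := 1) (by norm_num)).clm_apply contDiff_const
  have hφic : ∀ i : Fin N, HasCompactSupport fun y => fderiv ℝ φ y (bv i) := fun i =>
    hφc.fderiv_apply ℝ (bv i)
  have hφii : ∀ i : Fin N, Continuous fun y => fderiv ℝ (fun z => fderiv ℝ φ z (bv i)) y (bv i) :=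
    fun i => (((hφi i).fderiv_right (m := 0) (by norm_num)).clm_apply contDiff_const).continuous
  have hI1 : ∀ i : Fin N, Integrable fun y => φ y * fderiv ℝ (fun z => fderiv ℝ ξ z (bv i)) y (bv i) :=
    fun i => by
      refine ((h1.continuous.integrable_of_hasCompactSupport hφc).norm.mul_const (L : ℝ)).mono
        (h1.continuous.measurable.mul (measurable_fderiv_apply_const ℝ _ _)).aestronglyMeasurable
        (Eventually.of_forall fun y => ?_)
      rw [norm_mul, norm_mul, norm_norm]
      gcongr
      refine (ContinuousLinearMap.le_opNorm _ _).trans ?_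
      rw [norm_bv, mul_one]
      exact (norm_fderiv_le_of_lipschitz ℝ (hLi i)).trans (le_abs_self _)
  have hI2 : ∀ i : Fin N, Integrable fun y => fderiv ℝ (fun z => fderiv ℝ φ z (bv i)) y (bv i) * ξ y :=
    fun i => ((hφii i).mul hξd.continuous).integrable_of_hasCompactSupport hξc.mul_left
  have key : ∀ i : Fin N, ∫ y, φ y * fderiv ℝ (fun z => fderiv ℝ ξ z (bv i)) y (bv i) =
      ∫ y, fderiv ℝ (fun z => fderiv ℝ φ z (bv i)) y (bv i) * ξ y := fun i => by
    have e1 : ∫ y, φ y * fderiv ℝ (fun z => fderiv ℝ ξ z (bv i)) y (bv i) =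
        ∫ y, lineDeriv ℝ (fun z => fderiv ℝ ξ z (bv i)) y (bv i) * φ y := by
      refine integral_congr_ae ?_
      filter_upwards [(hLi i).ae_differentiableAt] with y hy
      rw [hy.lineDeriv_eq_fderiv, mul_comm]
    have e2 : ∀ y, lineDeriv ℝ φ y (-bv i) * fderiv ℝ ξ y (bv i) =
        -(fderiv ℝ φ y (bv i) * fderiv ℝ ξ y (bv i)) := fun y => by
      rw [(h1.differentiable one_ne_zero y).lineDeriv_eq_fderiv, map_neg, neg_mul]
    rw [e1, (hLi i).integral_lineDeriv_mul_eq hD hφc]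
    simp only [e2]
    rw [integral_neg, integral_mul_fderiv_eq_neg_fderiv_mul_of_integrable, neg_neg]
    · exact hI2 i
    · exact ((hφi i).continuous.mul (hLi i).continuous).integrable_of_hasCompactSupport
        (hφic i).mul_right
    · exact ((hφi i).continuous.mul hξd.continuous).integrable_of_hasCompactSupport (hφic i).mul_right
    · exact fun x _ => (hφi i).differentiable one_ne_zero x
    · exact fun x _ => hξd x
  have e3 : ∀ y, φ y * lap ξ y = ∑ i, φ y * fderiv ℝ (fun z => fderiv ℝ ξ z (bv i)) y (bv i) :=
    fun y => Finset.mul_sum _ _ _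
  have e4 : ∀ y, lap φ y * ξ y = ∑ i, fderiv ℝ (fun z => fderiv ℝ φ z (bv i)) y (bv i) * ξ y :=
    fun y => Finset.sum_mul _ _ _
  simp only [e3, e4]
  rw [integral_finsetSum _ fun i _ => hI1 i, integral_finsetSum _ fun i _ => hI2 i]
  exact Finset.sum_congr rfl fun i _ => key i

lemma lipschitzWith_smul_of_bounded {E F : Type*} [PseudoMetricSpace E] [NormedAddCommGroup F]
    [NormedSpace ℝ F] {f : E → ℝ} {G : E → F} {K₁ K₂ : NNReal} {M₁ M₂ : ℝ}
    (hf : LipschitzWith K₁ f) (hG : LipschitzWith K₂ G) (hM₁ : ∀ x, ‖f x‖ ≤ M₁)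
    (hM₂ : ∀ x, ‖G x‖ ≤ M₂) : ∃ K, LipschitzWith K fun x => f x • G x := by
  refine ⟨Real.toNNReal (M₁ * K₂ + K₁ * M₂), LipschitzWith.of_dist_le_mul fun x y => ?_⟩
  have h0 : 0 ≤ M₁ := (norm_nonneg _).trans (hM₁ x)
  have h0' : 0 ≤ M₂ := (norm_nonneg _).trans (hM₂ x)
  rw [Real.coe_toNNReal _ (by positivity), dist_eq_norm,
    show f x • G x - f y • G y = f x • (G x - G y) + (f x - f y) • G y by
      rw [smul_sub, sub_smul]; abel]
  refine (norm_add_le _ _).trans ?_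
  rw [norm_smul, norm_smul, ← dist_eq_norm, ← dist_eq_norm, add_mul]
  have h1 := hf.dist_le_mul x y
  have h2 := hG.dist_le_mul x y
  have h3 := hM₁ x
  have h4 := hM₂ y
  calc ‖f x‖ * dist (G x) (G y) + dist (f x) (f y) * ‖G y‖
      ≤ M₁ * (K₂ * dist x y) + (K₁ * dist x y) * M₂ := by gcongr
    _ = _ := by ring

lemma continuous_of_isC11c {ξ : Euc N → ℝ} (hξ : IsC11c ξ) : Continuous ξ := hξ.2.1.continuous

lemma isC11c_of_contDiff {g : Euc N → ℝ} (hg : ContDiff ℝ 2 g) (hgc : HasCompactSupport g) :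
    IsC11c g :=
  ⟨hgc, hg.differentiable two_ne_zero, (hg.fderiv_right (m := 1) (by norm_num)).lipschitzWith_of_hasCompactSupport
    (hgc.fderiv (𝕜 := ℝ)) one_ne_zero⟩

lemma contDiff_one_of_isC11c {ξ : Euc N → ℝ} (hξ : IsC11c ξ) : ContDiff ℝ 1 ξ := by
  obtain ⟨-, hd, L, hL⟩ := hξ
  exact contDiff_one_iff_fderiv.2 ⟨hd, hL.continuous⟩

lemma isC11c_mul {g ξ : Euc N → ℝ} (hg : IsC11c g) (hξ : IsC11c ξ) : IsC11c fun x => g x * ξ x := by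
  obtain ⟨Mg, hMg⟩ := exists_fderiv_bound hg
  obtain ⟨Mx, hMx⟩ := exists_fderiv_bound hξ
  obtain ⟨Bg, hBg⟩ := hg.1.exists_bound_of_continuous (continuous_of_isC11c hg)
  obtain ⟨Bx, hBx⟩ := hξ.1.exists_bound_of_continuous (continuous_of_isC11c hξ)
  obtain ⟨Kg, hKg⟩ := (contDiff_one_of_isC11c hg).lipschitzWith_of_hasCompactSupport hg.1 one_ne_zero
  obtain ⟨Kx, hKx⟩ := (contDiff_one_of_isC11c hξ).lipschitzWith_of_hasCompactSupport hξ.1 one_ne_zero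
  obtain ⟨hgc, hgd, Lg, hLg⟩ := hg
  obtain ⟨hξc, hξd, Lx, hLx⟩ := hξ
  refine ⟨hξc.mul_left, hgd.mul hξd, ?_⟩
  obtain ⟨K1, h1⟩ := lipschitzWith_smul_of_bounded hKg hLx hBg hMx
  obtain ⟨K2, h2⟩ := lipschitzWith_smul_of_bounded hKx hLg hBx hMg
  refine ⟨K1 + K2, ?_⟩
  have e : fderiv ℝ (fun x => g x * ξ x) = fun x => g x • fderiv ℝ ξ x + ξ x • fderiv ℝ g x := by
    funext x
    exact fderiv_fun_mul (hgd x) (hξd x)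
  rw [e]
  exact h1.add h2

/-- A radial cutoff that equals one on a ball. -/
lemma exists_cutoff (R : ℝ) : ∃ χ : Euc N → ℝ, ContDiff ℝ ∞ χ ∧ HasCompactSupport χ ∧
    ∀ x, ‖x‖ < R → χ x = 1 := by
  have hR : 0 < |R| + 1 := by positivity
  let f : ContDiffBump (0 : Euc N) := ⟨|R| + 1, |R| + 2, hR, by linarith⟩
  refine ⟨f, f.contDiff, f.hasCompactSupport, fun x hx => f.one_of_mem_closedBall ?_⟩
  rw [mem_closedBall_zero_iff]
  exact (hx.le.trans (le_abs_self R)).trans (by linarith)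

lemma isC11c_contDiff_mul {g ξ : Euc N → ℝ} (hg : ContDiff ℝ 2 g) (hξ : IsC11c ξ) :
    IsC11c fun x => g x * ξ x := by
  obtain ⟨R, hR⟩ := hξ.1.isBounded.subset_ball 0
  obtain ⟨χ, hχ, hχc, hχ1⟩ := exists_cutoff (N := N) R
  have e : (fun x => g x * ξ x) = fun x => (g x * χ x) * ξ x := by
    funext x
    by_cases hx : x ∈ tsupport ξ
    · rw [hχ1 x (by simpa using hR hx), mul_one]
    · rw [image_eq_zero_of_notMem_tsupport hx, mul_zero, mul_zero]
  rw [e]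
  exact isC11c_mul (isC11c_of_contDiff (hg.mul (contDiff_two_of_infty hχ)) hχc.mul_left) hξ

/-- Green's identity against a test function vanishing near the origin. -/
lemma integral_mul_lap_of_vanishing {u g : Euc N → ℝ} (hu : ∀ x ≠ 0, ContDiffAt ℝ 2 u x)
    (hg : IsC11c g) {ρ : ℝ} (hρ : 0 < ρ) (hg0 : ∀ x, ‖x‖ < ρ → g x = 0) :
    ∫ x, u x * lap g x = ∫ x, lap u x * g x := by
  obtain ⟨R, hR⟩ := hg.1.isBounded.subset_ball 0
  obtain ⟨χ, hχ, hχc, hχ1⟩ := exists_cutoff (N := N) R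
  let f : ContDiffBump (0 : Euc N) := ⟨ρ / 4, ρ / 2, by positivity, by linarith⟩
  set w : Euc N → ℝ := fun x => u x * (χ x * (1 - f x)) with hw
  have hw0 : ∀ x, ‖x‖ < ρ / 4 → w x = 0 := fun x hx => by
    have : f x = 1 := f.one_of_mem_closedBall (by rw [mem_closedBall_zero_iff]; exact hx.le)
    simp [hw, this]
  have hw1 : ∀ x, ρ / 2 < ‖x‖ → ‖x‖ < R → w x = u x := fun x h1 h2 => by
    have : f x = 0 := f.zero_of_le_dist (by rw [dist_zero_right]; exact h1.le)
    simp [hw, this, hχ1 x h2]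
  have hwC : ContDiff ℝ 2 w := contDiff_iff_contDiffAt.2 fun x => by
    rcases eq_or_ne x 0 with rfl | hx
    · refine (contDiffAt_const (c := (0 : ℝ))).congr_of_eventuallyEq ?_
      filter_upwards [ball_mem_nhds (0 : Euc N) (show 0 < ρ / 4 by positivity)] with y hy
      exact hw0 y (by simpa using hy)
    · exact (hu x hx).mul ((contDiff_two_of_infty hχ).contDiffAt.mul (contDiffAt_const.sub f.contDiff.contDiffAt))
  have hwc : HasCompactSupport w := (hχc.mul_right).mul_left
  have hts : ∀ x ∈ tsupport g, ρ / 2 < ‖x‖ ∧ ‖x‖ < R := fun x hx => by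
    refine ⟨?_, by simpa using hR hx⟩
    by_contra! h
    refine notMem_tsupport_iff_eventuallyEq.2 ?_ hx
    filter_upwards [continuous_norm.continuousAt.eventually (gt_mem_nhds (show ‖x‖ < ρ by linarith))]
      with y hy using hg0 y hy
  have key := integral_mul_lap_of_isC11c hwC hwc hg
  have e1 : ∀ x, w x * lap g x = u x * lap g x := fun x => by
    by_cases hx : x ∈ tsupport g
    · rw [hw1 x (hts x hx).1 (hts x hx).2]
    · have : lap g x = 0 := by
        rw [lap_congr (notMem_tsupport_iff_eventuallyEq.1 hx)]
        simp [lap]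
      rw [this, mul_zero, mul_zero]
  have e2 : ∀ x, lap w x * g x = lap u x * g x := fun x => by
    by_cases hx : x ∈ tsupport g
    · have : w =ᶠ[𝓝 x] u := by
        filter_upwards [continuous_norm.continuousAt.eventually (gt_mem_nhds (hts x hx).2),
          continuous_norm.continuousAt.eventually (lt_mem_nhds (hts x hx).1)] with y h1 h2
        exact hw1 y h2 h1
      rw [lap_congr this]
    · rw [image_eq_zero_of_notMem_tsupport hx, mul_zero, mul_zero]
  simpa only [e1, e2] using key

end

section

variable {N : ℕ}

lemma clm_apply_eq_sum (T : Euc N →L[ℝ] ℝ) (x : Euc N) : T x = ∑ i, x i * T (bv i) := by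
  conv_lhs => rw [← (EuclideanSpace.basisFun (Fin N) ℝ).sum_repr x]
  simp [map_sum]

lemma lap_mul_of_radial {g ξ : Euc N → ℝ} {x : Euc N} {a : ℝ} (hg : ContDiffAt ℝ 2 g x)
    (hξ : Differentiable ℝ ξ) (hξ' : DifferentiableAt ℝ (fderiv ℝ ξ) x)
    (ha : fderiv ℝ g x = a • innerSL ℝ x) :
    lap (fun y => g y * ξ y) x = g x * lap ξ x + 2 * a * fderiv ℝ ξ x x + lap g x * ξ x := by
  have hgd : ∀ᶠ y in 𝓝 x, DifferentiableAt ℝ g y := by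
    filter_upwards [hg.eventually (by simp)] with y hy using hy.differentiableAt two_ne_zero
  have hg' : DifferentiableAt ℝ (fderiv ℝ g) x :=
    (hg.fderiv_right (m := 1) (by norm_num)).differentiableAt one_ne_zero
  have key : ∀ i : Fin N, fderiv ℝ (fun y => fderiv ℝ (fun y => g y * ξ y) y (bv i)) x (bv i) =
      g x * fderiv ℝ (fun y => fderiv ℝ ξ y (bv i)) x (bv i) +
        2 * a * (x i * fderiv ℝ ξ x (bv i)) +
        fderiv ℝ (fun y => fderiv ℝ g y (bv i)) x (bv i) * ξ x := fun i => by
    have e : (fun y => fderiv ℝ (fun y => g y * ξ y) y (bv i)) =ᶠ[𝓝 x]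
        fun y => g y * fderiv ℝ ξ y (bv i) + ξ y * fderiv ℝ g y (bv i) := by
      filter_upwards [hgd] with y hy
      rw [fderiv_fun_mul hy (hξ y)]
      simp
    have d1 : DifferentiableAt ℝ (fun y => fderiv ℝ ξ y (bv i)) x :=
      hξ'.clm_apply (differentiableAt_const _)
    have d2 : DifferentiableAt ℝ (fun y => fderiv ℝ g y (bv i)) x :=
      hg'.clm_apply (differentiableAt_const _)
    have e2 : fderiv ℝ g x (bv i) = a * x i := by
      rw [ha]; simp [inner_bv]
    rw [e.fderiv_eq, fderiv_fun_add (hgd.self_of_nhds.fun_mul d1) ((hξ x).fun_mul d2),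
      fderiv_fun_mul hgd.self_of_nhds d1, fderiv_fun_mul (hξ x) d2]
    simp only [add_apply, smul_apply, smul_eq_mul, e2]
    ring
  have e1 : lap (fun y => g y * ξ y) x = ∑ i : Fin N, (g x * fderiv ℝ (fun y => fderiv ℝ ξ y (bv i)) x (bv i) +
        2 * a * (x i * fderiv ℝ ξ x (bv i)) +
        fderiv ℝ (fun y => fderiv ℝ g y (bv i)) x (bv i) * ξ x) := Finset.sum_congr rfl fun i _ => key i
  rw [e1, Finset.sum_add_distrib, Finset.sum_add_distrib, ← Finset.mul_sum, ← Finset.mul_sum,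
    ← Finset.sum_mul, ← clm_apply_eq_sum]
  rfl

/-! ### Logarithmic cutoffs -/

/-- The profile of the logarithmic cutoff. -/
def prof (σ : ℝ) : ℝ := Real.smoothTransition (2 - σ)

lemma contDiff_prof : ContDiff ℝ ∞ prof :=
  (Real.smoothTransition.contDiff (n := ⊤)).comp (contDiff_const.sub contDiff_id)

lemma prof_of_le {σ : ℝ} (h : σ ≤ 1) : prof σ = 1 :=
  Real.smoothTransition.one_of_one_le (by linarith)

lemma prof_of_ge {σ : ℝ} (h : 2 ≤ σ) : prof σ = 0 :=
  Real.smoothTransition.zero_of_nonpos (by linarith)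

lemma prof_nonneg (σ : ℝ) : 0 ≤ prof σ := Real.smoothTransition.nonneg _

lemma prof_le_one (σ : ℝ) : prof σ ≤ 1 := Real.smoothTransition.le_one _

lemma contDiff_deriv_prof : ContDiff ℝ ∞ (deriv prof) :=
  (contDiff_infty_iff_deriv.1 contDiff_prof).2

lemma contDiff_deriv2_prof : ContDiff ℝ ∞ (deriv (deriv prof)) :=
  (contDiff_infty_iff_deriv.1 contDiff_deriv_prof).2

lemma hasDerivAt_prof (σ : ℝ) : HasDerivAt prof (deriv prof σ) σ :=
  ((contDiff_prof).differentiable (by simp) σ).hasDerivAt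

lemma hasDerivAt_deriv_prof (σ : ℝ) : HasDerivAt (deriv prof) (deriv (deriv prof) σ) σ :=
  (contDiff_deriv_prof.differentiable (by simp) σ).hasDerivAt

lemma deriv_prof_of_notMem {σ : ℝ} (h : σ ∉ Set.Icc (1 : ℝ) 2) : deriv prof σ = 0 := by
  rw [Set.mem_Icc, not_and_or, not_le, not_le] at h
  rcases h with h | h
  · have : prof =ᶠ[𝓝 σ] fun _ => 1 := by
      filter_upwards [gt_mem_nhds h] with y hy using prof_of_le hy.le
    rw [this.deriv_eq, deriv_const]
  · have : prof =ᶠ[𝓝 σ] fun _ => 0 := by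
      filter_upwards [lt_mem_nhds h] with y hy using prof_of_ge hy.le
    rw [this.deriv_eq, deriv_const]

lemma tsupport_deriv_prof : tsupport (deriv prof) ⊆ Set.Icc 1 2 :=
  closure_minimal (fun _ h => by_contra fun h' => h (deriv_prof_of_notMem h')) isClosed_Icc

lemma hasCompactSupport_deriv_prof : HasCompactSupport (deriv prof) :=
  isCompact_Icc.of_isClosed_subset (isClosed_tsupport _) tsupport_deriv_prof

lemma tsupport_deriv2_prof : tsupport (deriv (deriv prof)) ⊆ Set.Icc 1 2 :=
  (tsupport_deriv_subset (f := deriv prof)).trans tsupport_deriv_prof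

lemma hasCompactSupport_deriv2_prof : HasCompactSupport (deriv (deriv prof)) :=
  isCompact_Icc.of_isClosed_subset (isClosed_tsupport _) tsupport_deriv2_prof

lemma deriv2_prof_of_notMem {σ : ℝ} (h : σ ∉ Set.Icc (1 : ℝ) 2) : deriv (deriv prof) σ = 0 :=
  image_eq_zero_of_notMem_tsupport fun h' => h (tsupport_deriv2_prof h')

lemma integral_mul_deriv2_prof : ∫ σ, σ * deriv (deriv prof) σ = 1 := by
  have hs : Function.support (fun σ => σ * deriv (deriv prof) σ) ⊆ Set.Ioc (1 / 2) 3 := fun σ h => by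
    by_contra h'
    refine h ?_
    simp only
    rw [deriv2_prof_of_notMem fun h2 => h' ⟨by linarith [h2.1], by linarith [h2.2]⟩, mul_zero]
  rw [← setIntegral_eq_integral_of_forall_compl_eq_zero (s := Set.Ioc (1 / 2) 3)
    fun σ hσ => by_contra fun h => hσ (hs h), ← intervalIntegral.integral_of_le (by norm_num)]
  have hd : ∀ σ ∈ Set.uIcc (1 / 2 : ℝ) 3, HasDerivAt (fun σ => σ * deriv prof σ - prof σ)
      (σ * deriv (deriv prof) σ) σ := fun σ _ => by
    refine (((hasDerivAt_id σ).mul (hasDerivAt_deriv_prof σ)).sub (hasDerivAt_prof σ)).congr_deriv ?_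
    simp
  rw [intervalIntegral.integral_eq_sub_of_hasDerivAt hd
    (continuous_id.mul contDiff_deriv2_prof.continuous |>.intervalIntegrable _ _),
    deriv_prof_of_notMem (by norm_num), deriv_prof_of_notMem (by norm_num), prof_of_ge (by norm_num),
    prof_of_le (by norm_num)]
  norm_num

end

section

variable {N : ℕ}

/-- The singular weight multiplied by a logarithmic cutoff vanishing near the origin. -/
def lcut (N : ℕ) (ε : ℝ) (x : Euc N) : ℝ := gam x * prof (-2 * ε * Real.log ‖x‖)

lemma lcut_eq_zero {ε : ℝ} (hε : 0 < ε) (hN : 3 ≤ N) {x : Euc N} (hx : ‖x‖ < Real.exp (-1 / ε)) :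
    lcut N ε x = 0 := by
  unfold lcut
  rcases eq_or_ne x 0 with rfl | h0
  · rw [gam_zero hN, zero_mul]
  · rw [prof_of_ge, mul_zero]
    have := (Real.log_lt_iff_lt_exp (norm_pos_iff.2 h0)).2 hx
    rw [lt_div_iff₀ hε] at this
    nlinarith

lemma contDiff_two_prof : ContDiff ℝ 2 prof := by exact_mod_cast contDiff_infty.1 contDiff_prof 2

lemma contDiff_lcut {ε : ℝ} (hε : 0 < ε) (hN : 3 ≤ N) : ContDiff ℝ 2 (lcut N ε) :=
  contDiff_iff_contDiffAt.2 fun x => by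
    rcases eq_or_ne x 0 with rfl | hx
    · refine (contDiffAt_const (c := (0 : ℝ))).congr_of_eventuallyEq ?_
      filter_upwards [ball_mem_nhds (0 : Euc N) (Real.exp_pos (-1 / ε))] with y hy
      exact lcut_eq_zero hε hN (by simpa using hy)
    · exact (contDiffAt_gam hx).mul ((contDiff_two_prof.contDiffAt).comp x
        (contDiffAt_const.mul (contDiffAt_log_norm hx)))

lemma lcut_eq (ε : ℝ) : lcut N ε = fun x : Euc N =>
    (fun t : ℝ => t ^ (-((N : ℝ) - 2) / 4) * prof (-ε * Real.log t)) (‖x‖ ^ 2) := by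
  funext x
  simp only [lcut, gam]
  rw [rpow_norm_eq, Real.log_pow]
  congr 2
  · ring
  · push_cast; ring

lemma hasDerivAt_rpow_mul_comp_log (s ε : ℝ) {P P1 : ℝ → ℝ} (hP : ∀ σ, HasDerivAt P (P1 σ) σ) {t : ℝ}
    (ht : 0 < t) : HasDerivAt (fun t : ℝ => t ^ s * P (-ε * Real.log t))
      (s * (t ^ (s - 1) * P (-ε * Real.log t)) - ε * (t ^ (s - 1) * P1 (-ε * Real.log t))) t := by
  refine ((Real.hasDerivAt_rpow_const (Or.inl ht.ne')).mul ((hP _).comp t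
    ((Real.hasDerivAt_log ht.ne').const_mul (-ε)))).congr_deriv ?_
  rw [show t ^ s = t ^ (s - 1) * t by rw [← Real.rpow_add_one ht.ne']; ring_nf]
  simp only [Function.comp]
  field_simp
  ring

lemma fderiv_lcut (ε : ℝ) {x : Euc N} (hx : x ≠ 0) : fderiv ℝ (lcut N ε) x =
    (2 * (gam x / ‖x‖ ^ 2 * (-((N : ℝ) - 2) / 4 * prof (-2 * ε * Real.log ‖x‖) -
      ε * deriv prof (-2 * ε * Real.log ‖x‖)))) • innerSL ℝ x := by
  have ht : 0 < ‖x‖ ^ 2 := by have := norm_pos_iff.2 hx; positivity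
  rw [lcut_eq, (hasFDerivAt_radial
    (hasDerivAt_rpow_mul_comp_log (-((N : ℝ) - 2) / 4) ε hasDerivAt_prof ht)).fderiv]
  have e : (‖x‖ ^ 2) ^ (-((N : ℝ) - 2) / 4 - 1) = gam x / ‖x‖ ^ 2 := by
    rw [Real.rpow_sub_one ht.ne', gam, rpow_norm_eq]
    ring_nf
  rw [e, Real.log_pow]
  congr 1
  push_cast
  ring_nf

lemma lap_lcut (ε : ℝ) {x : Euc N} (hx : x ≠ 0) : lap (lcut N ε) x =
    gam x / ‖x‖ ^ 2 * (-mu0 N * prof (-2 * ε * Real.log ‖x‖) +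
      4 * ε ^ 2 * deriv (deriv prof) (-2 * ε * Real.log ‖x‖)) := by
  have ht : 0 < ‖x‖ ^ 2 := by have := norm_pos_iff.2 hx; positivity
  set s := -((N : ℝ) - 2) / 4 with hs
  have h1 : ∀ᶠ t in 𝓝 (‖x‖ ^ 2), HasDerivAt (fun t : ℝ => t ^ s * prof (-ε * Real.log t))
      (s * (t ^ (s - 1) * prof (-ε * Real.log t)) - ε * (t ^ (s - 1) * deriv prof (-ε * Real.log t))) t := by
    filter_upwards [lt_mem_nhds ht] with t ht using hasDerivAt_rpow_mul_comp_log s ε hasDerivAt_prof ht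
  have h2 := ((hasDerivAt_rpow_mul_comp_log (s - 1) ε hasDerivAt_prof ht).const_mul s).sub
    ((hasDerivAt_rpow_mul_comp_log (s - 1) ε hasDerivAt_deriv_prof ht).const_mul ε)
  rw [lcut_eq, lap_radial h1 h2]
  have e : (‖x‖ ^ 2) ^ (s - 1) = gam x / ‖x‖ ^ 2 := by
    rw [Real.rpow_sub_one ht.ne', gam, rpow_norm_eq, hs]
    ring_nf
  have e' : (‖x‖ ^ 2) ^ (s - 1 - 1) = gam x / ‖x‖ ^ 2 / ‖x‖ ^ 2 := by
    rw [Real.rpow_sub_one ht.ne', e]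
  rw [e, e', Real.log_pow, show -ε * (((2 : ℕ) : ℝ) * Real.log ‖x‖) = -2 * ε * Real.log ‖x‖ by push_cast; ring,
    hs, mu0]
  field_simp
  ring

lemma mu0_tauPlus : tauPlus N (mu0 N) = -((N : ℝ) - 2) / 2 := by simp [tauPlus]

lemma cMu_mu0 : cMu N (mu0 N) = sphereArea N := by simp [cMu]

/-- Conjugation of the Schrödinger operator by the cut-off weight. -/
lemma lap_lcut_mul {ε : ℝ} (hε : 0 < ε) (hN : 3 ≤ N) (V : Euc N → ℝ) {ξ : Euc N → ℝ}
    (hξ : Differentiable ℝ ξ) {x : Euc N} (hx : x ≠ 0) (hξ' : DifferentiableAt ℝ (fderiv ℝ ξ) x) :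
    lap (fun y => lcut N ε y * ξ y) x + mu0 N * V x * (lcut N ε x * ξ x) =
      -(gam x * prof (-2 * ε * Real.log ‖x‖) * LstarMuV N (mu0 N) V ξ x) -
      4 * ε * (gam x / ‖x‖ ^ 2 * deriv prof (-2 * ε * Real.log ‖x‖) * fderiv ℝ ξ x x) +
      4 * ε ^ 2 * (gam x / ‖x‖ ^ 2 * deriv (deriv prof) (-2 * ε * Real.log ‖x‖) * ξ x) := by
  have ht : 0 < ‖x‖ := norm_pos_iff.2 hx
  rw [lap_mul_of_radial (contDiff_lcut hε hN).contDiffAt hξ hξ' (fderiv_lcut ε hx), lap_lcut ε hx,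
    LstarMuV, LstarMu, mu0_tauPlus, lcut, show ‖x‖ ^ (-2 : ℝ) = (‖x‖ ^ 2)⁻¹ by
      rw [Real.rpow_neg ht.le]; norm_num]
  field_simp
  ring

/-! ### The mass of logarithmic annuli -/

lemma radial_log_aux (hN : 3 ≤ N) {ε : ℝ} (hε : 0 < ε) {q : ℝ → ℝ} (hq : Continuous q)
    (hqc : HasCompactSupport q) :
    Integrable (fun x : Euc N => ‖x‖ ^ (-(N : ℝ)) * (2 * ε * q (-2 * ε * Real.log ‖x‖))) ∧
    ∫ x : Euc N, ‖x‖ ^ (-(N : ℝ)) * (2 * ε * q (-2 * ε * Real.log ‖x‖)) =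
      sphereArea N * ∫ σ, q σ := by
  have : Nonempty (Fin N) := ⟨⟨0, by omega⟩⟩
  have : Nontrivial (Euc N) := nontrivial_euc hN
  set f : ℝ → ℝ := fun r => r ^ (-(N : ℝ)) * (2 * ε * q (-2 * ε * Real.log r)) with hf
  have him : Real.exp '' Set.univ = Set.Ioi 0 := by rw [Set.image_univ, Real.range_exp]
  have hexp : ∀ s ∈ (Set.univ : Set ℝ), HasDerivWithinAt Real.exp (Real.exp s) Set.univ s :=
    fun s _ => (Real.hasDerivAt_exp s).hasDerivWithinAt
  have hinj : Set.InjOn Real.exp Set.univ := Real.exp_injective.injOn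
  have e : ∀ s : ℝ, |Real.exp s| • (Real.exp s ^ (N - 1) • f (Real.exp s)) = 2 * ε * q (-2 * ε * s) := fun s => by
    have h1 : Real.exp s * Real.exp s ^ (N - 1) * Real.exp s ^ (-(N : ℝ)) = 1 := by
      rw [← pow_succ', show N - 1 + 1 = N by omega, Real.rpow_neg (Real.exp_pos _).le, Real.rpow_natCast,
        mul_inv_cancel₀ (by positivity)]
    simp only [hf, smul_eq_mul, abs_of_pos (Real.exp_pos s), Real.log_exp]
    linear_combination (2 * ε * q (-2 * ε * s)) * h1
  have hd : Module.finrank ℝ (Euc N) = N := by simp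
  have hqi := hq.integrable_of_hasCompactSupport hqc (μ := volume)
  have hne : -2 * ε ≠ 0 := by nlinarith
  constructor
  · refine (integrable_fun_norm_addHaar (E := Euc N) volume (f := f)).2 ?_
    rw [hd, ← him, integrableOn_image_iff_integrableOn_abs_deriv_smul MeasurableSet.univ hexp hinj]
    simp only [e, integrableOn_univ]
    exact (hqi.comp_mul_left' hne).const_mul _
  · rw [integral_fun_norm_addHaar (E := Euc N) volume f, hd, ← him,
      integral_image_eq_integral_abs_deriv_smul MeasurableSet.univ hexp hinj]
    simp only [e, Measure.restrict_univ]
    rw [integral_const_mul, Measure.integral_comp_mul_left q (-2 * ε), sphereArea, measureReal_def]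
    have : |(-2 * ε)⁻¹| = (2 * ε)⁻¹ := by
      rw [abs_inv, show -2 * ε = -(2 * ε) by ring, abs_neg, abs_of_pos (by positivity)]
    rw [this]
    simp only [smul_eq_mul, nsmul_eq_mul]
    field_simp

/-- Logarithmic annuli concentrate at the origin. -/
lemma tendsto_integral_mul_log (hN : 3 ≤ N) {q : ℝ → ℝ} (hq : Continuous q)
    (hqs : ∀ σ, σ ∉ Set.Icc (1 : ℝ) 2 → q σ = 0) {G : Euc N → ℝ} (hG : Measurable G) {L : ℝ}
    (hGL : Tendsto G (𝓝[≠] 0) (𝓝 L)) {ε : ℕ → ℝ} (hε : ∀ n, 0 < ε n) (hε0 : Tendsto ε atTop (𝓝 0)) :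
    Tendsto (fun n => ∫ x, G x * (‖x‖ ^ (-(N : ℝ)) * (2 * ε n * q (-2 * ε n * Real.log ‖x‖)))) atTop
      (𝓝 (L * (sphereArea N * ∫ σ, q σ))) := by
  have hqc : HasCompactSupport q := HasCompactSupport.of_support_subset_isCompact isCompact_Icc
    fun σ h => by_contra fun h' => h (hqs σ h')
  set m : ℕ → Euc N → ℝ := fun n x => ‖x‖ ^ (-(N : ℝ)) * (2 * ε n * q (-2 * ε n * Real.log ‖x‖)) with hm
  have hmi : ∀ n, Integrable (m n) := fun n => (radial_log_aux hN (hε n) hq hqc).1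
  have hmI : ∀ n, ∫ x, m n x = sphereArea N * ∫ σ, q σ := fun n => (radial_log_aux hN (hε n) hq hqc).2
  have hma : ∀ n x, |m n x| = ‖x‖ ^ (-(N : ℝ)) * (2 * ε n * |q (-2 * ε n * Real.log ‖x‖)|) := fun n x => by
    simp only [hm, abs_mul, abs_of_pos (hε n), abs_of_nonneg (Real.rpow_nonneg (norm_nonneg x) _),
      abs_of_pos (show (0 : ℝ) < 2 by norm_num)]
  have hmA : ∀ n, ∫ x, |m n x| = sphereArea N * ∫ σ, |q σ| := fun n => by
    simp only [hma]
    exact (radial_log_aux hN (hε n) hq.abs (hqc.comp_left (g := fun t : ℝ => |t|) abs_zero)).2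
  have hS := sphereArea_pos hN
  set K := sphereArea N * ∫ σ, |q σ|
  have hK : 0 ≤ K := mul_nonneg hS.le (integral_nonneg fun _ => abs_nonneg _)
  rw [Metric.tendsto_atTop]
  intro η hη
  have hη' : 0 < η / (K + 1) := by positivity
  obtain ⟨d, hd, hGd⟩ := Metric.mem_nhdsWithin_iff.1 (hGL (ball_mem_nhds L hη'))
  have hlog : ∀ᶠ n in atTop, Real.exp (-1 / (2 * ε n)) < d := by
    have h1 : Tendsto (fun n => (2 * ε n)) atTop (𝓝[>] 0) := tendsto_nhdsWithin_iff.2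
      ⟨by simpa using hε0.const_mul 2, Eventually.of_forall fun n => by have := hε n; simpa using this⟩
    have h2 : Tendsto (fun n => -1 / (2 * ε n)) atTop atBot := by
      have := tendsto_neg_atTop_atBot.comp (tendsto_inv_nhdsGT_zero.comp h1)
      refine this.congr fun n => ?_
      simp [neg_div]
    exact (Real.tendsto_exp_atBot.comp h2).eventually (gt_mem_nhds hd)
  obtain ⟨n₀, hn₀⟩ := eventually_atTop.1 hlog
  refine ⟨n₀, fun n hn => ?_⟩
  have hsm : ∀ x, |(G x - L) * m n x| ≤ η / (K + 1) * |m n x| := fun x => by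
    rw [abs_mul]
    rcases eq_or_ne x 0 with rfl | hx
    · have : m n 0 = 0 := by
        simp only [hm]
        rw [hqs _ (by simp), mul_zero, mul_zero]
      simp [this]
    by_cases hσ : -2 * ε n * Real.log ‖x‖ ∈ Set.Icc (1 : ℝ) 2
    · refine mul_le_mul_of_nonneg_right ?_ (abs_nonneg _)
      have hp := hε n
      have : Real.log ‖x‖ ≤ -1 / (2 * ε n) := by
        rw [le_div_iff₀ (by positivity)]; linarith [hσ.1]
      have hxd : ‖x‖ < d := ((Real.log_le_iff_le_exp (norm_pos_iff.2 hx)).1 this).trans_lt (hn₀ n hn)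
      have := hGd ⟨by simpa using hxd, hx⟩
      exact (show |G x - L| < _ from this).le
    · have : m n x = 0 := by
        simp only [hm]
        rw [hqs _ hσ, mul_zero, mul_zero]
      simp [this]
  have hi : Integrable fun x => (G x - L) * m n x :=
    ((hmi n).norm.const_mul (η / (K + 1))).mono'
      ((hG.sub_const L).aestronglyMeasurable.mul (hmi n).1) (Eventually.of_forall hsm)
  have e : ∫ x, G x * m n x = ∫ x, (G x - L) * m n x + L * m n x :=
    integral_congr_ae (Eventually.of_forall fun x => by simp only; ring)
  rw [show (∫ x, G x * (‖x‖ ^ (-(N : ℝ)) * (2 * ε n * q (-2 * ε n * Real.log ‖x‖)))) = ∫ x, G x * m n x from rfl,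
    e, integral_add hi ((hmi n).const_mul L), integral_const_mul, hmI, Real.dist_eq, add_sub_cancel_right]
  calc |∫ x, (G x - L) * m n x| ≤ ∫ x, |(G x - L) * m n x| := abs_integral_le_integral_abs
    _ ≤ ∫ x, η / (K + 1) * |m n x| := integral_mono hi.abs ((hmi n).abs.const_mul _) hsm
    _ = η / (K + 1) * K := by rw [integral_const_mul, hmA]
    _ < η := by rw [div_mul_eq_mul_div, div_lt_iff₀ (by positivity)]; nlinarith

end

section

variable {N : ℕ} {γ c : ℝ} {V : Euc N → ℝ}

lemma measurable_gam : Measurable (gam : Euc N → ℝ) := measurable_norm.pow_const _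

lemma measurable_fderiv_self {ξ : Euc N → ℝ} (hξ : IsC11c ξ) : Measurable fun x => fderiv ℝ ξ x x :=
  ((contDiff_one_of_isC11c hξ).continuous_fderiv one_ne_zero |>.clm_apply continuous_id).measurable

lemma AdmV.measurable_LstarMuV (A : AdmV N γ c V) {ξ : Euc N → ℝ} (hξ : IsC11c ξ) :
    Measurable (LstarMuV N (mu0 N) V ξ) := by
  have h1 := measurable_lap ξ
  have h2 := measurable_fderiv_self hξ
  have h3 := A.measurable
  have h4 := (continuous_of_isC11c hξ).measurable
  unfold LstarMuV LstarMu
  exact ((h1.neg.sub ((measurable_const.div (measurable_norm.pow_const 2)).mul h2))).sub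
    (((h3.sub (measurable_norm.pow_const _)).const_mul _).mul h4)

lemma LstarMuV_eq_zero {ξ : Euc N → ℝ} {x : Euc N} (hx : x ∉ tsupport ξ) :
    LstarMuV N (mu0 N) V ξ x = 0 := by
  have h := notMem_tsupport_iff_eventuallyEq.1 hx
  have h1 : lap ξ x = 0 := by rw [lap_congr h]; simp [lap]
  have h2 : fderiv ℝ ξ x = 0 := by rw [h.fderiv_eq]; simp
  rw [LstarMuV, LstarMu, h1, h2, image_eq_zero_of_notMem_tsupport hx]
  simp

lemma abs_fderiv_self_le {ξ : Euc N → ℝ} {M : ℝ} (hM : ∀ x, ‖fderiv ℝ ξ x‖ ≤ M) (x : Euc N) :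
    |fderiv ℝ ξ x x| ≤ M * ‖x‖ :=
  ((fderiv ℝ ξ x).le_opNorm x).trans (mul_le_mul_of_nonneg_right (hM x) (norm_nonneg x))

lemma AdmV.exists_LstarMuV_bound (A : AdmV N γ c V) {ξ : Euc N → ℝ} (hξ : IsC11c ξ) :
    ∃ R K : ℝ, 0 < R ∧ 0 ≤ K ∧ (∀ x, R ≤ ‖x‖ → x ∉ tsupport ξ) ∧
      ∀ x, x ≠ 0 → |LstarMuV N (mu0 N) V ξ x| ≤ K * ‖x‖⁻¹ := by
  obtain ⟨M, hM⟩ := exists_fderiv_bound hξ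
  obtain ⟨B, hB⟩ := (continuous_of_isC11c hξ).bounded_above_of_compact_support hξ.1
  obtain ⟨R, hR, hR'⟩ := hξ.1.isBounded.subset_ball_lt 0 0
  obtain ⟨L, hL⟩ := hξ.2.2
  have hM0 : 0 ≤ M := (norm_nonneg _).trans (hM 0)
  have hB0 : 0 ≤ B := (norm_nonneg _).trans (hB 0)
  have hm := mu0_pos A.hN
  have hc := A.hc
  have hN : (3 : ℝ) ≤ N := by exact_mod_cast A.hN
  refine ⟨R, N * L * R + ((N : ℝ) - 2) * M + mu0 N * c * B * R, hR, ?_, fun x hx hx' => ?_, fun x hx => ?_⟩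
  · have : 0 ≤ (N : ℝ) - 2 := by linarith
    positivity
  · have := hR' hx'
    rw [mem_ball_zero_iff] at this
    linarith
  have hp : 0 < ‖x‖ := norm_pos_iff.2 hx
  by_cases hxs : x ∈ tsupport ξ
  swap
  · rw [LstarMuV_eq_zero hxs, abs_zero]
    have : 0 ≤ (N : ℝ) - 2 := by linarith
    positivity
  have hxR : ‖x‖ < R := by simpa using hR' hxs
  have hRx : 1 ≤ R * ‖x‖⁻¹ := by rw [← div_eq_mul_inv, one_le_div hp]; exact hxR.le
  have h1 : |lap ξ x| ≤ N * L * (R * ‖x‖⁻¹) := (abs_lap_le hL x).trans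
    (le_mul_of_one_le_right (by positivity) hRx)
  have h2 : |2 * tauPlus N (mu0 N) / ‖x‖ ^ 2 * fderiv ℝ ξ x x| ≤ ((N : ℝ) - 2) * M * ‖x‖⁻¹ := by
    rw [mu0_tauPlus, abs_mul, show 2 * (-((N : ℝ) - 2) / 2) / ‖x‖ ^ 2 = -(((N : ℝ) - 2) / ‖x‖ ^ 2) by ring,
      abs_neg, abs_of_nonneg (div_nonneg (by linarith) (by positivity))]
    calc ((N : ℝ) - 2) / ‖x‖ ^ 2 * |fderiv ℝ ξ x x| ≤ ((N : ℝ) - 2) / ‖x‖ ^ 2 * (M * ‖x‖) :=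
          mul_le_mul_of_nonneg_left (abs_fderiv_self_le hM x) (div_nonneg (by linarith) (by positivity))
      _ = ((N : ℝ) - 2) * M * ‖x‖⁻¹ := by field_simp
  have h3 : |mu0 N * (V x - ‖x‖ ^ (-2 : ℝ)) * ξ x| ≤ mu0 N * c * B * (R * ‖x‖⁻¹) := by
    rw [abs_mul, abs_mul, abs_of_pos hm]
    have e1 : |V x - ‖x‖ ^ (-2 : ℝ)| ≤ c := abs_le.2 ⟨by linarith [A.lo x hx], by linarith [A.hi x hx]⟩
    calc mu0 N * |V x - ‖x‖ ^ (-2 : ℝ)| * |ξ x| ≤ mu0 N * c * B := by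
          have := hB x
          rw [Real.norm_eq_abs] at this
          gcongr
      _ ≤ _ := le_mul_of_one_le_right (by positivity) hRx
  rw [LstarMuV, LstarMu]
  have e := abs_add_three (-lap ξ x) (-(2 * tauPlus N (mu0 N) / ‖x‖ ^ 2 * fderiv ℝ ξ x x))
    (-(mu0 N * (V x - ‖x‖ ^ (-2 : ℝ)) * ξ x))
  rw [abs_neg, abs_neg, abs_neg] at e
  rw [sub_eq_add_neg (-lap ξ x - _), sub_eq_add_neg (-lap ξ x)]
  refine e.trans ((add_le_add_three h1 h2 h3).trans (le_of_eq ?_))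
  ring

lemma integrable_indicator_rpow (hN : 3 ≤ N) {p : ℝ} (hp : -(N : ℝ) < p) (C R : ℝ) :
    Integrable ((ball (0 : Euc N) R).indicator fun x => C * ‖x‖ ^ p) := by
  refine (IntegrableOn.integrable_indicator ?_ measurableSet_ball)
  exact (((locallyIntegrable_rpow hN hp).integrableOn_isCompact (isCompact_closedBall 0 R)).mono_set
    ball_subset_closedBall).const_mul C

/-- A solution with the logarithmic singularity satisfies the weighted distributional identity. -/
lemma AdmV.integral_mul_LstarMuV (A : AdmV N γ c V) {u : Euc N → ℝ}
    (hu : ∀ x ≠ 0, ContDiffAt ℝ 2 u x) (hlap : ∀ x ≠ 0, lap u x = -(mu0 N * V x * u x))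
    (hu0 : ∀ x ≠ 0, 0 ≤ u x) {p C : ℝ} (hp : 1 - (N : ℝ) < p) (hC : 0 ≤ C)
    (hb : ∀ x ≠ 0, u x * gam x ≤ C * ‖x‖ ^ p)
    (hlim : Tendsto (fun x => u x / (gam x * -Real.log ‖x‖)) (𝓝[≠] 0) (𝓝 1))
    {ξ : Euc N → ℝ} (hξ : IsC11c ξ) :
    ∫ x, u x * LstarMuV N (mu0 N) V ξ x * gam x = sphereArea N * ξ 0 := by
  have hN := A.hN
  have hm := mu0_pos hN
  have : Nontrivial (Euc N) := nontrivial_euc hN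
  have hum : Measurable u := measurable_of_continuousOn_ne fun x hx =>
    (hu x hx).continuousAt.continuousWithinAt
  have hgm : Measurable (gam : Euc N → ℝ) := measurable_gam
  have hξm := (continuous_of_isC11c hξ).measurable
  obtain ⟨M, hM⟩ := exists_fderiv_bound hξ
  have hM0 : 0 ≤ M := (norm_nonneg _).trans (hM 0)
  obtain ⟨R, K, hR, hK, hRs, hLb⟩ := A.exists_LstarMuV_bound hξ
  have hbound : ∀ {Q : Euc N → ℝ} {B : ℝ}, 0 ≤ B → (∀ x, x ≠ 0 → |Q x| ≤ B * ‖x‖⁻¹) →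
      (∀ x ∉ tsupport ξ, Q x = 0) → ∀ x, x ≠ 0 → |u x * Q x * gam x| ≤
        (ball (0 : Euc N) R).indicator (fun x => C * B * ‖x‖ ^ (p - 1)) x := by
    intro Q B hB hQ hQ0 x hx
    by_cases hxs : x ∈ tsupport ξ
    · rw [Set.indicator_of_mem (by
        rw [mem_ball_zero_iff]; by_contra! h; exact hRs x h hxs)]
      have hpx := norm_pos_iff.2 hx
      rw [mul_right_comm, abs_mul, abs_of_nonneg (mul_nonneg (hu0 x hx) (gam_nonneg x)),
        Real.rpow_sub_one hpx.ne']
      calc u x * gam x * |Q x| ≤ C * ‖x‖ ^ p * (B * ‖x‖⁻¹) :=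
            mul_le_mul (hb x hx) (hQ x hx) (abs_nonneg _) (by positivity)
        _ = _ := by rw [div_eq_mul_inv]; ring
    · rw [hQ0 x hxs]
      simp only [mul_zero, zero_mul, abs_zero]
      exact Set.indicator_nonneg (fun y _ => by positivity) x
  have hpI : ∀ C, Integrable ((ball (0 : Euc N) R).indicator fun x => C * ‖x‖ ^ (p - 1)) := fun C =>
    integrable_indicator_rpow hN (by linarith) C R
  obtain ⟨D1, hD1⟩ := contDiff_deriv_prof.continuous.bounded_above_of_compact_support
    hasCompactSupport_deriv_prof
  have hD10 : 0 ≤ D1 := (norm_nonneg _).trans (hD1 0)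
  obtain ⟨D2, hD2⟩ := contDiff_deriv2_prof.continuous.bounded_above_of_compact_support
    hasCompactSupport_deriv2_prof
  set ε : ℕ → ℝ := fun n => 1 / ((n : ℝ) + 1) with hεd
  have hε : ∀ n, 0 < ε n := fun n => by simp only [hεd]; positivity
  have hε0 : Tendsto ε atTop (𝓝 0) := tendsto_one_div_add_atTop_nhds_zero_nat
  have hσm : ∀ n, Measurable fun x : Euc N => -2 * ε n * Real.log ‖x‖ := fun n =>
    (Real.measurable_log.comp measurable_norm).const_mul _
  set F : ℕ → Euc N → ℝ := fun n x =>
    u x * (prof (-2 * ε n * Real.log ‖x‖) * LstarMuV N (mu0 N) V ξ x) * gam x with hF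
  set F1 : ℕ → Euc N → ℝ := fun n x =>
    u x * (-(4 * ε n) * deriv prof (-2 * ε n * Real.log ‖x‖) / ‖x‖ ^ 2 * fderiv ℝ ξ x x) * gam x with hF1
  set F2 : ℕ → Euc N → ℝ := fun n x =>
    u x * (4 * ε n ^ 2 * deriv (deriv prof) (-2 * ε n * Real.log ‖x‖) / ‖x‖ ^ 2 * ξ x) * gam x with hF2
  have hFm : ∀ n, Measurable (F n) := fun n =>
    (hum.mul ((contDiff_prof.continuous.measurable.comp (hσm n)).mul (A.measurable_LstarMuV hξ))).mul hgm
  have hF1m : ∀ n, Measurable (F1 n) := fun n => (hum.mul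
    (((((contDiff_deriv_prof.continuous.measurable.comp (hσm n)).const_mul _).div
      (measurable_norm.pow_const 2))).mul (measurable_fderiv_self hξ))).mul hgm
  have hF2m : ∀ n, Measurable (F2 n) := fun n => (hum.mul
    (((((contDiff_deriv2_prof.continuous.measurable.comp (hσm n)).const_mul _).div
      (measurable_norm.pow_const 2))).mul hξm)).mul hgm
  have hFb : ∀ n, ∀ᵐ x : Euc N, ‖F n x‖ ≤
      (ball (0 : Euc N) R).indicator (fun x => C * K * ‖x‖ ^ (p - 1)) x := fun n => by
    filter_upwards [ae_ne_zero hN] with x hx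
    refine hbound (Q := fun x => prof (-2 * ε n * Real.log ‖x‖) * LstarMuV N (mu0 N) V ξ x) hK
      (fun y hy => ?_) (fun y hy => ?_) x hx
    · rw [abs_mul, abs_of_nonneg (prof_nonneg _)]
      exact (mul_le_of_le_one_left (abs_nonneg _) (prof_le_one _)).trans (hLb y hy)
    · rw [LstarMuV_eq_zero hy, mul_zero]
  have hFi : ∀ n, Integrable (F n) := fun n => (hpI _).mono' (hFm n).aestronglyMeasurable (hFb n)
  have hF1b : ∀ n, ∀ᵐ x : Euc N, ‖F1 n x‖ ≤
      ε n * (ball (0 : Euc N) R).indicator (fun x => C * (4 * D1 * M) * ‖x‖ ^ (p - 1)) x := fun n => by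
    filter_upwards [ae_ne_zero hN] with x hx
    have := hbound (Q := fun x => -4 * deriv prof (-2 * ε n * Real.log ‖x‖) / ‖x‖ ^ 2 * fderiv ℝ ξ x x)
      (B := 4 * D1 * M) (by positivity) (fun y hy => ?_) (fun y hy => ?_) x hx
    · calc ‖F1 n x‖ = ε n * |u x * (-4 * deriv prof (-2 * ε n * Real.log ‖x‖) / ‖x‖ ^ 2 *
            fderiv ℝ ξ x x) * gam x| := by
            rw [← abs_of_pos (hε n), ← abs_mul, Real.norm_eq_abs, abs_of_pos (hε n)]
            congr 1; simp only [hF1]; ring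
        _ ≤ _ := mul_le_mul_of_nonneg_left this (hε n).le
    · have hpy := norm_pos_iff.2 hy
      have hd := hD1 (-2 * ε n * Real.log ‖y‖)
      rw [Real.norm_eq_abs] at hd
      rw [abs_mul, abs_div, abs_mul, abs_of_pos (show 0 < ‖y‖ ^ 2 by positivity), abs_neg,
        abs_of_pos (show (0 : ℝ) < 4 by norm_num)]
      calc 4 * |deriv prof (-2 * ε n * Real.log ‖y‖)| / ‖y‖ ^ 2 * |fderiv ℝ ξ y y|
          ≤ 4 * D1 / ‖y‖ ^ 2 * (M * ‖y‖) := by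
            gcongr
            exact abs_fderiv_self_le hM y
        _ = 4 * D1 * M * ‖y‖⁻¹ := by field_simp
    · rw [(notMem_tsupport_iff_eventuallyEq.1 hy).fderiv_eq]
      simp
  have hF1i : ∀ n, Integrable (F1 n) := fun n =>
    ((hpI _).const_mul _).mono' (hF1m n).aestronglyMeasurable (hF1b n)
  have hF2e : ∀ n, ∀ x, x ≠ 0 → F2 n x = u x / (gam x * -Real.log ‖x‖) * ξ x * (‖x‖ ^ (-(N : ℝ)) *
      (2 * ε n * ((-2 * ε n * Real.log ‖x‖) * deriv (deriv prof) (-2 * ε n * Real.log ‖x‖)))) := fun n x hx => by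
    have hpx := norm_pos_iff.2 hx
    have hg := gam_pos hx
    by_cases hl : Real.log ‖x‖ = 0
    · simp only [hF2, hl, mul_zero]
      rw [deriv2_prof_of_notMem (by simp)]
      simp
    have e : ‖x‖ ^ (-(N : ℝ)) = gam x * gam x / ‖x‖ ^ 2 := by
      rw [gam_sq hx, ← Real.rpow_natCast, ← Real.rpow_sub hpx]
      congr 1; push_cast; ring
    simp only [hF2]
    rw [e]
    field_simp
    ring
  have hq : Continuous fun σ => σ * deriv (deriv prof) σ := continuous_id.mul contDiff_deriv2_prof.continuous
  have hqs : ∀ σ, σ ∉ Set.Icc (1 : ℝ) 2 → σ * deriv (deriv prof) σ = 0 := fun σ h => by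
    rw [deriv2_prof_of_notMem h, mul_zero]
  have hlim2 : Tendsto (fun x => u x / (gam x * -Real.log ‖x‖) * ξ x) (𝓝[≠] 0) (𝓝 (ξ 0)) := by
    simpa using hlim.mul ((continuous_of_isC11c hξ).continuousAt.tendsto.mono_left nhdsWithin_le_nhds)
  have hGm : Measurable fun x => u x / (gam x * -Real.log ‖x‖) * ξ x :=
    (hum.div (hgm.mul (Real.measurable_log.comp measurable_norm).neg)).mul hξm
  have hT2 : Tendsto (fun n => ∫ x, F2 n x) atTop (𝓝 (sphereArea N * ξ 0)) := by
    have := tendsto_integral_mul_log hN hq hqs hGm hlim2 hε hε0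
    rw [integral_mul_deriv2_prof, mul_one, mul_comm] at this
    refine this.congr fun n => integral_congr_ae ?_
    filter_upwards [ae_ne_zero hN] with x hx using (hF2e n x hx).symm
  have hT1 : Tendsto (fun n => ∫ x, F1 n x) atTop (𝓝 0) := by
    have h0 := hε0.mul_const
      (∫ x, (ball (0 : Euc N) R).indicator (fun x => C * (4 * D1 * M) * ‖x‖ ^ (p - 1)) x)
    rw [zero_mul] at h0
    refine squeeze_zero_norm (fun n => ?_) h0
    rw [← integral_const_mul]
    exact norm_integral_le_of_norm_le ((hpI _).const_mul _) (hF1b n)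
  have hT : Tendsto (fun n => ∫ x, F n x) atTop (𝓝 (∫ x, u x * LstarMuV N (mu0 N) V ξ x * gam x)) := by
    refine tendsto_integral_of_dominated_convergence _ (fun n => (hFm n).aestronglyMeasurable) (hpI _) hFb ?_
    refine Eventually.of_forall fun x => ?_
    have h1 : Tendsto (fun n => -2 * ε n * Real.log ‖x‖) atTop (𝓝 0) := by
      simpa using (hε0.const_mul (-2)).mul_const (Real.log ‖x‖)
    refine tendsto_const_nhds.congr' ?_
    filter_upwards [h1.eventually (gt_mem_nhds one_pos)] with n hn
    simp only [hF]
    rw [prof_of_le hn.le, one_mul]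
  obtain ⟨B, hB⟩ := (continuous_of_isC11c hξ).bounded_above_of_compact_support hξ.1
  have hD20 : 0 ≤ D2 := (norm_nonneg _).trans (hD2 0)
  have hB0 : 0 ≤ B := (norm_nonneg _).trans (hB 0)
  have hlog : ∀ n, ∀ x : Euc N, x ≠ 0 → -2 * ε n * Real.log ‖x‖ ≤ 2 → Real.exp (-1 / ε n) ≤ ‖x‖ := fun n x hx h => by
    rw [← Real.le_log_iff_exp_le (norm_pos_iff.2 hx), div_le_iff₀ (hε n)]
    nlinarith
  have hinv : ∀ n, ∀ x : Euc N, x ≠ 0 → -2 * ε n * Real.log ‖x‖ ≤ 2 →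
      (‖x‖ ^ 2)⁻¹ ≤ (Real.exp (-1 / ε n))⁻¹ * ‖x‖⁻¹ := fun n x hx h => by
    have hpx := norm_pos_iff.2 hx
    have := hlog n x hx h
    rw [sq, mul_inv]
    gcongr
  have hF2b : ∀ n, ∀ᵐ x : Euc N, ‖F2 n x‖ ≤ (ball (0 : Euc N) R).indicator
      (fun x => C * (4 * ε n ^ 2 * D2 * B * (Real.exp (-1 / ε n))⁻¹) * ‖x‖ ^ (p - 1)) x := fun n => by
    filter_upwards [ae_ne_zero hN] with x hx
    refine hbound (Q := fun x => 4 * ε n ^ 2 * deriv (deriv prof) (-2 * ε n * Real.log ‖x‖) / ‖x‖ ^ 2 * ξ x)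
      (by positivity) (fun y hy => ?_) (fun y hy => ?_) x hx
    · have hpy := norm_pos_iff.2 hy
      rcases lt_or_ge 2 (-2 * ε n * Real.log ‖y‖) with h2 | h2
      · rw [deriv2_prof_of_notMem fun h => by linarith [h.2]]
        simp only [mul_zero, zero_div, zero_mul, abs_zero]
        positivity
      · have hd := hD2 (-2 * ε n * Real.log ‖y‖)
        have hb := hB y
        rw [Real.norm_eq_abs] at hd hb
        rw [abs_mul, abs_div, abs_mul, abs_of_pos (show 0 < ‖y‖ ^ 2 by positivity),
          abs_of_nonneg (show 0 ≤ 4 * ε n ^ 2 by positivity), div_eq_mul_inv]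
        calc 4 * ε n ^ 2 * |deriv (deriv prof) (-2 * ε n * Real.log ‖y‖)| * (‖y‖ ^ 2)⁻¹ * |ξ y|
            ≤ 4 * ε n ^ 2 * D2 * ((Real.exp (-1 / ε n))⁻¹ * ‖y‖⁻¹) * B := by
              gcongr
              exact hinv n y hy h2
          _ = _ := by ring
    · rw [image_eq_zero_of_notMem_tsupport hy, mul_zero]
  have hF2i : ∀ n, Integrable (F2 n) := fun n =>
    (hpI _).mono' (hF2m n).aestronglyMeasurable (hF2b n)
  have key : ∀ n, ∫ x, F n x = ∫ x, F1 n x + F2 n x := fun n => by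
    have hρ := Real.exp_pos (-1 / ε n)
    have hg0 : ∀ x, ‖x‖ < Real.exp (-1 / ε n) → lcut N (ε n) x * ξ x = 0 := fun x hx => by
      rw [lcut_eq_zero (hε n) hN hx, zero_mul]
    have hgc : IsC11c fun x => lcut N (ε n) x * ξ x := isC11c_contDiff_mul (contDiff_lcut (hε n) hN) hξ
    have h := integral_mul_lap_of_vanishing hu hgc hρ hg0
    set Q : Euc N → ℝ := fun x => mu0 N * V x * prof (-2 * ε n * Real.log ‖x‖) * ξ x with hQ
    have hQb : ∀ᵐ x : Euc N, ‖u x * Q x * gam x‖ ≤ (ball (0 : Euc N) R).indicator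
        (fun x => C * (mu0 N * (Real.exp (-1 / ε n))⁻¹ * B) * ‖x‖ ^ (p - 1)) x := by
      filter_upwards [ae_ne_zero hN] with x hx
      refine hbound (by positivity) (fun y hy => ?_) (fun y hy => ?_) x hx
      · have hpy := norm_pos_iff.2 hy
        have hV := A.pos y hy
        have hV2 := A.hi y hy
        rw [Real.rpow_neg hpy.le, Real.rpow_ofNat] at hV2
        rcases lt_or_ge 2 (-2 * ε n * Real.log ‖y‖) with h2 | h2
        · simp only [hQ]
          rw [prof_of_ge h2.le]
          simp only [mul_zero, zero_mul, abs_zero]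
          positivity
        · have hb := hB y
          rw [Real.norm_eq_abs] at hb
          simp only [hQ]
          rw [abs_mul, abs_mul, abs_of_pos (mul_pos hm hV), abs_of_nonneg (prof_nonneg _)]
          calc mu0 N * V y * prof (-2 * ε n * Real.log ‖y‖) * |ξ y|
              ≤ mu0 N * ((Real.exp (-1 / ε n))⁻¹ * ‖y‖⁻¹) * 1 * B := by
                gcongr
                · exact prof_nonneg _
                · exact hV2.trans (hinv n y hy h2)
                · exact prof_le_one _
            _ = _ := by ring
      · simp only [hQ]
        rw [image_eq_zero_of_notMem_tsupport hy, mul_zero]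
    have hQm : Measurable fun x => u x * Q x * gam x :=
      (hum.mul (((A.measurable.const_mul _).mul (contDiff_prof.continuous.measurable.comp (hσm n))).mul hξm)).mul hgm
    have hQi : Integrable fun x => u x * Q x * gam x := (hpI _).mono' hQm.aestronglyMeasurable hQb
    have e1 : ∫ x, lap u x * (lcut N (ε n) x * ξ x) = -∫ x, u x * Q x * gam x := by
      rw [← integral_neg]
      refine integral_congr_ae ?_
      filter_upwards [ae_ne_zero hN] with x hx
      simp only [hQ]
      rw [hlap x hx, lcut]
      ring
    have e2 : ∫ x, u x * lap (fun x => lcut N (ε n) x * ξ x) x =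
        ∫ x, (F1 n x + F2 n x - F n x) - u x * Q x * gam x := by
      refine integral_congr_ae ?_
      filter_upwards [ae_ne_zero hN, ae_differentiableAt_fderiv hξ] with x hx hx'
      have h3 := lap_lcut_mul (hε n) hN V hξ.2.1 hx hx'
      simp only [hQ, hF, hF1, hF2]
      rw [lcut] at h3
      linear_combination u x * h3
    have h12 : Integrable fun x => F1 n x + F2 n x := (hF1i n).add (hF2i n)
    have h123 : Integrable fun x => F1 n x + F2 n x - F n x := h12.sub (hFi n)
    rw [e1, e2, integral_sub h123 hQi, integral_sub h12 (hFi n)] at h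
    linarith
  refine tendsto_nhds_unique hT ?_
  have := hT1.add hT2
  rw [zero_add] at this
  refine this.congr fun n => ?_
  rw [key, integral_add (hF1i n) (hF2i n)]

end

section

variable {N : ℕ} {γ c : ℝ} {V : Euc N → ℝ}

/-- A smooth convex function vanishing on the negative half-line, of slope one beyond one. -/
def ramp (σ : ℝ) : ℝ := ∫ τ in (0 : ℝ)..σ, Real.smoothTransition τ

lemma continuous_smoothTransition : Continuous Real.smoothTransition :=
  Real.smoothTransition.continuous

lemma hasDerivAt_ramp (σ : ℝ) : HasDerivAt ramp (Real.smoothTransition σ) σ :=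
  (continuous_smoothTransition.integral_hasStrictDerivAt 0 σ).hasDerivAt

lemma contDiff_smoothTransition : ContDiff ℝ ∞ Real.smoothTransition :=
  Real.smoothTransition.contDiff (n := ⊤)

lemma contDiff_ramp : ContDiff ℝ ∞ ramp := by
  refine contDiff_infty_iff_deriv.2 ⟨fun σ => (hasDerivAt_ramp σ).differentiableAt, ?_⟩
  rw [show deriv ramp = Real.smoothTransition from funext fun σ => (hasDerivAt_ramp σ).deriv]
  exact contDiff_smoothTransition

lemma ramp_sub (a b : ℝ) : ramp b - ramp a = ∫ τ in a..b, Real.smoothTransition τ :=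
  intervalIntegral.integral_interval_sub_left (continuous_smoothTransition.intervalIntegrable _ _)
    (continuous_smoothTransition.intervalIntegrable _ _)

lemma ramp_sub_nonneg {a b : ℝ} (h : a ≤ b) : 0 ≤ ramp b - ramp a := by
  rw [ramp_sub]
  exact intervalIntegral.integral_nonneg h fun τ _ => Real.smoothTransition.nonneg τ

lemma ramp_sub_le {a b : ℝ} (h : a ≤ b) : ramp b - ramp a ≤ b - a := by
  rw [ramp_sub]
  refine (intervalIntegral.integral_mono_on h (continuous_smoothTransition.intervalIntegrable _ _)
    (intervalIntegrable_const (c := (1 : ℝ))) fun τ _ => Real.smoothTransition.le_one τ).trans (by simp)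

lemma ramp_of_nonpos {a : ℝ} (h : a ≤ 0) : ramp a = 0 := by
  rw [ramp, intervalIntegral.integral_congr (g := fun _ => 0), intervalIntegral.integral_zero]
  intro τ hτ
  rw [Set.uIcc_of_ge h] at hτ
  exact Real.smoothTransition.zero_of_nonpos hτ.2

lemma ramp_sub_of_one_le {a b : ℝ} (h1 : 1 ≤ a) (h : a ≤ b) : ramp b - ramp a = b - a := by
  rw [ramp_sub, intervalIntegral.integral_congr (g := fun _ => 1), intervalIntegral.integral_const]
  · simp
  intro τ hτ
  rw [Set.uIcc_of_le h] at hτ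
  exact Real.smoothTransition.one_of_one_le (h1.trans hτ.1)

lemma hasDerivAt_smoothTransition (σ : ℝ) :
    HasDerivAt Real.smoothTransition (deriv Real.smoothTransition σ) σ :=
  (contDiff_smoothTransition.differentiable (by simp) σ).hasDerivAt

lemma deriv_smoothTransition_nonneg (σ : ℝ) : 0 ≤ deriv Real.smoothTransition σ :=
  Real.smoothTransition.monotone.deriv_nonneg

lemma deriv_smoothTransition_of_notMem {σ : ℝ} (h : σ ∉ Set.Icc (0 : ℝ) 1) :
    deriv Real.smoothTransition σ = 0 := by
  rw [Set.mem_Icc, not_and_or, not_le, not_le] at h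
  rcases h with h | h
  · have : Real.smoothTransition =ᶠ[𝓝 σ] fun _ => 0 := by
      filter_upwards [gt_mem_nhds h] with y hy using Real.smoothTransition.zero_of_nonpos hy.le
    rw [this.deriv_eq, deriv_const]
  · have : Real.smoothTransition =ᶠ[𝓝 σ] fun _ => 1 := by
      filter_upwards [lt_mem_nhds h] with y hy using Real.smoothTransition.one_of_one_le hy.le
    rw [this.deriv_eq, deriv_const]

lemma exists_deriv_smoothTransition_bound : ∃ D, 0 < D ∧ ∀ σ, deriv Real.smoothTransition σ ≤ D := by
  obtain ⟨D, hD⟩ := (contDiff_infty_iff_deriv.1 contDiff_smoothTransition).2.continuous.bounded_above_of_compact_support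
    (HasCompactSupport.of_support_subset_isCompact isCompact_Icc
      fun σ h => by_contra fun h' => h (deriv_smoothTransition_of_notMem h'))
  exact ⟨D + 1, by linarith [(norm_nonneg _).trans (hD 0)], fun σ =>
    (le_abs_self _).trans ((hD σ).trans (by linarith))⟩

/-- A radial test function growing logarithmically between two scales. -/
def logTest (N : ℕ) (α β : ℝ) (x : Euc N) : ℝ :=
  if x = 0 then β - α else ramp (β - 2 * Real.log ‖x‖) - ramp (α - 2 * Real.log ‖x‖)

variable {α β : ℝ}

lemma logTest_zero : logTest N α β 0 = β - α := if_pos rfl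

lemma logTest_of_ne {x : Euc N} (hx : x ≠ 0) :
    logTest N α β x = ramp (β - 2 * Real.log ‖x‖) - ramp (α - 2 * Real.log ‖x‖) := if_neg hx

lemma logTest_nonneg (h : α ≤ β) (x : Euc N) : 0 ≤ logTest N α β x := by
  by_cases hx : x = 0
  · rw [hx, logTest_zero]; linarith
  · rw [logTest_of_ne hx]; exact ramp_sub_nonneg (by linarith)

lemma logTest_le (h : α ≤ β) (x : Euc N) : logTest N α β x ≤ β - α := by
  by_cases hx : x = 0
  · rw [hx, logTest_zero]
  · rw [logTest_of_ne hx]; exact (ramp_sub_le (by linarith)).trans (by linarith)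

lemma logTest_eq_zero (h : α ≤ β) {x : Euc N} (hx : Real.exp (β / 2) ≤ ‖x‖) : logTest N α β x = 0 := by
  have hp : 0 < ‖x‖ := (Real.exp_pos _).trans_le hx
  have := (Real.le_log_iff_exp_le hp).2 hx
  rw [logTest_of_ne (norm_pos_iff.1 hp), ramp_of_nonpos (by linarith), ramp_of_nonpos (by linarith), sub_zero]

lemma logTest_eq_const (h : α ≤ β) {x : Euc N} (hx : ‖x‖ < Real.exp ((α - 1) / 2)) :
    logTest N α β x = β - α := by
  by_cases h0 : x = 0
  · rw [h0, logTest_zero]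
  have := (Real.log_lt_iff_lt_exp (norm_pos_iff.2 h0)).2 hx
  rw [logTest_of_ne h0, ramp_sub_of_one_le (by linarith) (by linarith)]
  ring

lemma isC11c_logTest (h : α ≤ β) : IsC11c (logTest N α β) := by
  refine isC11c_of_contDiff (contDiff_iff_contDiffAt.2 fun x => ?_)
    (HasCompactSupport.of_support_subset_isCompact (isCompact_closedBall 0 (Real.exp (β / 2))) fun x hx => ?_)
  · rcases eq_or_ne x 0 with rfl | hx
    · refine (contDiffAt_const (c := β - α)).congr_of_eventuallyEq ?_
      filter_upwards [ball_mem_nhds (0 : Euc N) (Real.exp_pos ((α - 1) / 2))] with y hy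
      exact logTest_eq_const h (by simpa using hy)
    · have hr : ContDiff ℝ 2 ramp := by exact_mod_cast contDiff_infty.1 contDiff_ramp 2
      have hl : ContDiffAt ℝ 2 (fun y : Euc N => Real.log ‖y‖) x := contDiffAt_log_norm hx
      have hc : ∀ b : ℝ, ContDiffAt ℝ 2 (fun y : Euc N => ramp (b - 2 * Real.log ‖y‖)) x := fun b =>
        hr.contDiffAt.comp x (contDiffAt_const.sub (contDiffAt_const.mul hl))
      refine ((hc β).sub (hc α)).congr_of_eventuallyEq ?_
      filter_upwards [isOpen_ne.mem_nhds hx] with y hy using logTest_of_ne hy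
  · rw [mem_closedBall_zero_iff]
    by_contra! h'
    exact hx (logTest_eq_zero h h'.le)

/-- The weighted adjoint operator on radial functions. -/
lemma LstarMuV_radial (V : Euc N → ℝ) {ξ : Euc N → ℝ} {g g1 : ℝ → ℝ} {g2 : ℝ} {x : Euc N} (hx : x ≠ 0)
    (hξ : ξ =ᶠ[𝓝 x] fun y => g (‖y‖ ^ 2))
    (h1 : ∀ᶠ t in 𝓝 (‖x‖ ^ 2), HasDerivAt g (g1 t) t) (h2 : HasDerivAt g1 g2 (‖x‖ ^ 2)) :
    LstarMuV N (mu0 N) V ξ x = -4 * (‖x‖ ^ 2 * g2 + g1 (‖x‖ ^ 2)) +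
      mu0 N * (‖x‖ ^ (-2 : ℝ) - V x) * ξ x := by
  have hp : 0 < ‖x‖ := norm_pos_iff.2 hx
  rw [LstarMuV, LstarMu, lap_congr hξ, lap_radial h1 h2, hξ.fderiv_eq,
    (hasFDerivAt_radial h1.self_of_nhds).fderiv, mu0_tauPlus]
  simp only [smul_apply, innerSL_apply_apply, smul_eq_mul, real_inner_self_eq_norm_sq]
  field_simp
  ring

lemma LstarMuV_logTest (V : Euc N → ℝ) {x : Euc N} (hx : x ≠ 0) :
    LstarMuV N (mu0 N) V (logTest N α β) x =
      4 * (deriv Real.smoothTransition (α - 2 * Real.log ‖x‖) -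
        deriv Real.smoothTransition (β - 2 * Real.log ‖x‖)) / ‖x‖ ^ 2 +
      mu0 N * (‖x‖ ^ (-2 : ℝ) - V x) * logTest N α β x := by
  have hp : 0 < ‖x‖ := norm_pos_iff.2 hx
  have ht : 0 < ‖x‖ ^ 2 := by positivity
  have hlog : ‖x‖ ^ 2 = ‖x‖ ^ 2 → Real.log (‖x‖ ^ 2) = 2 * Real.log ‖x‖ := fun _ => by
    rw [Real.log_pow]; norm_num
  have hd : ∀ {P : ℝ → ℝ} {P1 : ℝ → ℝ} (_ : ∀ σ, HasDerivAt P (P1 σ) σ) (b : ℝ) {t : ℝ}, 0 < t →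
      HasDerivAt (fun t => P (b - Real.log t)) (-(P1 (b - Real.log t) * t⁻¹)) t := by
    intro P P1 hP b t ht
    refine ((hP _).comp t ((Real.hasDerivAt_log ht.ne').const_sub b)).congr_deriv ?_
    ring
  have h1 : ∀ᶠ t in 𝓝 (‖x‖ ^ 2), HasDerivAt (fun t => ramp (β - Real.log t) - ramp (α - Real.log t))
      ((Real.smoothTransition (α - Real.log t) - Real.smoothTransition (β - Real.log t)) * t⁻¹) t := by
    filter_upwards [lt_mem_nhds ht] with t ht
    refine ((hd hasDerivAt_ramp β ht).sub (hd hasDerivAt_ramp α ht)).congr_deriv ?_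
    ring
  have h2 := (((hd hasDerivAt_smoothTransition α ht).sub (hd hasDerivAt_smoothTransition β ht)).mul
    (hasDerivAt_inv ht.ne'))
  have hξ : logTest N α β =ᶠ[𝓝 x] fun y => (fun t => ramp (β - Real.log t) - ramp (α - Real.log t)) (‖y‖ ^ 2) := by
    filter_upwards [isOpen_ne.mem_nhds hx] with y hy
    rw [logTest_of_ne hy]
    simp only [Real.log_pow]
    norm_num
  rw [LstarMuV_radial V hx hξ h1 h2]
  simp only [hlog rfl, Pi.sub_apply]
  field_simp
  ring

/-- A test function on which the weighted adjoint operator is bounded below near the origin. -/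
lemma AdmV.exists_coercive_test (A : AdmV N γ c V) : ∃ ξ : Euc N → ℝ, IsC11c ξ ∧ ξ 0 = 1 ∧
    ∀ x, x ≠ 0 → ‖x‖ < 1 → 4 ≤ LstarMuV N (mu0 N) V ξ x := by
  obtain ⟨χ, hχ, hχc, hχ1⟩ := exists_cutoff (N := N) 1
  have hs : ContDiff ℝ 2 fun x : Euc N => 1 - ‖x‖ ^ 2 := contDiff_const.sub (contDiff_norm_sq ℝ)
  refine ⟨fun x => (1 - ‖x‖ ^ 2) * χ x, isC11c_contDiff_mul hs
    (isC11c_of_contDiff (contDiff_two_of_infty hχ) hχc), by simp [hχ1 0], fun x hx hx1 => ?_⟩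
  have hp : 0 < ‖x‖ := norm_pos_iff.2 hx
  have hξ : (fun x => (1 - ‖x‖ ^ 2) * χ x) =ᶠ[𝓝 x] fun y => (fun t : ℝ => 1 - t) (‖y‖ ^ 2) := by
    filter_upwards [continuous_norm.continuousAt.eventually (gt_mem_nhds hx1)] with y hy
    rw [hχ1 y hy, mul_one]
  rw [LstarMuV_radial V hx hξ (g1 := fun _ => -1) (g2 := 0)
    (Eventually.of_forall fun t => (hasDerivAt_id t).const_sub 1) (hasDerivAt_const _ _), hχ1 x hx1]
  have h1 : 0 ≤ mu0 N * (‖x‖ ^ (-2 : ℝ) - V x) * ((1 - ‖x‖ ^ 2) * 1) :=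
    mul_nonneg (mul_nonneg (mu0_pos A.hN).le (by linarith [A.hi x hx])) (by nlinarith)
  linarith

end

section

variable {N : ℕ} {γ c : ℝ} {V : Euc N → ℝ}

/-- The annulus carrying the concave part of the logarithmic test function. -/
def logAnn (N : ℕ) (α : ℝ) : Set (Euc N) :=
  {x | Real.exp ((α - 1) / 2) ≤ ‖x‖ ∧ ‖x‖ ≤ Real.exp (α / 2)}

lemma measurableSet_logAnn (α : ℝ) : MeasurableSet (logAnn N α) :=
  (measurableSet_le measurable_const measurable_norm).inter
    (measurableSet_le measurable_norm measurable_const)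

lemma logAnn_subset_ball {α ρ : ℝ} (h : Real.exp (α / 2) < ρ) : logAnn N α ⊆ ball 0 ρ := fun x hx => by
  rw [mem_ball_zero_iff]
  exact hx.2.trans_lt h

/-- A function with a nontrivial distributional identity at the origin has mass of logarithmic
size on small annuli. -/
lemma AdmV.exists_annulus_mass (A : AdmV N γ c V) {v : Euc N → ℝ} (hvm : Measurable v)
    (hv0 : ∀ x ≠ 0, 0 ≤ v x) {K : ℝ} (hK : 0 < K)
    (hid : ∀ ξ : Euc N → ℝ, IsC11c ξ → ξ 0 ≠ 0 →
      Integrable (fun x => v x * LstarMuV N (mu0 N) V ξ x * gam x) ∧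
      ∫ x, v x * LstarMuV N (mu0 N) V ξ x * gam x = K * ξ 0) :
    IntegrableOn (fun x => v x * gam x) (ball 0 1) ∧ ∃ m β : ℝ, 0 < m ∧ β ≤ 0 ∧ ∀ α < β,
      m * (β - α) * Real.exp α ≤ ∫ x in logAnn N α, v x * gam x := by
  have hN := A.hN
  have hm := mu0_pos hN
  have hc := A.hc
  have : Nontrivial (Euc N) := nontrivial_euc hN
  have hw0 : ∀ x ≠ 0, 0 ≤ v x * gam x := fun x hx => mul_nonneg (hv0 x hx) (gam_nonneg x)
  have hwi : IntegrableOn (fun x => v x * gam x) (ball 0 1) := by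
    obtain ⟨ξ, hξ, hξ0, hξL⟩ := A.exists_coercive_test
    refine (hid ξ hξ (by simp [hξ0])).1.integrableOn.mono' (hvm.mul measurable_gam).aestronglyMeasurable ?_
    filter_upwards [ae_restrict_of_ae (ae_ne_zero hN), ae_restrict_mem measurableSet_ball] with x hx hx1
    have := hξL x hx (by simpa using hx1)
    rw [Real.norm_eq_abs, abs_of_nonneg (hw0 x hx), mul_right_comm]
    exact le_mul_of_one_le_right (hw0 x hx) (by linarith)
  refine ⟨hwi, ?_⟩
  obtain ⟨n, hn⟩ : ∃ n : ℕ, mu0 N * c * ∫ x in ball (0 : Euc N) (1 / ((n : ℝ) + 1)), v x * gam x < K / 2 := by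
    have hanti : Antitone fun n : ℕ => ball (0 : Euc N) (1 / ((n : ℝ) + 1)) := fun i j hij =>
      ball_subset_ball (one_div_le_one_div_of_le (by positivity) (by exact_mod_cast Nat.succ_le_succ hij))
    have h1 := tendsto_setIntegral_of_antitone (μ := volume) (f := fun x => v x * gam x)
      (fun n : ℕ => (measurableSet_ball : MeasurableSet (ball (0 : Euc N) (1 / ((n : ℝ) + 1))))) hanti
      ⟨0, by simpa using hwi⟩
    have h2 : (⋂ n : ℕ, ball (0 : Euc N) (1 / ((n : ℝ) + 1))) ⊆ {0} := fun x hx => by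
      by_contra h
      obtain ⟨n, hn⟩ := exists_nat_one_div_lt (norm_pos_iff.2 h)
      have := Set.mem_iInter.1 hx n
      rw [mem_ball_zero_iff] at this
      linarith
    rw [setIntegral_measure_zero _ (measure_mono_null h2 (by simp))] at h1
    have h3 := h1.const_mul (mu0 N * c)
    rw [mul_zero] at h3
    exact (h3.eventually (gt_mem_nhds (half_pos hK))).exists
  set ρ : ℝ := 1 / ((n : ℝ) + 1) with hρ
  have hρ0 : 0 < ρ := by positivity
  have hρ1 : ρ ≤ 1 := by rw [hρ, div_le_one (by positivity)]; linarith [n.cast_nonneg (α := ℝ)]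
  obtain ⟨D, hD, hDb⟩ := exists_deriv_smoothTransition_bound
  have hβ : Real.exp (2 * Real.log ρ / 2) = ρ := by
    rw [mul_div_cancel_left₀ _ two_ne_zero, Real.exp_log hρ0]
  refine ⟨K / (8 * D * Real.exp 1), 2 * Real.log ρ, by positivity,
    by linarith [Real.log_nonpos hρ0.le hρ1], fun α hα => ?_⟩
  set β := 2 * Real.log ρ
  have hαρ : Real.exp (α / 2) < ρ := by rw [← hβ]; exact Real.exp_lt_exp.2 (by linarith)
  obtain ⟨hi, hI⟩ := hid (logTest N α β) (isC11c_logTest hα.le) (by rw [logTest_zero]; linarith)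
  have hi1 : IntegrableOn (fun x => v x * gam x) (logAnn N α) :=
    hwi.mono_set (logAnn_subset_ball (hαρ.trans_le hρ1))
  have hi2 : IntegrableOn (fun x => v x * gam x) (ball 0 ρ) := hwi.mono_set (ball_subset_ball hρ1)
  have hpt : ∀ x : Euc N, x ≠ 0 → v x * LstarMuV N (mu0 N) V (logTest N α β) x * gam x ≤
      4 * D * Real.exp (1 - α) * (logAnn N α).indicator (fun x => v x * gam x) x +
        mu0 N * c * (β - α) * (ball (0 : Euc N) ρ).indicator (fun x => v x * gam x) x := fun x hx => by
    have hp := norm_pos_iff.2 hx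
    have hw := hw0 x hx
    have h1 : 4 * (deriv Real.smoothTransition (α - 2 * Real.log ‖x‖) -
        deriv Real.smoothTransition (β - 2 * Real.log ‖x‖)) / ‖x‖ ^ 2 * (v x * gam x) ≤
        4 * D * Real.exp (1 - α) * (logAnn N α).indicator (fun x => v x * gam x) x := by
      have hd := deriv_smoothTransition_nonneg (β - 2 * Real.log ‖x‖)
      by_cases hxa : x ∈ logAnn N α
      · rw [Set.indicator_of_mem hxa]
        refine mul_le_mul_of_nonneg_right ?_ hw
        have h2 : Real.exp (α - 1) ≤ ‖x‖ ^ 2 := by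
          rw [show α - 1 = (α - 1) / 2 + (α - 1) / 2 by ring, Real.exp_add, sq]
          exact mul_self_le_mul_self (Real.exp_pos _).le hxa.1
        rw [show (1 - α) = -(α - 1) by ring, Real.exp_neg, ← div_eq_mul_inv]
        have := hDb (α - 2 * Real.log ‖x‖)
        exact div_le_div₀ (by positivity) (by linarith) (Real.exp_pos _) h2
      · rw [Set.indicator_of_notMem hxa, mul_zero, deriv_smoothTransition_of_notMem]
        · refine mul_nonpos_of_nonpos_of_nonneg (div_nonpos_of_nonpos_of_nonneg (by linarith) (by positivity)) hw
        · refine fun h => hxa ⟨?_, ?_⟩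
          · rw [← Real.le_log_iff_exp_le hp]; linarith [h.2]
          · rw [← Real.log_le_iff_le_exp hp]; linarith [h.1]
    have h2 : mu0 N * (‖x‖ ^ (-2 : ℝ) - V x) * logTest N α β x * (v x * gam x) ≤
        mu0 N * c * (β - α) * (ball (0 : Euc N) ρ).indicator (fun x => v x * gam x) x := by
      by_cases hxb : x ∈ ball (0 : Euc N) ρ
      · rw [Set.indicator_of_mem hxb]
        refine mul_le_mul_of_nonneg_right ?_ hw
        refine mul_le_mul (mul_le_mul_of_nonneg_left (by linarith [A.lo x hx]) hm.le) (logTest_le hα.le x)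
          (logTest_nonneg hα.le x) (by positivity)
      · rw [Set.indicator_of_notMem hxb, logTest_eq_zero hα.le (by rw [hβ]; simpa using hxb)]
        simp
    rw [LstarMuV_logTest V hx]
    linarith
  have hle : K * (β - α) ≤ 4 * D * Real.exp (1 - α) * (∫ x in logAnn N α, v x * gam x) +
      mu0 N * c * (β - α) * ∫ x in ball (0 : Euc N) ρ, v x * gam x := by
    rw [logTest_zero] at hI
    rw [← hI, ← integral_indicator (measurableSet_logAnn α), ← integral_indicator measurableSet_ball,
      ← integral_const_mul, ← integral_const_mul]
    have i1 := (hi1.integrable_indicator (measurableSet_logAnn α)).const_mul (4 * D * Real.exp (1 - α))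
    have i2 := (hi2.integrable_indicator measurableSet_ball).const_mul (mu0 N * c * (β - α))
    rw [← integral_add i1 i2]
    refine integral_mono_ae hi (i1.add i2) ?_
    filter_upwards [ae_ne_zero hN] with x hx using hpt x hx
  have hba : 0 < β - α := by linarith
  have h4 : K / 2 * (β - α) ≤ 4 * D * Real.exp (1 - α) * ∫ x in logAnn N α, v x * gam x := by
    nlinarith
  rw [Real.exp_sub] at h4
  have he := Real.exp_pos α
  have he1 := Real.exp_pos 1
  have h5 : 4 * D * (Real.exp 1 / Real.exp α) * (∫ x in logAnn N α, v x * gam x) * Real.exp α =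
      4 * D * Real.exp 1 * ∫ x in logAnn N α, v x * gam x := by field_simp
  have h6 := (mul_le_mul_of_nonneg_right h4 he.le).trans_eq h5
  rw [div_mul_eq_mul_div, div_mul_eq_mul_div, div_le_iff₀ (by positivity)]
  linarith

/-- Lower bound of a supersolution by its mass on a set. -/
lemma mul_setIntegral_le_of_TL_le (hN : 3 ≤ N) {v : Euc N → ℝ} (hv0 : ∀ x ≠ 0, 0 ≤ v x) {y : Euc N}
    (hy : y ≠ 0) (hTL : TL V (fun x => ENNReal.ofReal (v x)) y ≤ ENNReal.ofReal (v y)) {S : Set (Euc N)}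
    (hS : MeasurableSet S) {b : ℝ} (hb : 0 ≤ b)
    (hk : ∀ x ∈ S, x ≠ 0 → x ≠ y → b * gam x ≤ (kap N)⁻¹ * (nk (y - x) * (mu0 N * V x)))
    (hi : IntegrableOn (fun x => v x * gam x) S) : b * ∫ x in S, v x * gam x ≤ v y := by
  have : Nontrivial (Euc N) := nontrivial_euc hN
  have hkap : 0 < (kap N)⁻¹ := inv_pos.2 (kap_pos hN)
  refine (ENNReal.ofReal_le_ofReal_iff (hv0 y hy)).1 (le_trans ?_ hTL)
  have hne : ∀ᵐ x : Euc N, x ≠ y := compl_mem_ae_iff.2 (measure_singleton y)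
  rw [← integral_const_mul, ofReal_integral_eq_lintegral_ofReal (hi.const_mul b) (by
    filter_upwards [ae_restrict_of_ae (ae_ne_zero hN)] with x hx
    exact mul_nonneg hb (mul_nonneg (hv0 x hx) (gam_nonneg x)))]
  unfold TL
  rw [← lintegral_const_mul' _ _ ENNReal.ofReal_ne_top]
  refine le_trans ?_ (setLIntegral_le_lintegral S _)
  refine lintegral_mono_ae ?_
  filter_upwards [ae_restrict_of_ae (ae_ne_zero hN), ae_restrict_of_ae hne, ae_restrict_mem hS] with x hx hxy hxS
  rw [← ENNReal.ofReal_mul' (hv0 x hx), ← ENNReal.ofReal_mul hkap.le]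
  refine ENNReal.ofReal_le_ofReal ?_
  have := mul_le_mul_of_nonneg_right (hk x hxS hx hxy) (hv0 x hx)
  linarith

/-- A nonnegative supersolution with a nontrivial distributional identity dominates a multiple of
the explicit subsolution. -/
lemma AdmV.exists_mul_subsol_le (A : AdmV N γ c V) {v : Euc N → ℝ} (hvm : Measurable v)
    (hv0 : ∀ x ≠ 0, 0 ≤ v x)
    (hTL : ∀ x ≠ 0, TL V (fun y => ENNReal.ofReal (v y)) x ≤ ENNReal.ofReal (v x)) {K : ℝ} (hK : 0 < K)
    (hid : ∀ ξ : Euc N → ℝ, IsC11c ξ → ξ 0 ≠ 0 →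
      Integrable (fun x => v x * LstarMuV N (mu0 N) V ξ x * gam x) ∧
      ∫ x, v x * LstarMuV N (mu0 N) V ξ x * gam x = K * ξ 0) {r₀ : ℝ} (hr₀ : r₀ < 1) :
    ∃ ε, 0 < ε ∧ ∀ x ≠ 0, ε * subsol r₀ x ≤ v x := by
  have hN := A.hN
  have hN' : (3 : ℝ) ≤ N := by exact_mod_cast hN
  have hm := mu0_pos hN
  have hc := A.hc
  have hkap : 0 < (kap N)⁻¹ := inv_pos.2 (kap_pos hN)
  obtain ⟨hwi, m, β₀, hm0, hβ₀, hmass⟩ := A.exists_annulus_mass hvm hv0 hK hid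
  set β : ℝ := min β₀ (min (-1) (-Real.log (2 * c))) with hβ
  have hββ₀ : β ≤ β₀ := min_le_left _ _
  have hβ1 : β ≤ -1 := (min_le_right _ _).trans (min_le_left _ _)
  have hβc : β ≤ -Real.log (2 * c) := (min_le_right _ _).trans (min_le_right _ _)
  set s : ℝ := ((N : ℝ) - 2) / 2 with hs
  have hs0 : 0 < s := by rw [hs]; linarith
  set C : ℝ := (kap N)⁻¹ * mu0 N / 2 * Real.exp (-s / 2) * m with hC
  have hC0 : 0 < C := by positivity
  have main : ∀ y ≠ 0, ∀ α < β,
      C * (‖y‖ + Real.exp (α / 2)) ^ (2 - (N : ℝ)) * Real.exp (α / 2 * s) * (β - α) ≤ v y := by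
    intro y hy α hα
    have hyp := norm_pos_iff.2 hy
    have hea := Real.exp_pos (α / 2)
    have hr : ∀ x ∈ logAnn N α, (Real.exp α)⁻¹ / 2 ≤ V x := fun x hx => by
      have hp : 0 < ‖x‖ := (Real.exp_pos _).trans_le hx.1
      have h1 : (Real.exp α)⁻¹ ≤ ‖x‖ ^ (-2 : ℝ) := by
        rw [Real.rpow_neg hp.le, Real.rpow_ofNat]
        refine inv_anti₀ (by positivity) ?_
        rw [show α = α / 2 + α / 2 by ring, Real.exp_add, sq]
        exact mul_self_le_mul_self hp.le hx.2
      have h2 : 2 * c ≤ (Real.exp α)⁻¹ := by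
        rw [← Real.exp_neg, ← Real.log_le_iff_le_exp (by positivity)]
        linarith
      have := A.lo x (norm_pos_iff.1 hp)
      linarith
    have hg : ∀ x ∈ logAnn N α, gam x ≤ Real.exp (-((α - 1) / 2 * s)) := fun x hx => by
      rw [gam, show -((N : ℝ) - 2) / 2 = -s by rw [hs]; ring]
      refine (Real.rpow_le_rpow_of_nonpos (Real.exp_pos _) hx.1 (by linarith)).trans (le_of_eq ?_)
      rw [← Real.exp_mul]
      ring_nf
    have hb := mul_setIntegral_le_of_TL_le hN hv0 hy (hTL y hy) (measurableSet_logAnn α)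
      (b := (kap N)⁻¹ * ((‖y‖ + Real.exp (α / 2)) ^ (2 - (N : ℝ)) * (mu0 N * ((Real.exp α)⁻¹ / 2))) *
        Real.exp ((α - 1) / 2 * s)) (by positivity) (fun x hx hx0 hxy => ?_)
      (hwi.mono_set (logAnn_subset_ball (Real.exp_lt_one_iff.2 (by linarith))))
    · refine le_trans ?_ ((mul_le_mul_of_nonneg_left ((mul_le_mul_of_nonneg_right
        (mul_le_mul_of_nonneg_left (sub_le_sub_right hββ₀ α) hm0.le) (Real.exp_pos α).le).trans
          (hmass α (hα.trans_le hββ₀))) (by positivity)).trans hb)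
      refine le_of_eq ?_
      rw [show (α - 1) / 2 * s = α / 2 * s + -s / 2 by ring, Real.exp_add, hC]
      field_simp
    · have hxy' : 0 < ‖y - x‖ := norm_pos_iff.2 (sub_ne_zero.2 hxy.symm)
      have hn : (‖y‖ + Real.exp (α / 2)) ^ (2 - (N : ℝ)) ≤ nk (y - x) :=
        Real.rpow_le_rpow_of_nonpos hxy' ((norm_sub_le y x).trans (by linarith [hx.2])) (by linarith)
      rw [mul_assoc]
      calc (kap N)⁻¹ * ((‖y‖ + Real.exp (α / 2)) ^ (2 - (N : ℝ)) * (mu0 N * ((Real.exp α)⁻¹ / 2))) *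
            (Real.exp ((α - 1) / 2 * s) * gam x)
          ≤ (kap N)⁻¹ * (nk (y - x) * (mu0 N * V x)) *
            (Real.exp ((α - 1) / 2 * s) * Real.exp (-((α - 1) / 2 * s))) := by
            have hV := A.pos x hx0
            have := nk_nonneg (y - x)
            have := hr x hx
            have := hg x hx
            have := gam_nonneg x
            gcongr
        _ = _ := by rw [← Real.exp_add, add_neg_cancel, Real.exp_zero, mul_one]
  set c1 := C * 2 ^ (2 - (N : ℝ)) with hc1
  have hc10 : 0 < c1 := by positivity
  set c2 := C * 2 ^ (2 - (N : ℝ)) * Real.exp ((β - 1) / 2 * s) with hc2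
  have hc20 : 0 < c2 := by positivity
  set M := Real.exp (-(β * s)) * -β with hM
  have hM0 : 0 < M := mul_pos (Real.exp_pos _) (by linarith)
  refine ⟨min c1 (c2 / M), lt_min hc10 (by positivity), fun x hx => ?_⟩
  have hp := norm_pos_iff.2 hx
  rcases le_or_gt r₀ ‖x‖ with hxr | hxr
  · rw [subsol_eq_zero hxr, mul_zero]; exact hv0 x hx
  have hgx := gam_pos hx
  have hsub : subsol r₀ x ≤ gam x * -Real.log ‖x‖ := by
    rw [subsol_eq hxr]
    have : Real.log r₀ ≤ 0 := Real.log_nonpos (hp.le.trans hxr.le) hr₀.le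
    exact mul_le_mul_of_nonneg_left (by linarith) hgx.le
  have hsub0 := subsol_nonneg hr₀ hx
  rcases le_or_gt (Real.log ‖x‖) β with hl | hl
  · have := main x hx (2 * Real.log ‖x‖) (by linarith)
    have e1 : Real.exp (2 * Real.log ‖x‖ / 2) = ‖x‖ := by
      rw [mul_div_cancel_left₀ _ two_ne_zero, Real.exp_log hp]
    have e2 : ‖x‖ ^ (2 - (N : ℝ)) * Real.exp (2 * Real.log ‖x‖ / 2 * s) = gam x := by
      rw [Real.exp_mul, e1, gam, ← Real.rpow_add hp, hs]
      ring_nf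
    rw [e1, ← two_mul, Real.mul_rpow zero_le_two hp.le] at this
    calc min c1 (c2 / M) * subsol r₀ x ≤ c1 * (gam x * -Real.log ‖x‖) :=
          mul_le_mul (min_le_left _ _) hsub hsub0 hc10.le
      _ ≤ c1 * (gam x * (β - 2 * Real.log ‖x‖)) := by
          gcongr; linarith
      _ ≤ v x := by rw [← e2, hc1]; linarith
  · have := main x hx (β - 1) (by linarith)
    have h1 : (2 : ℝ) ^ (2 - (N : ℝ)) ≤ (‖x‖ + Real.exp ((β - 1) / 2)) ^ (2 - (N : ℝ)) := by
      have h3 : Real.exp ((β - 1) / 2) < 1 := Real.exp_lt_one_iff.2 (by linarith)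
      exact Real.rpow_le_rpow_of_nonpos (by positivity) (by linarith) (by linarith)
    have h2 : c2 ≤ v x := by
      refine le_trans ?_ this
      rw [hc2, sub_sub_cancel, mul_one]
      gcongr
    have h3 : subsol r₀ x ≤ M := by
      refine hsub.trans (mul_le_mul ?_ (by linarith) (by
        have := Real.log_nonpos hp.le (hxr.le.trans hr₀.le); linarith) (Real.exp_pos _).le)
      rw [gam, show -((N : ℝ) - 2) / 2 = -s by rw [hs]; ring]
      refine (Real.rpow_le_rpow_of_nonpos (Real.exp_pos β) ((Real.lt_log_iff_exp_lt hp).1 hl).le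
        (by linarith)).trans (le_of_eq ?_)
      rw [← Real.exp_mul]
      ring_nf
    calc min c1 (c2 / M) * subsol r₀ x ≤ c2 / M * M := mul_le_mul (min_le_right _ _) h3 hsub0 (by positivity)
      _ = c2 := div_mul_cancel₀ _ hM0.ne'
      _ ≤ v x := h2

end

section

variable {N : ℕ} {γ c : ℝ} {V : Euc N → ℝ}

lemma AdmV.integrable_mul_LstarMuV (A : AdmV N γ c V) {u : Euc N → ℝ} (hum : Measurable u)
    (hu0 : ∀ x ≠ 0, 0 ≤ u x) {p C : ℝ} (hp : 1 - (N : ℝ) < p) (hC : 0 ≤ C)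
    (hb : ∀ x ≠ 0, u x * gam x ≤ C * ‖x‖ ^ p) {ξ : Euc N → ℝ} (hξ : IsC11c ξ) :
    Integrable fun x => u x * LstarMuV N (mu0 N) V ξ x * gam x := by
  obtain ⟨R, K, -, hK, hRs, hLb⟩ := A.exists_LstarMuV_bound hξ
  refine (integrable_indicator_rpow A.hN (p := p - 1) (by linarith) (C * K) R).mono'
    ((hum.mul (A.measurable_LstarMuV hξ)).mul measurable_gam).aestronglyMeasurable ?_
  filter_upwards [ae_ne_zero A.hN] with x hx
  by_cases hxs : x ∈ tsupport ξ
  · have hpx := norm_pos_iff.2 hx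
    rw [Set.indicator_of_mem (by rw [mem_ball_zero_iff]; by_contra! h; exact hRs x h hxs),
      Real.norm_eq_abs, mul_right_comm, abs_mul,
      abs_of_nonneg (mul_nonneg (hu0 x hx) (gam_nonneg x)), Real.rpow_sub_one hpx.ne']
    calc u x * gam x * |LstarMuV N (mu0 N) V ξ x| ≤ C * ‖x‖ ^ p * (K * ‖x‖⁻¹) :=
          mul_le_mul (hb x hx) (hLb x hx) (abs_nonneg _) (by positivity)
      _ = _ := by rw [div_eq_mul_inv]; ring
  · rw [LstarMuV_eq_zero hxs, mul_zero, zero_mul, norm_zero]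
    exact Set.indicator_nonneg (fun y _ => by positivity) x

lemma AdmV.TL_le_of_solution (A : AdmV N γ c V) {v : Euc N → ℝ} (hv0 : ∀ x ≠ 0, 0 ≤ v x)
    (hv : ∀ x ≠ 0, ContDiffAt ℝ 2 v x) (hlap : ∀ x ≠ 0, lap v x = -(mu0 N * V x * v x)) :
    ∀ x ≠ 0, TL V (fun y => ENNReal.ofReal (v y)) x ≤ ENNReal.ofReal (v x) :=
  A.TL_le_of_supersolution hv0
    (locHolderOn_of_contDiffAt A.hγ A.hγ1 fun x hx => (hv x hx).of_le one_le_two)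
    fun x hx => ⟨v, hv x hx, rfl, .of_forall fun _ => le_rfl, (hlap x hx).le⟩

/-- The rescaled minimal function is below every positive solution with the same singular mass. -/
lemma IsMin.mul_le_of_distribIdentity {ϱ r₀ : ℝ} {u : Euc N → ℝ} (h : IsMin V ϱ r₀ u)
    (A : AdmV N γ c V) (hϱ : ϱ < 1) {k : ℝ} (hk : 0 < k) {v : Euc N → ℝ} (hv0 : ∀ x ≠ 0, 0 < v x)
    (hv : ∀ x ≠ 0, ContDiffAt ℝ 2 v x) (hlap : ∀ x ≠ 0, lap v x = -(mu0 N * V x * v x))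
    (hid : ∀ ξ : Euc N → ℝ, IsC11c ξ →
      ∫ x, v x * LstarMuV N (mu0 N) V ξ x * gam x = sphereArea N * k * ξ 0) :
    ∀ x ≠ 0, k * u x ≤ v x := by
  have hN := A.hN
  have hsA := sphereArea_pos hN
  obtain ⟨p, C, hp, hC, hb⟩ := h.exists_bound hN hϱ
  have hu0 : ∀ x ≠ 0, 0 ≤ u x := fun x hx => (h.pos x hx).le
  have hum : Measurable u := measurable_of_continuousOn_ne fun x hx =>
    (h.contDiffAt x hx).continuousAt.continuousWithinAt
  have hvm : Measurable v := measurable_of_continuousOn_ne fun x hx =>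
    (hv x hx).continuousAt.continuousWithinAt
  set S : Set ℝ := {a | ∀ x ≠ 0, a * u x ≤ v x} with hS
  have hdown : ∀ a ∈ S, ∀ b ≤ a, b ∈ S := fun a ha b hb x hx =>
    (mul_le_mul_of_nonneg_right hb (hu0 x hx)).trans (ha x hx)
  by_contra hcon
  have hbdd : BddAbove S := ⟨k, fun a ha => le_of_not_gt fun hka => hcon (hdown a ha k hka.le)⟩
  have h0S : (0 : ℝ) ∈ S := fun x hx => by rw [zero_mul]; exact (hv0 x hx).le
  have hclosed : IsClosed S := by
    simp only [hS, Set.ofPred_forall]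
    exact isClosed_iInter fun x => isClosed_iInter fun _ =>
      isClosed_le (continuous_id.mul continuous_const) continuous_const
  set a := sSup S with ha
  have haS : a ∈ S := hclosed.csSup_mem ⟨0, h0S⟩ hbdd
  have hak : a < k := lt_of_not_ge fun hka => hcon (hdown a haS k hka)
  set w : Euc N → ℝ := fun x => v x - a * u x with hw
  have hw0 : ∀ x ≠ 0, 0 ≤ w x := fun x hx => sub_nonneg.2 (haS x hx)
  have hau : ∀ x ≠ 0, ContDiffAt ℝ 2 (fun y => a * u y) x := fun x hx =>
    contDiffAt_const.mul (h.contDiffAt x hx)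
  have hwc : ∀ x ≠ 0, ContDiffAt ℝ 2 w x := fun x hx => (hv x hx).sub (hau x hx)
  have hwl : ∀ x ≠ 0, lap w x = -(mu0 N * V x * w x) := fun x hx => by
    rw [hw, lap_sub (hv x hx) (hau x hx), lap_const_mul a (h.contDiffAt x hx), hlap x hx, h.lap_eq x hx]
    ring
  obtain ⟨ε, hε, hεw⟩ := A.exists_mul_subsol_le (v := w) (hvm.sub (hum.const_mul a)) hw0
    (A.TL_le_of_solution hw0 hwc hwl) (K := sphereArea N * (k - a)) (mul_pos hsA (sub_pos.2 hak))
    (fun ξ hξ hξ0 => by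
      have hvi : Integrable fun x => v x * LstarMuV N (mu0 N) V ξ x * gam x := by
        by_contra hni
        have h1 := hid ξ hξ
        rw [integral_undef hni] at h1
        exact mul_ne_zero (mul_pos hsA hk).ne' hξ0 h1.symm
      have hui := (A.integrable_mul_LstarMuV hum hu0 hp hC hb hξ).const_mul a
      have e : ∀ x, w x * LstarMuV N (mu0 N) V ξ x * gam x =
          v x * LstarMuV N (mu0 N) V ξ x * gam x - a * (u x * LstarMuV N (mu0 N) V ξ x * gam x) :=
        fun x => by simp only [hw]; ring
      simp only [e]
      refine ⟨hvi.sub hui, ?_⟩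
      rw [integral_sub hvi hui, hid ξ hξ, integral_const_mul,
        A.integral_mul_LstarMuV h.contDiffAt h.lap_eq hu0 hp hC hb (h.tendsto hN hϱ) hξ]
      ring) h.r₀_lt
  have hz0 : ∀ x ≠ 0, 0 ≤ ε⁻¹ * w x := fun x hx => mul_nonneg (inv_pos.2 hε).le (hw0 x hx)
  have hz := h.le_of_super (fun x => ε⁻¹ * w x) hz0
    (A.TL_le_of_solution hz0 (fun x hx => contDiffAt_const.mul (hwc x hx)) fun x hx => by
      rw [lap_const_mul _ (hwc x hx), hwl x hx]; ring)
    (fun x hx => (le_inv_mul_iff₀ hε).2 (hεw x hx))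
  have hmem : a + ε ∈ S := fun x hx => by
    have h1 := (le_inv_mul_iff₀ hε).1 (hz x hx)
    have h2 : w x = v x - a * u x := rfl
    linarith
  linarith [le_csSup hbdd hmem]

end

end CritHardy

open CritHardy

/-- Theorem 4.3: fundamental solutions in the critical case μ = μ₀. -/
theorem existence_minimal_solution_critical
    (N : ℕ) (hN : 3 ≤ N)
    (γ : ℝ) (hγ : 0 < γ ∧ γ < 1) (V : Euc N → ℝ)
    (hVreg : LocHolderOn γ {x : Euc N | x ≠ 0} V)
    (hVpos : ∀ x : Euc N, x ≠ 0 → 0 < V x)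
    (c : ℝ) (hc : 0 < c)
    (hV : ∀ x : Euc N, x ≠ 0 → ‖x‖ ^ (-2 : ℝ) - c ≤ V x ∧ V x ≤ ‖x‖ ^ (-2 : ℝ))
    (ϱ : ℝ) (hϱ : ϱ < 1)
    (hVinf : limsup (fun x : Euc N => V x * ‖x‖ ^ 2) (normAtTop N) = ϱ)
    (k : ℝ) (hk : 0 < k) :
    ∃ u : Euc N → ℝ,
      (∀ x : Euc N, x ≠ 0 → 0 < u x) ∧
      IsSolution N (mu0 N) V u ∧
      DistribIdentity N (mu0 N) V u k ∧
      (∀ v : Euc N → ℝ, (∀ x : Euc N, x ≠ 0 → 0 < v x) → IsSolution N (mu0 N) V v →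
        DistribIdentity N (mu0 N) V v k → ∀ x : Euc N, x ≠ 0 → u x ≤ v x) ∧
      Tendsto (fun x : Euc N => u x / (‖x‖ ^ (-((N : ℝ) - 2) / 2) * (-Real.log ‖x‖)))
        (nhdsWithin (0 : Euc N) {x : Euc N | x ≠ 0}) (nhds k) ∧
      (∀ μ' : ℝ, ϱ * mu0 N < μ' → μ' < mu0 N → ∃ c₁₀ : ℝ, 0 < c₁₀ ∧
        ∀ x : Euc N, 1 ≤ ‖x‖ → u x ≤ c₁₀ * ‖x‖ ^ tauMinus N μ') := by
  have A : AdmV N γ c V := ⟨hN, hγ.1, hγ.2, hVreg, hVpos, hc, fun x hx => (hV x hx).1,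
    fun x hx => (hV x hx).2⟩
  obtain ⟨r₀, u, h⟩ := A.exists_isMin hϱ hVinf
  obtain ⟨p, C, hp, hC, hb⟩ := h.exists_bound hN hϱ
  have hlim := h.tendsto hN hϱ
  have hu0 : ∀ x ≠ 0, 0 ≤ u x := fun x hx => (h.pos x hx).le
  refine ⟨fun x => k * u x, fun x hx => mul_pos hk (h.pos x hx),
    ⟨fun x hx => (contDiffAt_const.mul (h.contDiffAt x hx)).contDiffWithinAt, fun x hx => ?_⟩,
    fun ξ hξ => ?_, fun v hv0 hv hvid => ?_, ?_, fun μ' h1 h2 => ?_⟩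
  · rw [lap_const_mul _ (h.contDiffAt x hx), h.lap_eq x hx]
    ring
  · rw [mu0_tauPlus, cMu_mu0]
    have e : ∀ x, k * u x * LstarMuV N (mu0 N) V ξ x * ‖x‖ ^ (-((N : ℝ) - 2) / 2) =
        k * (u x * LstarMuV N (mu0 N) V ξ x * gam x) := fun x => by rw [gam]; ring
    simp only [e]
    rw [integral_const_mul, A.integral_mul_LstarMuV h.contDiffAt h.lap_eq hu0 hp hC hb hlim hξ]
    ring
  · refine h.mul_le_of_distribIdentity A hϱ hk hv0
      (fun x hx => hv.1.contDiffAt (isOpen_ne.mem_nhds hx)) (fun x hx => ?_) fun ξ hξ => ?_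
    · linarith [hv.2 x hx]
    · have := hvid ξ hξ
      rwa [mu0_tauPlus, cMu_mu0] at this
  · have := hlim.const_mul k
    rw [mul_one] at this
    exact this.congr fun x => (mul_div_assoc _ _ _).symm
  · obtain ⟨R, hR, hle⟩ := h.le_supsol μ' h1 h2
    have hδ : 0 < Real.sqrt (mu0 N - μ') := Real.sqrt_pos.2 (sub_pos.2 h2)
    have hR0 : 0 < R := by linarith
    refine ⟨k * ((Real.sqrt (mu0 N - μ'))⁻¹ * R ^ Real.sqrt (mu0 N - μ')), by positivity,
      fun x hx => ?_⟩
    have hx0 : x ≠ 0 := norm_pos_iff.1 (one_pos.trans_le hx)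
    rw [mul_assoc]
    exact mul_le_mul_of_nonneg_left ((hle x hx0).trans (supsol_le hδ hR0 hx0)) hk.le
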